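/- Let η ∈ {1,2} and let q, r, s be primes with q ≡ 3 (mod 4), r ≡ s ≡ 5 (mod 8), Legendre symbols (q/r) = (q/s) = (−1)^{δ_{η,2}} and (r/s) = 1, let (γ, γ′) be the fundamental solution of X² − ηqrs·Y² = 1, and assume 2^{δ_{η,1}}·q·(γ−1) is not a perfect square. Then for every integer n ≥ 0, the n-th layer F_n of the cyclotomic ℤ₂-extension of F = ℚ(√(ηqrs)) satisfies h₂(F_n) = h₂(ηqrs). -/

import Mathlib

open IntermediateField NumberField

/-- The `n`-th layer `k(2·cos(2π/2^(n+2)))` of the cyclotomic `ℤ₂`-extension of a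
(totally real) subfield of `ℝ`. -/
noncomputable def layer (F : IntermediateField ℚ ℝ) (n : ℕ) : IntermediateField ℚ ℝ :=
  F ⊔ IntermediateField.adjoin ℚ {2 * Real.cos (2 * Real.pi / 2 ^ (n + 2))}

/-- The 2-part of the class number of a subfield of `ℝ` (the largest power of 2 dividing
the cardinality of the class group of its ring of integers). -/
noncomputable def h2 (F : IntermediateField ℚ ℝ) : ℕ :=
  2 ^ ((Nat.card (ClassGroup (NumberField.RingOfIntegers F))).factorization 2)

set_option linter.all false

section
open Subgroup in
theorem chev_abstract {M N : Type*} [CommGroup M] [CommGroup N] (sM : M →* M) (sN : N →* N)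
    (hsM : ∀ x, sM (sM x) = x) (hsN : ∀ x, sN (sN x) = x) (d : M →* N)
    (hd : ∀ x, d (sM x) = sN (d x))
    (h90 : ∀ x, x * sM x = 1 → ∃ y, x = y / sM y)
    (Mfix : Subgroup M) (hMfix : ∀ x, x ∈ Mfix ↔ sM x = x)
    (Nfix : Subgroup N) (hNfix : ∀ x, x ∈ Nfix ↔ sN x = x)
    (IK : Subgroup N) (hIK : IK ≤ Nfix) (hPK : Mfix.map d ≤ IK)
    (hidx : IK.relIndex Nfix ∣ 2)
    (E1 Em NE EK : Subgroup M)
    (hE1 : ∀ x, x ∈ E1 ↔ ∃ e, d e = 1 ∧ e / sM e = x)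
    (hEm : ∀ x, x ∈ Em ↔ d x = 1 ∧ x * sM x = 1)
    (hNE : ∀ x, x ∈ NE ↔ ∃ e, d e = 1 ∧ e * sM e = x)
    (hEK : ∀ x, x ∈ EK ↔ d x = 1 ∧ sM x = x)
    (hE : E1.relIndex Em = 2 * NE.relIndex EK)
    (Z : Subgroup N) (hZ : ∀ a, a ∈ Z ↔ ∃ x, d x = a / sN a) :
    d.range.relIndex Z ∣ (Mfix.map d).relIndex IK := by
  let f : N →* N := MonoidHom.id N / sN
  have hf : ∀ a, f a = a / sN a := fun a => rfl
  let g : M →* M := MonoidHom.id M / sM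
  have hg : ∀ a, g a = a / sM a := fun a => rfl
  let ν : M →* M := MonoidHom.id M * sM
  have hν : ∀ a, ν a = a * sM a := fun a => rfl
  have hν90 : ∀ x, ν x = 1 → ∃ y, x = g y := h90
  have hνg : ∀ y, ν (g y) = 1 := by
    intro y; rw [hν, hg, map_div, hsM, div_mul_div_comm, mul_comm (sM y), div_self']
  have hfd : ∀ y, f (d y) = d (g y) := by intro y; rw [hf, hg, map_div, hd]
  have hdZ : d.range ≤ Z := by
    rintro _ ⟨y, rfl⟩; rw [hZ]; exact ⟨g y, (hfd y).symm⟩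
  have hNZ : Nfix ≤ Z := by
    intro a ha; rw [hZ]; rw [hNfix] at ha; exact ⟨1, by simp [ha]⟩
  set D := d.range with hD
  set D1 : Subgroup N := (g.range).map d with hD1
  let X : Subgroup M := (f.range).comap d
  have c1 : D1.comap f = Nfix ⊔ D := by
    ext a
    rw [mem_comap, mem_sup]
    constructor
    · rintro ⟨_, ⟨y, rfl⟩, hy⟩
      refine ⟨a / d y, ?_, d y, ⟨y, rfl⟩, by simp⟩
      rw [hNfix]
      have : f (a / d y) = 1 := by rw [map_div, hfd, hy, div_self']
      rw [hf, div_eq_one] at this; exact this.symm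
    · rintro ⟨b, hb, _, ⟨y, rfl⟩, rfl⟩
      rw [hNfix] at hb
      refine ⟨g y, ⟨y, rfl⟩, ?_⟩
      rw [map_mul, hfd, hf b, hb, div_self', one_mul]
  have c2 : Z.map f = X.map d := by
    ext b
    constructor
    · rintro ⟨a, ha, rfl⟩
      obtain ⟨x, hx⟩ := (hZ a).1 ha
      exact ⟨x, ⟨a, hx.symm⟩, hx⟩
    · rintro ⟨x, ⟨a, ha⟩, rfl⟩
      exact ⟨a, (hZ a).2 ⟨x, ha.symm⟩, ha⟩
  have c3 : D1.comap d = NE.comap ν := by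
    ext x
    rw [mem_comap, mem_comap, hNE]
    constructor
    · rintro ⟨_, ⟨y, rfl⟩, hy⟩
      refine ⟨x / g y, by rw [map_div, hy, div_self'], ?_⟩
      rw [← hν, map_div, hνg, div_one]
    · rintro ⟨e, he, h⟩
      obtain ⟨y, hy⟩ := hν90 (x / e) (by rw [map_div, hν e, h, div_self'])
      exact ⟨g y, ⟨y, rfl⟩, by rw [← hy, map_div, he, div_one]⟩
  have i1 : (Nfix ⊔ D).relIndex Z ∣ NE.relIndex EK := by
    rw [← c1, relIndex_comap, c2, ← relIndex_comap, c3, relIndex_comap]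
    have h1 : NE ≤ X.map ν := by
      intro x hx
      obtain ⟨e, he, rfl⟩ := (hNE x).1 hx
      exact ⟨e, ⟨1, by simp [he]⟩, rfl⟩
    have h2 : X.map ν ≤ EK := by
      rintro _ ⟨x, ⟨a, ha⟩, rfl⟩
      rw [hEK]
      constructor
      · rw [hν, map_mul, hd, ← ha, hf, map_div, hsN, div_mul_div_comm, mul_comm (sN a), div_self']
      · rw [hν, map_mul, hsM, mul_comm]
    rw [← relIndex_mul_relIndex _ _ _ h1 h2]
    exact dvd_mul_right _ _
  let Y : Subgroup M := (d.ker).comap g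
  have c4 : D ⊓ Nfix = Y.map d := by
    ext b
    constructor
    · rintro ⟨⟨x, rfl⟩, hx⟩
      have hx := (hNfix _).1 hx
      refine ⟨x, ?_, rfl⟩
      change d (g x) = 1
      rw [hg, map_div, hd, hx, div_self']
    · rintro ⟨x, hx, rfl⟩
      refine ⟨⟨x, rfl⟩, ?_⟩
      have hx : d (g x) = 1 := hx
      rw [hg, map_div, hd, div_eq_one] at hx
      exact (hNfix _).2 hx.symm
  have c5 : (Mfix.map d).comap d = E1.comap g := by
    ext x
    rw [mem_comap, mem_comap, hE1]
    constructor
    · rintro ⟨y, hy, h⟩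
      have hy : sM y = y := (hMfix y).1 hy
      refine ⟨x / y, by rw [map_div, h, div_self'], ?_⟩
      rw [← hg, map_div, hg y, hy, div_self', div_one]
    · rintro ⟨e, he, h⟩
      refine ⟨x / e, ?_, by rw [map_div, he, div_one]⟩
      rw [SetLike.mem_coe, hMfix]
      have : g (x / e) = 1 := by rw [map_div, hg e, h, div_self']
      rw [hg, div_eq_one] at this; exact this.symm
  have c6 : Y.map g = Em := by
    ext x
    rw [hEm]
    constructor
    · rintro ⟨y, hy, rfl⟩
      exact ⟨hy, hνg y⟩
    · rintro ⟨h1, h2⟩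
      obtain ⟨y, rfl⟩ := hν90 x h2
      exact ⟨y, h1, rfl⟩
  have i2 : (Mfix.map d).relIndex (D ⊓ Nfix) = 2 * NE.relIndex EK := by
    rw [c4, ← relIndex_comap, c5, relIndex_comap, c6, hE]
  have hPKD : Mfix.map d ≤ D ⊓ Nfix := by
    refine le_inf ?_ (hPK.trans hIK)
    rintro _ ⟨x, _, rfl⟩; exact ⟨x, rfl⟩
  have i3 := relIndex_mul_relIndex _ _ _ hPK hIK
  have i4 := relIndex_mul_relIndex _ _ _ hPKD inf_le_right
  have i5 : D.relIndex Z = D.relIndex Nfix * (Nfix ⊔ D).relIndex Z := by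
    rw [← relIndex_mul_relIndex D (Nfix ⊔ D) Z le_sup_right (sup_le hNZ hdZ), relIndex_sup_right]
  rw [i5, ← inf_relIndex_right]
  rw [i2, ← i3] at i4
  have h6 : 2 * ((D ⊓ Nfix).relIndex Nfix * NE.relIndex EK) ∣ 2 * (Mfix.map d).relIndex IK := by
    have : 2 * ((D ⊓ Nfix).relIndex Nfix * NE.relIndex EK)
      = (Mfix.map d).relIndex IK * IK.relIndex Nfix := by rw [← i4]; ring
    rw [this, mul_comm 2]
    exact mul_dvd_mul_left _ hidx
  exact (mul_dvd_mul_left _ i1).trans (Nat.dvd_of_mul_dvd_mul_left two_pos h6)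
end

section
open Subgroup in
theorem relIndex_congr_inf {G : Type*} [Group G] {H H' K : Subgroup G}
    (h : ∀ x ∈ K, x ∈ H ↔ x ∈ H') : H.relIndex K = H'.relIndex K := by
  rw [← inf_relIndex_right H, ← inf_relIndex_right H']
  congr 1
  ext x
  constructor
  · rintro ⟨h1, h2⟩; exact ⟨(h x h2).1 h1, h2⟩
  · rintro ⟨h1, h2⟩; exact ⟨(h x h2).2 h1, h2⟩

open Subgroup in
theorem unit_index_abstract {M : Type*} [CommGroup M] (s : M →* M) (hs : ∀ x, s (s x) = x)
    (E : Subgroup M) (hsE : ∀ x ∈ E, s x ∈ E) (z : M) (hzE : z ∈ E) (hz1 : z ≠ 1)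
    (hz2 : z ^ 2 = 1) (hsz : s z = z)
    (htor : ∀ x ∈ E, x ^ 2 = 1 → x = 1 ∨ x = z) (hnsq : ∀ x ∈ E, x ^ 2 ≠ z)
    (E1 Em NE EK : Subgroup M)
    (hE1 : ∀ x, x ∈ E1 ↔ ∃ e, e ∈ E ∧ e / s e = x)
    (hEm : ∀ x, x ∈ Em ↔ x ∈ E ∧ x * s x = 1)
    (hNE : ∀ x, x ∈ NE ↔ ∃ e, e ∈ E ∧ e * s e = x)
    (hEK : ∀ x, x ∈ EK ↔ x ∈ E ∧ s x = x) (D : ℕ)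
    (hE2 : (E.map (powMonoidHom 2)).relIndex E = 2 ^ (2 * D))
    (hK2 : (EK.map (powMonoidHom 2)).relIndex EK = 2 ^ D) :
    E1.relIndex Em = 2 * NE.relIndex EK := by
  let sq : M →* M := powMonoidHom 2
  have hsq : ∀ x, sq x = x ^ 2 := fun x => rfl
  let g : M →* M := MonoidHom.id M / s
  have hg : ∀ a, g a = a / s a := fun a => rfl
  let ν : M →* M := MonoidHom.id M * s
  have hν : ∀ a, ν a = a * s a := fun a => rfl
  set B := EK ⊔ Em with hB
  have hEKE : EK ≤ E := fun x hx => ((hEK x).1 hx).1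
  have hEmE : Em ≤ E := fun x hx => ((hEm x).1 hx).1
  have hBE : B ≤ E := sup_le hEKE hEmE
  have hzEK : z ∈ EK := (hEK z).2 ⟨hzE, hsz⟩
  have hzEm : z ∈ Em := (hEm z).2 ⟨hzE, by rw [hsz, ← pow_two, hz2]⟩
  have hgv : ∀ v ∈ Em, g v = v ^ 2 := by
    intro v hv
    have := ((hEm v).1 hv).2
    rw [hg, eq_inv_of_mul_eq_one_right this, div_inv_eq_mul, _root_.sq]
  have hga : ∀ v ∈ EK, g v = 1 := by
    intro v hv
    rw [hg, ((hEK v).1 hv).2, div_self']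
  have hνa : ∀ v ∈ EK, ν v = v ^ 2 := by
    intro v hv
    rw [hν, ((hEK v).1 hv).2, _root_.sq]
  have hνv : ∀ v ∈ Em, ν v = 1 := fun v hv => ((hEm v).1 hv).2
  have hsqB : E.map sq ≤ B := by
    rintro _ ⟨x, hx, rfl⟩
    have : sq x = (x * s x) * (x / s x) := by
      rw [hsq, pow_two, mul_div_assoc', mul_right_comm, mul_div_cancel_right]
    rw [this]
    refine mul_mem_sup ((hEK _).2 ⟨mul_mem hx (hsE x hx), by rw [map_mul, hs, mul_comm]⟩)
      ((hEm _).2 ⟨div_mem hx (hsE x hx), ?_⟩)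
    rw [map_div, hs, div_mul_div_comm, mul_comm (s x), div_self']
  have hBne : B.relIndex E ≠ 0 := by
    intro h
    have h2 := relIndex_mul_relIndex _ _ _ hsqB hBE
    rw [h, mul_zero] at h2
    exact absurd (h2.trans hE2).symm (by positivity)
  -- (b)
  have hmono : B.map sq ≤ E.map sq := map_mono hBE
  have hb : (B.map sq).relIndex B = 2 ^ (2 * D) := by
    have h1 := relIndex_mul_relIndex _ _ _ hmono (hsqB.trans hBE)
    have hBB : B.map sq ≤ B := hmono.trans hsqB
    have h2 := relIndex_mul_relIndex _ _ _ hBB hBE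
    have h3 : (B.map sq).relIndex (E.map sq) = B.relIndex E := by
      rw [← relIndex_comap]
      refine relIndex_congr_inf fun x hx => ?_
      rw [mem_comap]
      constructor
      · rintro ⟨b, hb, hbx⟩
        have : (x / b) ^ 2 = 1 := by rw [div_pow, ← hsq, ← hsq, hbx, div_self']
        rcases htor _ (div_mem hx (hBE hb)) this with h | h
        · rw [div_eq_one] at h; rw [h]; exact hb
        · rw [div_eq_iff_eq_mul] at h; rw [h]; exact mul_mem (le_sup_left (a := EK) hzEK) hb
      · intro h; exact ⟨x, h, rfl⟩
    rw [h3, ← h2, hE2, mul_comm] at h1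
    exact (Nat.eq_of_mul_eq_mul_right (Nat.pos_of_ne_zero hBne) h1).symm
  -- (c)
  set K2 := EK.map sq with hK2d
  set M2 := Em.map sq with hM2d
  have hBsq : B.map sq = K2 ⊔ M2 := by rw [hB, Subgroup.map_sup]
  have hK2le : K2 ≤ EK := by rintro _ ⟨x, hx, rfl⟩; exact pow_mem hx 2
  have hM2le : M2 ≤ Em := by rintro _ ⟨x, hx, rfl⟩; exact pow_mem hx 2
  have hinter : ∀ x ∈ EK, x ∈ Em → x = 1 ∨ x = z := by
    intro x hx hx'
    refine htor x (hEKE hx) ?_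
    rw [← hνa x hx, hνv x hx']
  have hc1 : (K2 ⊔ M2).relIndex (K2 ⊔ Em) = M2.relIndex Em := by
    have e : K2 ⊔ Em = Em ⊔ (K2 ⊔ M2) := by
      rw [← sup_assoc, sup_comm Em K2, sup_assoc, sup_eq_left.2 hM2le]
    rw [e, relIndex_sup_right]
    refine relIndex_congr_inf fun x hx => ?_
    constructor
    · intro h
      obtain ⟨a, ⟨a', ha', rfl⟩, b, hb, rfl⟩ := mem_sup.1 h
      have h1 : sq a' ∈ Em := by
        have := div_mem hx (hM2le hb); rwa [mul_div_cancel_right] at this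
      rcases hinter _ (pow_mem ha' 2) h1 with h | h
      · have : sq a' = 1 := h
        rw [this, one_mul]; exact hb
      · exact absurd h (hnsq a' (hEKE ha'))
    · intro h; exact le_sup_right (a := K2) h
  have hc2 : (K2 ⊔ Em).relIndex B = (K2 ⊔ zpowers z).relIndex EK := by
    have e : B = EK ⊔ (K2 ⊔ Em) := by rw [← sup_assoc, sup_eq_left.2 hK2le]
    rw [e, relIndex_sup_right]
    refine relIndex_congr_inf fun x hx => ?_
    constructor
    · intro h
      obtain ⟨a, ha, b, hb, rfl⟩ := mem_sup.1 h
      have h1 : b ∈ EK := by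
        have := div_mem hx (hK2le ha); rwa [mul_div_cancel_left] at this
      refine mul_mem_sup ha ?_
      rcases hinter _ h1 hb with h | h
      · rw [h]; exact one_mem _
      · rw [h]; exact mem_zpowers z
    · intro h
      have : K2 ⊔ zpowers z ≤ K2 ⊔ Em := sup_le_sup_left (by simpa using hzEm) _
      exact this h
  have hc3 : K2.relIndex (K2 ⊔ zpowers z) = 2 := by
    rw [sup_comm, relIndex_sup_right, ← inf_relIndex_right]
    have : K2 ⊓ zpowers z = ⊥ := by
      rw [eq_bot_iff]
      rintro x ⟨⟨a, ha, rfl⟩, hx⟩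
      obtain ⟨k, hk⟩ := hx
      rw [Subgroup.mem_bot]
      rcases Int.even_or_odd' k with ⟨j, rfl | rfl⟩
      · rw [← hk]; simp only [zpow_mul]; rw [show z ^ (2 : ℤ) = 1 by exact_mod_cast hz2]; simp
      · exfalso
        apply hnsq a (hEKE ha)
        change sq a = z
        rw [← hk]; simp only [zpow_add, zpow_mul]
        rw [show z ^ (2 : ℤ) = 1 by exact_mod_cast hz2]; simp
    rw [this, relIndex_bot_left, Nat.card_zpowers]
    exact orderOf_eq_prime hz2 hz1
  have hc4 : K2 ⊔ zpowers z ≤ EK := sup_le hK2le (by simpa using hzEK)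
  have hc5 := relIndex_mul_relIndex _ _ _ (le_sup_left : K2 ≤ K2 ⊔ zpowers z) hc4
  have hc6 := relIndex_mul_relIndex (K2 ⊔ M2) (K2 ⊔ Em) B (sup_le_sup_left hM2le _)
    (sup_le_sup_right hK2le _)
  rw [hc1, hc2, ← hBsq, hb] at hc6
  have hK2' : K2.relIndex EK = 2 ^ D := hK2
  rw [hc3, hK2'] at hc5
  have hc7 : M2.relIndex Em = 2 ^ (D + 1) := by
    have hpos : 0 < (K2 ⊔ zpowers z).relIndex EK := by
      rcases Nat.eq_zero_or_pos ((K2 ⊔ zpowers z).relIndex EK) with h | h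
      · rw [h, mul_zero] at hc5
        exact absurd hc5.symm (by positivity)
      · exact h
    apply Nat.eq_of_mul_eq_mul_right hpos
    rw [hc6, pow_succ, mul_assoc, hc5]
    ring
  -- (d)
  have hE1' : E1 = E.map g := by ext x; rw [hE1]; rfl
  have hNE' : NE = E.map ν := by ext x; rw [hNE]; rfl
  have hd1 : M2.relIndex E1 = B.relIndex E := by
    rw [hE1', ← relIndex_comap]
    refine relIndex_congr_inf fun x hx => ?_
    rw [mem_comap]
    constructor
    · rintro ⟨v, hv, h⟩
      have h1 : g (x / v) = 1 := by rw [map_div, hgv v hv, ← h, hsq, div_self']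
      rw [← div_mul_cancel x v]
      refine mul_mem_sup ((hEK _).2 ⟨div_mem hx (hEmE hv), ?_⟩) hv
      rw [hg, div_eq_one] at h1; exact h1.symm
    · intro h
      obtain ⟨a, ha, v, hv, rfl⟩ := mem_sup.1 h
      exact ⟨v, hv, by rw [map_mul, hga a ha, hgv v hv, one_mul, hsq]⟩
  have hd2 : K2.relIndex NE = B.relIndex E := by
    rw [hNE', ← relIndex_comap]
    refine relIndex_congr_inf fun x hx => ?_
    rw [mem_comap]
    constructor
    · rintro ⟨v, hv, h⟩
      have h1 : ν (x / v) = 1 := by rw [map_div, hνa v hv, ← h, hsq, div_self']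
      rw [← div_mul_cancel x v, mul_comm]
      exact mul_mem_sup hv ((hEm _).2 ⟨div_mem hx (hEKE hv), h1⟩)
    · intro h
      obtain ⟨a, ha, v, hv, rfl⟩ := mem_sup.1 h
      exact ⟨a, ha, by rw [map_mul, hνa a ha, hνv v hv, mul_one, hsq]⟩
  have hM2E1 : M2 ≤ E1 := by
    rintro _ ⟨v, hv, rfl⟩
    rw [hE1]; exact ⟨v, hEmE hv, hgv v hv⟩
  have hE1Em : E1 ≤ Em := by
    intro x hx
    obtain ⟨e, he, rfl⟩ := (hE1 x).1 hx
    refine (hEm _).2 ⟨div_mem he (hsE _ he), ?_⟩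
    rw [map_div, hs, div_mul_div_comm, mul_comm (s e), div_self']
  have hK2NE : K2 ≤ NE := by
    rintro _ ⟨v, hv, rfl⟩
    rw [hNE]; exact ⟨v, hEKE hv, hνa v hv⟩
  have hNEEK : NE ≤ EK := by
    intro x hx
    obtain ⟨e, he, rfl⟩ := (hNE x).1 hx
    refine (hEK _).2 ⟨mul_mem he (hsE _ he), ?_⟩
    rw [map_mul, hs, mul_comm]
  have f1 := relIndex_mul_relIndex _ _ _ hM2E1 hE1Em
  have f2 := relIndex_mul_relIndex _ _ _ hK2NE hNEEK
  rw [hd1, hc7] at f1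
  rw [hd2, hK2'] at f2
  apply Nat.eq_of_mul_eq_mul_left (Nat.pos_of_ne_zero hBne)
  rw [f1, pow_succ, ← f2]; ring
end

section
open NumberField

theorem unit_torsion_real (K : Type*) [Field K] [NumberField K] [IsTotallyReal K]
    (x : (𝓞 K)ˣ) (hx : IsOfFinOrder x) : x = 1 ∨ x = -1 := by
  obtain ⟨φ⟩ : Nonempty (K →+* ℂ) := inferInstance
  have hφ := IsTotallyReal.complexEmbedding_isReal φ
  let ψ : K →+* ℝ := hφ.embedding
  obtain ⟨n, hn, hxn⟩ := (isOfFinOrder_iff_pow_eq_one).1 hx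
  have h1 : (ψ (x : K)) ^ n = 1 := by
    rw [← map_pow, ← Units.coe_pow, hxn]; simp
  have h2 : |ψ (x : K)| = 1 := by
    have := congrArg abs h1
    rw [abs_pow, abs_one] at this
    exact (pow_eq_one_iff_of_nonneg (abs_nonneg _) hn.ne').1 this
  rcases (abs_eq zero_le_one).1 h2 with h | h
  · left
    ext
    apply ψ.injective
    rw [h]; simp
  · right
    ext
    apply ψ.injective
    rw [h]; simp

theorem unit_sq_index (K : Type*) [Field K] [NumberField K] [IsTotallyReal K] :
    (powMonoidHom 2 : (𝓞 K)ˣ →* (𝓞 K)ˣ).range.index = 2 ^ (Module.finrank ℚ K) := by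
  classical
  set S := (powMonoidHom 2 : (𝓞 K)ˣ →* (𝓞 K)ˣ).range with hS
  let T := Units.torsion K
  have h1 := Subgroup.relIndex_mul_index (le_sup_left : S ≤ S ⊔ T)
  have h2 : S.relIndex (S ⊔ T) = 2 := by
    rw [sup_comm, Subgroup.relIndex_sup_right, ← Subgroup.inf_relIndex_right]
    have : S ⊓ T = ⊥ := by
      rw [eq_bot_iff]
      rintro x ⟨⟨a, rfl⟩, hx⟩
      have h3 : IsOfFinOrder a := by
        have : IsOfFinOrder (a ^ 2) := hx
        exact (isOfFinOrder_pow.1 this).resolve_right (by norm_num)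
      rcases unit_torsion_real K a h3 with rfl | rfl <;> simp
    rw [this, Subgroup.relIndex_bot_left]
    rw [Nat.card_eq_two_iff]
    refine ⟨1, ⟨-1, ?_⟩, ?_, ?_⟩
    · change IsOfFinOrder _
      exact isOfFinOrder_iff_pow_eq_one.2 ⟨2, by norm_num, by simp⟩
    · intro h
      have := congrArg (fun y : T => (((y : (𝓞 K)ˣ) : 𝓞 K) : K)) h
      simp at this
      norm_num [eq_neg_iff_add_eq_zero] at this
    · ext x
      simp only [Set.mem_insert_iff, Set.mem_singleton_iff, Set.mem_univ, iff_true]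
      rcases unit_torsion_real K x.1 x.2 with h | h
      · left; exact Subtype.ext h
      · right; exact Subtype.ext h
  have h3 : (S ⊔ T).index = 2 ^ (Units.rank K) := by
    have h4 := AddSubgroup.index_range_nsmul (Additive ((𝓞 K)ˣ ⧸ (Units.torsion K))) 2
    rw [Units.finrank_modTorsion] at h4
    have h5 : (powMonoidHom (α := (𝓞 K)ˣ ⧸ T) 2).range.index = 2 ^ (Units.rank K) := by
      rw [← Subgroup.index_toAddSubgroup]
      exact h4
    rw [← h5]
    have h6 : S ⊔ T = ((powMonoidHom (α := (𝓞 K)ˣ ⧸ T) 2).range).comap (QuotientGroup.mk' T) := by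
      have : (powMonoidHom (α := (𝓞 K)ˣ ⧸ T) 2).range = S.map (QuotientGroup.mk' T) := by
        ext y
        constructor
        · rintro ⟨z, rfl⟩
          obtain ⟨w, rfl⟩ := QuotientGroup.mk'_surjective T z
          exact ⟨w ^ 2, ⟨w, rfl⟩, by simp⟩
        · rintro ⟨_, ⟨w, rfl⟩, rfl⟩
          exact ⟨QuotientGroup.mk' T w, by simp⟩
      rw [this, Subgroup.comap_map_eq, QuotientGroup.ker_mk']
    rw [h6, Subgroup.index_comap_of_surjective _ (QuotientGroup.mk'_surjective T)]
  rw [← h1, h2, h3, ← pow_succ', Units.rank]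
  have h7 : Fintype.card (InfinitePlace K) = Module.finrank ℚ K := by
    rw [IsTotallyReal.finrank, InfinitePlace.card_eq_nrRealPlaces_add_nrComplexPlaces,
      IsTotallyReal.nrComplexPlaces_eq_zero, add_zero]
  rw [← h7]
  have : 0 < Fintype.card (InfinitePlace K) := Fintype.card_pos
  congr 1; omega
end

section
open NumberField nonZeroDivisors

section clMap
variable {R S : Type*} [CommRing R] [IsDedekindDomain R] [CommRing S] [IsDedekindDomain S]

/-- nonzero-ideal restriction -/
noncomputable def idRestrict (f : Ideal R →*₀ Ideal S) (h0 : ∀ I, f I = ⊥ → I = ⊥)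
    (I : (Ideal R)⁰) : (Ideal S)⁰ :=
  ⟨f I, mem_nonZeroDivisors_iff_ne_zero.2 fun h => nonZeroDivisors.coe_ne_zero I (h0 _ h)⟩

theorem idRestrict_wd (f : Ideal R →*₀ Ideal S) (h0 : ∀ I, f I = ⊥ → I = ⊥)
    (hp : ∀ x : R, ∃ y : S, f (Ideal.span {x}) = Ideal.span {y}) (I J : (Ideal R)⁰)
    (h : ClassGroup.mk0 I = ClassGroup.mk0 J) :
    ClassGroup.mk0 (idRestrict f h0 I) = ClassGroup.mk0 (idRestrict f h0 J) := by
  obtain ⟨x, y, hx, hy, hxy⟩ := (ClassGroup.mk0_eq_mk0_iff).1 h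
  obtain ⟨x', hx'⟩ := hp x
  obtain ⟨y', hy'⟩ := hp y
  refine (ClassGroup.mk0_eq_mk0_iff).2 ⟨x', y', ?_, ?_, ?_⟩
  · rintro rfl
    rw [Ideal.span_singleton_eq_bot.2 rfl] at hx'
    exact hx (Ideal.span_singleton_eq_bot.1 (h0 _ hx'))
  · rintro rfl
    rw [Ideal.span_singleton_eq_bot.2 rfl] at hy'
    exact hy (Ideal.span_singleton_eq_bot.1 (h0 _ hy'))
  · have := congrArg f hxy
    rw [map_mul, map_mul, hx', hy'] at this
    exact this

/-- homomorphism of class groups induced by a homomorphism of ideals -/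
noncomputable def clMap (f : Ideal R →*₀ Ideal S) (h0 : ∀ I, f I = ⊥ → I = ⊥)
    (hp : ∀ x : R, ∃ y : S, f (Ideal.span {x}) = Ideal.span {y}) : ClassGroup R →* ClassGroup S :=
  MonoidHom.mk' (fun c => ClassGroup.mk0 (idRestrict f h0 (ClassGroup.mk0_surjective c).choose)) (by
    intro a b
    have ha := (ClassGroup.mk0_surjective a).choose_spec
    have hb := (ClassGroup.mk0_surjective b).choose_spec
    have hab := (ClassGroup.mk0_surjective (a * b)).choose_spec
    rw [← map_mul]
    have := idRestrict_wd f h0 hp (ClassGroup.mk0_surjective (a * b)).choose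
      ((ClassGroup.mk0_surjective a).choose * (ClassGroup.mk0_surjective b).choose)
      (by rw [hab, map_mul, ha, hb])
    rw [this]
    congr 1
    ext1
    exact map_mul f _ _)

theorem clMap_mk0 (f : Ideal R →*₀ Ideal S) (h0 : ∀ I, f I = ⊥ → I = ⊥)
    (hp : ∀ x : R, ∃ y : S, f (Ideal.span {x}) = Ideal.span {y}) (I : (Ideal R)⁰) :
    clMap f h0 hp (ClassGroup.mk0 I) = ClassGroup.mk0 (idRestrict f h0 I) :=
  idRestrict_wd f h0 hp _ _ (ClassGroup.mk0_surjective (ClassGroup.mk0 I)).choose_spec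
end clMap

section maps
variable {K L : Type*} [Field K] [NumberField K] [Field L] [NumberField L]

/-- the action of an automorphism on ideals -/
noncomputable def idS (σ : L ≃+* L) : Ideal (𝓞 L) →*₀ Ideal (𝓞 L) where
  toFun I := I.map (RingOfIntegers.mapRingEquiv σ)
  map_zero' := by rw [Ideal.zero_eq_bot]; exact Ideal.map_bot
  map_one' := by rw [Ideal.one_eq_top]; exact Ideal.map_top _
  map_mul' := Ideal.map_mul _

theorem idS_bot (σ : L ≃+* L) : ∀ I, idS σ I = ⊥ → I = ⊥ := fun I h =>
  (Ideal.map_eq_bot_iff_of_injective (RingOfIntegers.mapRingEquiv σ).injective).1 h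

theorem idS_span (σ : L ≃+* L) (x : 𝓞 L) :
    idS σ (Ideal.span {x}) = Ideal.span {RingOfIntegers.mapRingEquiv σ x} := by
  change Ideal.map _ _ = _
  rw [Ideal.map_span, Set.image_singleton]

/-- the action of an automorphism on the class group -/
noncomputable def clS (σ : L ≃+* L) : ClassGroup (𝓞 L) →* ClassGroup (𝓞 L) :=
  clMap (idS σ) (idS_bot σ) fun x => ⟨_, idS_span σ x⟩

theorem mem_idS (σ : L ≃+* L) (I : Ideal (𝓞 L)) (x : 𝓞 L) :
    x ∈ idS σ I ↔ ∃ y ∈ I, σ (y : L) = (x : L) := by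
  change x ∈ Ideal.map _ _ ↔ _
  rw [Ideal.mem_map_iff_of_surjective _ (RingOfIntegers.mapRingEquiv σ).surjective]
  constructor
  · rintro ⟨y, hy, rfl⟩; exact ⟨y, hy, rfl⟩
  · rintro ⟨y, hy, h⟩; exact ⟨y, hy, RingOfIntegers.ext h⟩

theorem idS_trans (σ τ : L ≃+* L) (I : Ideal (𝓞 L)) : idS τ (idS σ I) = idS (σ.trans τ) I := by
  ext x
  simp only [mem_idS]
  constructor
  · rintro ⟨y, ⟨z, hz, h1⟩, h2⟩; exact ⟨z, hz, by rw [← h2, ← h1]; rfl⟩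
  · rintro ⟨z, hz, h1⟩
    exact ⟨RingOfIntegers.mapRingEquiv σ z, ⟨z, hz, rfl⟩, h1⟩

theorem clS_trans (σ τ : L ≃+* L) (c : ClassGroup (𝓞 L)) :
    clS τ (clS σ c) = clS (σ.trans τ) c := by
  obtain ⟨I, rfl⟩ := ClassGroup.mk0_surjective c
  simp only [clS, clMap_mk0]
  congr 1
  ext1
  exact idS_trans σ τ I

theorem clS_refl (c : ClassGroup (𝓞 L)) : clS (RingEquiv.refl L) c = c := by
  obtain ⟨I, rfl⟩ := ClassGroup.mk0_surjective c
  simp only [clS, clMap_mk0]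
  congr 1
  ext1
  ext x
  change x ∈ idS _ _ ↔ _
  rw [mem_idS]
  constructor
  · rintro ⟨y, hy, h⟩
    have : y = x := RingOfIntegers.ext h
    rwa [← this]
  · intro h; exact ⟨x, h, rfl⟩

variable [Algebra K L]
variable (K L)

/-- extension of ideals -/
noncomputable def idJ : Ideal (𝓞 K) →*₀ Ideal (𝓞 L) where
  toFun I := I.map (algebraMap (𝓞 K) (𝓞 L))
  map_zero' := by rw [Ideal.zero_eq_bot, Ideal.zero_eq_bot]; exact Ideal.map_bot
  map_one' := by rw [Ideal.one_eq_top, Ideal.one_eq_top]; exact Ideal.map_top (algebraMap (𝓞 K) (𝓞 L))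
  map_mul' := Ideal.map_mul _

theorem idJ_bot : ∀ I, idJ K L I = ⊥ → I = ⊥ := fun I h =>
  (Ideal.map_eq_bot_iff_of_injective (FaithfulSMul.algebraMap_injective (𝓞 K) (𝓞 L))).1 h

theorem idJ_span (x : 𝓞 K) :
    idJ K L (Ideal.span {x}) = Ideal.span {algebraMap (𝓞 K) (𝓞 L) x} := by
  change Ideal.map _ _ = _
  rw [Ideal.map_span, Set.image_singleton]

/-- extension of ideal classes -/
noncomputable def clJ : ClassGroup (𝓞 K) →* ClassGroup (𝓞 L) :=
  clMap (idJ K L) (idJ_bot K L) fun x => ⟨_, idJ_span K L x⟩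

/-- relative norm of ideals -/
noncomputable def idN : Ideal (𝓞 L) →*₀ Ideal (𝓞 K) := Ideal.relNorm (𝓞 K)

theorem idN_bot : ∀ I, idN K L I = ⊥ → I = ⊥ := fun I h => Ideal.relNorm_eq_bot_iff.1 h

/-- relative norm of ideal classes -/
noncomputable def clN : ClassGroup (𝓞 L) →* ClassGroup (𝓞 K) :=
  clMap (idN K L) (idN_bot K L) fun x => ⟨_, Ideal.relNorm_singleton (𝓞 K) x⟩

theorem idN_idS (σ : L ≃ₐ[K] L) (I : Ideal (𝓞 L)) :
    idN K L (idS σ.toRingEquiv I) = idN K L I :=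
  Ideal.relNorm_map_algEquiv (RingOfIntegers.mapAlgEquiv σ) I

theorem clN_clS (σ : L ≃ₐ[K] L) (c : ClassGroup (𝓞 L)) :
    clN K L (clS σ.toRingEquiv c) = clN K L c := by
  obtain ⟨I, rfl⟩ := ClassGroup.mk0_surjective c
  simp only [clS, clN, clMap_mk0]
  congr 1
  ext1
  exact idN_idS K L σ I
end maps
end

section
open NumberField nonZeroDivisors

section quad
variable {K L : Type*} [Field K] [NumberField K] [Field L] [NumberField L] [Algebra K L]
  [Algebra.IsQuadraticExtension K L] (σ : L ≃ₐ[K] L)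

theorem quad_univ (hσ : σ ≠ 1) (g : L ≃ₐ[K] L) : g = 1 ∨ g = σ := by
  have h : Nat.card (L ≃ₐ[K] L) = 2 := by
    rw [IsGalois.card_aut_eq_finrank, Algebra.IsQuadraticExtension.finrank_eq_two]
  obtain ⟨x, y, hxy, hu⟩ := Nat.card_eq_two_iff.1 h
  have h1 : (1 : L ≃ₐ[K] L) ∈ ({x, y} : Set _) := hu ▸ Set.mem_univ _
  have h2 : σ ∈ ({x, y} : Set _) := hu ▸ Set.mem_univ _
  have h3 : g ∈ ({x, y} : Set _) := hu ▸ Set.mem_univ _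
  simp only [Set.mem_insert_iff, Set.mem_singleton_iff] at h1 h2 h3
  grind

theorem quad_sq (hσ : σ ≠ 1) (x : L) : σ (σ x) = x := by
  rcases quad_univ σ hσ (σ * σ) with h | h
  · exact DFunLike.congr_fun h x
  · exact absurd (mul_eq_left.1 h) hσ

theorem quad_fix (hσ : σ ≠ 1) (x : L) (h : σ x = x) : ∃ k : K, algebraMap K L k = x := by
  have := (IsGalois.mem_bot_iff_fixed (F := K) x).2 (by
    intro g
    rcases quad_univ σ hσ g with rfl | rfl
    · rfl
    · exact h)
  exact this

theorem quad_norm (hσ : σ ≠ 1) (x : L) : algebraMap K L (Algebra.norm K x) = x * σ x := by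
  classical
  rw [Algebra.norm_eq_prod_automorphisms]
  have : (Finset.univ : Finset (L ≃ₐ[K] L)) = {1, σ} := by
    ext g; simpa using quad_univ σ hσ g
  rw [this, Finset.prod_pair (Ne.symm hσ)]
  rfl

theorem quad_h90 (hσ : σ ≠ 1) (x : L) (hx : x * σ x = 1) : ∃ y : L, y ≠ 0 ∧ x = y / σ y := by
  have hx0 : x ≠ 0 := left_ne_zero_of_mul_eq_one hx
  have hsx0 : σ x ≠ 0 := right_ne_zero_of_mul_eq_one hx
  by_cases h : x = -1
  · obtain ⟨z, hz⟩ : ∃ z, σ z ≠ z := by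
      by_contra! hcon
      exact hσ (AlgEquiv.ext hcon)
    refine ⟨z - σ z, sub_ne_zero.2 (Ne.symm hz), ?_⟩
    rw [map_sub, quad_sq σ hσ, h, ← neg_sub z (σ z), div_neg, div_self (sub_ne_zero.2 (Ne.symm hz))]
  · have h1 : 1 + x ≠ 0 := by intro h'; apply h; linear_combination h'
    refine ⟨1 + x, h1, ?_⟩
    have h2 : σ (1 + x) ≠ 0 := by rwa [Ne, EmbeddingLike.map_eq_zero_iff]
    rw [eq_div_iff h2, map_add, map_one]
    linear_combination hx

theorem quad_idS_mul (hσ : σ ≠ 1) (I : Ideal (𝓞 L)) :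
    I * idS σ.toRingEquiv I = idJ K L (idN K L I) := by
  have hle : idJ K L (idN K L I) ≤ I * idS σ.toRingEquiv I := by
    change Ideal.map _ (Ideal.relNorm _ I) ≤ _
    rw [Ideal.map_relNorm, Ideal.span_le]
    rintro _ ⟨x, hx, rfl⟩
    have : algebraMap (𝓞 K) (𝓞 L) (Algebra.intNorm (𝓞 K) (𝓞 L) x) =
        x * RingOfIntegers.mapRingEquiv σ.toRingEquiv x := by
      apply RingOfIntegers.ext
      have h1 := Algebra.algebraMap_intNorm (A := 𝓞 K) (K := K) (L := L) (B := 𝓞 L) x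
      have h2 := quad_norm σ hσ (x : L)
      change algebraMap (𝓞 L) L (algebraMap (𝓞 K) (𝓞 L) _) = _
      rw [← IsScalarTower.algebraMap_apply, IsScalarTower.algebraMap_apply (𝓞 K) K L, h1]
      exact h2
    rw [Function.comp_apply, this]
    exact Ideal.mul_mem_mul hx ((mem_idS _ _ _).2 ⟨x, hx, rfl⟩)
  by_cases hI : I = ⊥
  · subst hI
    have h1 := map_zero (idS σ.toRingEquiv)
    have h2 := map_zero (idN K L)
    have h3 := map_zero (idJ K L)
    simp only [Ideal.zero_eq_bot] at h1 h2 h3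
    rw [h2, h3, Ideal.bot_mul]
  obtain ⟨C, hC⟩ := Ideal.dvd_iff_le.2 hle
  have hn : Ideal.absNorm (I * idS σ.toRingEquiv I) = Ideal.absNorm (idJ K L (idN K L I)) := by
    rw [map_mul]
    have e1 : Ideal.absNorm (idS σ.toRingEquiv I) = Ideal.absNorm I := by
      rw [← Ideal.absNorm_relNorm (𝓞 K) (𝓞 L) (idS σ.toRingEquiv I), ← Ideal.absNorm_relNorm (𝓞 K) (𝓞 L) I]
      exact congrArg _ (idN_idS K L σ I)
    have e2 : Ideal.absNorm (idJ K L (idN K L I)) = Ideal.absNorm I ^ 2 := by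
      change Ideal.absNorm (Ideal.map _ (Ideal.relNorm _ I)) = _
      rw [Ideal.absNorm_algebraMap, Ideal.absNorm_relNorm]
      congr 1
      rw [← IsFractionRing.finrank_eq (𝓞 K) K (𝓞 L) L]
      exact Algebra.IsQuadraticExtension.finrank_eq_two K L
    rw [e1, e2, sq]
  rw [hC, map_mul _ (I * _)] at hn
  have hne : Ideal.absNorm (I * idS σ.toRingEquiv I) ≠ 0 := by
    rw [Ne, Ideal.absNorm_eq_zero_iff]
    intro h
    rcases Ideal.mul_eq_bot.1 h with h | h
    · exact hI h
    · exact hI (idS_bot _ _ h)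
  have hC1 : Ideal.absNorm C = 1 := by
    have := mul_left_cancel₀ hne ((mul_one _).trans hn)
    exact this.symm
  rw [Ideal.absNorm_eq_one_iff] at hC1
  rw [hC, hC1, Ideal.mul_top]

theorem quad_cl (hσ : σ ≠ 1) (c : ClassGroup (𝓞 L)) :
    c * clS σ.toRingEquiv c = clJ K L (clN K L c) := by
  obtain ⟨I, rfl⟩ := ClassGroup.mk0_surjective c
  simp only [clS, clN, clJ, clMap_mk0]
  rw [← map_mul]
  congr 1
  ext1
  exact quad_idS_mul σ hσ I

end quad
end

section
open NumberField nonZeroDivisors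

theorem relIndex_zpowers_dvd {N : Type*} [CommGroup N] (H : Subgroup N) (p : N) (hp : p ^ 2 ∈ H) :
    H.relIndex (Subgroup.zpowers p) ∣ 2 := by
  have e : Subgroup.zpowers p = (zpowersHom N p).range := by
    rw [Subgroup.zpowers_eq_closure]
    ext x
    rw [← Subgroup.zpowers_eq_closure]
    rfl
  rw [e, ← Subgroup.index_comap]
  have h1 : (AddSubgroup.toSubgroup (AddSubgroup.zmultiples (2 : ℤ))) ≤
      H.comap (zpowersHom N p) := by
    rintro x ⟨k, hk⟩
    have hx : x = Multiplicative.ofAdd (k * 2) := by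
      simp only [zsmul_eq_mul, Int.cast_id] at hk
      exact hk.symm
    rw [Subgroup.mem_comap, hx, zpowersHom_apply, toAdd_ofAdd, mul_comm, zpow_mul]
    exact zpow_mem (by exact_mod_cast hp) k
  have h2 := Subgroup.index_dvd_of_le h1
  rw [AddSubgroup.index_toSubgroup, Int.index_zmultiples] at h2
  exact h2

section fS
variable {L : Type*} [Field L] [NumberField L]

/-- action on fractional ideals -/
noncomputable def fS (σ : L ≃+* L) :
    FractionalIdeal (𝓞 L)⁰ L ≃+* FractionalIdeal (𝓞 L)⁰ L :=
  FractionalIdeal.ringEquivOfRingEquiv L L (RingOfIntegers.mapRingEquiv σ)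

theorem fS_frac (σ : L ≃+* L) (x : L) :
    IsFractionRing.ringEquivOfRingEquiv (K := L) (L := L) (RingOfIntegers.mapRingEquiv σ) x = σ x := by
  obtain ⟨a, b, hb, rfl⟩ := IsFractionRing.div_surjective (A := 𝓞 L) x
  simp only [map_div₀, IsFractionRing.ringEquivOfRingEquiv_algebraMap]
  rfl

theorem fS_span (σ : L ≃+* L) (x : L) : fS σ (FractionalIdeal.spanSingleton _ x) =
    FractionalIdeal.spanSingleton _ (σ x) := by
  rw [fS, FractionalIdeal.ringEquivOfRingEquiv_spanSingleton, fS_frac]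

theorem fS_coe (σ : L ≃+* L) (I : Ideal (𝓞 L)) :
    fS σ (I : FractionalIdeal (𝓞 L)⁰ L) = (idS σ I : Ideal (𝓞 L)) := by
  ext x
  rw [fS, FractionalIdeal.ringEquivOfRingEquiv_apply]
  rw [FractionalIdeal.mem_coeIdeal]
  change x ∈ Submodule.map _ _ ↔ _
  rw [Submodule.mem_map]
  constructor
  · rintro ⟨y, hy, rfl⟩
    obtain ⟨z, hz, rfl⟩ := (FractionalIdeal.mem_coeIdeal _).1 hy
    exact ⟨RingOfIntegers.mapRingEquiv σ z, (mem_idS σ I _).2 ⟨z, hz, rfl⟩, (fS_frac σ z).symm⟩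
  · rintro ⟨y, hy, rfl⟩
    obtain ⟨z, hz, h⟩ := (mem_idS σ I _).1 hy
    exact ⟨(z : L), (FractionalIdeal.mem_coeIdeal _).2 ⟨z, hz, rfl⟩, (fS_frac σ z).trans h⟩

/-- action on the group of fractional ideals -/
noncomputable def uS (σ : L ≃+* L) :
    (FractionalIdeal (𝓞 L)⁰ L)ˣ →* (FractionalIdeal (𝓞 L)⁰ L)ˣ := Units.map (fS σ).toMonoidHom

theorem uS_mk0 (σ : L ≃+* L) (I : (Ideal (𝓞 L))⁰) :
    uS σ (FractionalIdeal.mk0 L I) = FractionalIdeal.mk0 L (idRestrict (idS σ) (idS_bot σ) I) := by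
  ext1
  exact fS_coe σ I

theorem uS_pr (σ : L ≃+* L) (x : Lˣ) :
    uS σ (toPrincipalIdeal (𝓞 L) L x) = toPrincipalIdeal (𝓞 L) L (Units.map σ x) := by
  ext1
  rw [coe_toPrincipalIdeal]
  change fS σ _ = _
  rw [coe_toPrincipalIdeal, fS_span]; rfl

theorem exists_frac (a : (FractionalIdeal (𝓞 L)⁰ L)ˣ) : ∃ (x : 𝓞 L) (hx : x ≠ 0) (I : (Ideal (𝓞 L))⁰),
    a * toPrincipalIdeal (𝓞 L) L (Units.mk0 (x : L) (by simpa using hx))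
      = FractionalIdeal.mk0 L I := by
  obtain ⟨x, I, hx, h⟩ := FractionalIdeal.exists_eq_spanSingleton_mul (a : FractionalIdeal (𝓞 L)⁰ L)
  have hI : I ≠ ⊥ := by
    rintro rfl
    apply a.ne_zero
    rw [h]; simp
  refine ⟨x, hx, ⟨I, mem_nonZeroDivisors_iff_ne_zero.2 hI⟩, ?_⟩
  ext1
  rw [Units.val_mul, coe_toPrincipalIdeal, h]
  simp only [Units.val_mk0, FractionalIdeal.coe_mk0]
  rw [mul_right_comm, FractionalIdeal.spanSingleton_mul_spanSingleton, inv_mul_cancel₀,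
    FractionalIdeal.spanSingleton_one, one_mul]
  simpa using hx

theorem uS_uS (σ τ : L ≃+* L) (a : (FractionalIdeal (𝓞 L)⁰ L)ˣ) :
    uS τ (uS σ a) = uS (σ.trans τ) a := by
  obtain ⟨x, hx, I, h⟩ := exists_frac a
  rw [← eq_div_iff_mul_eq'] at h
  rw [h]
  simp only [map_div, uS_mk0, uS_pr]
  congr 2
  ext1
  exact idS_trans σ τ I

theorem uS_refl (a : (FractionalIdeal (𝓞 L)⁰ L)ˣ) :
    uS (RingEquiv.refl L) a = a := by
  obtain ⟨x, hx, I, h⟩ := exists_frac a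
  rw [← eq_div_iff_mul_eq'] at h
  rw [h]
  simp only [map_div, uS_mk0, uS_pr]
  congr 2
  ext1
  ext y
  change y ∈ idS _ _ ↔ _
  rw [mem_idS]
  constructor
  · rintro ⟨z, hz, h⟩
    have : z = y := RingOfIntegers.ext h
    rwa [← this]
  · intro h; exact ⟨y, h, rfl⟩

variable (L) in
/-- the projection to the class group -/
noncomputable def clP : (FractionalIdeal (𝓞 L)⁰ L)ˣ →* ClassGroup (𝓞 L) :=
  (ClassGroup.equiv (R := 𝓞 L) L).symm.toMonoidHom.comp (QuotientGroup.mk' (toPrincipalIdeal (𝓞 L) L).range)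

theorem clP_mk0 (I : (Ideal (𝓞 L))⁰) : clP L (FractionalIdeal.mk0 L I) = ClassGroup.mk0 I := by
  change (ClassGroup.equiv (R := 𝓞 L) L).symm _ = _
  rw [MulEquiv.symm_apply_eq, ClassGroup.equiv_mk0]

theorem clP_ker : (clP L).ker = (toPrincipalIdeal (𝓞 L) L).range := by
  ext x
  rw [MonoidHom.mem_ker]
  change (ClassGroup.equiv (R := 𝓞 L) L).symm (QuotientGroup.mk' _ x) = 1 ↔ _
  rw [EmbeddingLike.map_eq_one_iff]
  exact QuotientGroup.eq_one_iff x

theorem clP_surj : Function.Surjective (clP L) :=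
  (ClassGroup.equiv (R := 𝓞 L) L).symm.surjective.comp (QuotientGroup.mk'_surjective _)

theorem clP_pr (x : Lˣ) : clP L (toPrincipalIdeal (𝓞 L) L x) = 1 := by
  rw [← MonoidHom.mem_ker, clP_ker]; exact ⟨x, rfl⟩

theorem clP_uS (σ : L ≃+* L) (a : (FractionalIdeal (𝓞 L)⁰ L)ˣ) :
    clP L (uS σ a) = clS σ (clP L a) := by
  obtain ⟨x, hx, I, h⟩ := exists_frac a
  rw [← eq_div_iff_mul_eq'] at h
  rw [h]
  simp only [map_div, uS_mk0, uS_pr, clP_pr, clP_mk0, clS, clMap_mk0, map_one, div_one]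
end fS
end

section
open NumberField nonZeroDivisors

section amb
variable {K L : Type*} [Field K] [NumberField K] [Field L] [NumberField L] [Algebra K L]

variable (K L) in
/-- extension on groups of fractional ideals -/
noncomputable def uJ : (FractionalIdeal (𝓞 K)⁰ K)ˣ →* (FractionalIdeal (𝓞 L)⁰ L)ˣ :=
  Units.map (FractionalIdeal.extendedHom L (𝓞 L) (A := 𝓞 K) (K := K)).toMonoidHom

theorem uJ_mk0 (I : (Ideal (𝓞 K))⁰) :
    uJ K L (FractionalIdeal.mk0 K I) =
      FractionalIdeal.mk0 L (idRestrict (idJ K L) (idJ_bot K L) I) := by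
  ext1
  exact FractionalIdeal.extendedHom_coeIdeal_eq_map L (𝓞 L) (I : Ideal (𝓞 K))

theorem uJ_inj : Function.Injective (uJ K L) := by
  intro a b h
  ext1
  exact FractionalIdeal.extendedHom_injective (𝓞 K) K L (𝓞 L) (congrArg Units.val h)

theorem uJ_pr (x : Kˣ) :
    uJ K L (toPrincipalIdeal (𝓞 K) K x) =
      toPrincipalIdeal (𝓞 L) L (Units.map (algebraMap K L).toMonoidHom x) := by
  ext1
  rw [coe_toPrincipalIdeal]
  change FractionalIdeal.extendedHom L (𝓞 L) _ = _
  rw [coe_toPrincipalIdeal, FractionalIdeal.extendedHom_spanSingleton]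
  congr 1
  obtain ⟨a, b, hb, h⟩ := IsFractionRing.div_surjective (A := 𝓞 K) (x : K)
  change _ = algebraMap K L x
  rw [← h]
  simp only [map_div₀, IsFractionRing.map, IsLocalization.map_eq]
  simp only [← IsScalarTower.algebraMap_apply]

theorem pow_of_unique (P : Ideal (𝓞 L))
    (hP : ∀ Q : Ideal (𝓞 L), Q.IsPrime → (2 : 𝓞 L) ∈ Q → Q = P)
    (C : Ideal (𝓞 L)) (hC : C ≠ ⊥) (M : ℕ) (h2 : (2 : 𝓞 L) ^ M ∈ C) : ∃ k : ℕ, C = P ^ k := by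
  classical
  refine ⟨Multiset.card (UniqueFactorizationMonoid.normalizedFactors C), ?_⟩
  have : UniqueFactorizationMonoid.normalizedFactors C =
      Multiset.replicate (Multiset.card (UniqueFactorizationMonoid.normalizedFactors C)) P := by
    rw [Multiset.eq_replicate]
    refine ⟨rfl, fun Q hQ => ?_⟩
    have hQp := UniqueFactorizationMonoid.prime_of_normalized_factor Q hQ
    have hQi : Q.IsPrime := Ideal.isPrime_of_prime hQp
    have hdvd := UniqueFactorizationMonoid.dvd_of_mem_normalizedFactors hQ
    exact hP Q hQi (hQi.mem_of_pow_mem M (Ideal.le_of_dvd hdvd h2))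
  conv_lhs => rw [← Ideal.prod_normalizedFactors_eq_self hC, this]
  rw [Multiset.prod_replicate]

theorem aux_grp {G : Type*} [CommGroup G] (a u p : G) : a = p⁻¹ * (a * u * p * u⁻¹) := by
  rw [mul_right_comm (a * u), mul_inv_cancel_right, mul_comm a p, inv_mul_cancel_left]

theorem uS_uJ (σ : L ≃ₐ[K] L) (b : (FractionalIdeal (𝓞 K)⁰ K)ˣ) :
    uS σ.toRingEquiv (uJ K L b) = uJ K L b := by
  obtain ⟨x, hx, I, h⟩ := exists_frac b
  rw [← eq_div_iff_mul_eq'] at h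
  rw [h]
  simp only [map_div, uJ_mk0, uJ_pr, uS_mk0, uS_pr]
  congr 2
  · ext1
    change Ideal.map _ (Ideal.map _ _) = Ideal.map _ _
    refine (Ideal.map_map (algebraMap (𝓞 K) (𝓞 L)) (RingOfIntegers.mapRingEquiv σ.toRingEquiv).toRingHom).trans ?_
    congr 1
    ext k
    exact σ.commutes k
  · congr 1
    ext1
    exact σ.commutes _

variable [Algebra.IsQuadraticExtension K L] (σ : L ≃ₐ[K] L)

theorem quad_fix_int (hσ : σ ≠ 1) (x : 𝓞 L) (h : σ (x : L) = x) : ∃ k : 𝓞 K, algebraMap (𝓞 K) (𝓞 L) k = x := by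
  obtain ⟨k, hk⟩ := quad_fix σ hσ x h
  have : IsIntegral ℤ k := by
    rw [← isIntegral_algebraMap_iff (algebraMap K L).injective, hk]
    exact x.isIntegral_coe
  exact ⟨⟨k, this⟩, RingOfIntegers.ext hk⟩

theorem amb_int (hσ : σ ≠ 1) (w : 𝓞 L) (hw : σ (w : L) = -w) (N : ℕ) (hwN : w ∣ 2 ^ N)
    (P : Ideal (𝓞 L))
    (hP : ∀ Q : Ideal (𝓞 L), Q.IsPrime → (2 : 𝓞 L) ∈ Q → Q = P)
    (I : Ideal (𝓞 L)) (hI : I ≠ ⊥) (hIs : idS σ.toRingEquiv I = I) :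
    ∃ (J : Ideal (𝓞 K)) (k : ℕ), J ≠ ⊥ ∧ idJ K L J = I * P ^ k := by
  set J := I.comap (algebraMap (𝓞 K) (𝓞 L)) with hJ
  have hle : idJ K L J ≤ I := Ideal.map_comap_le
  have key : ∀ x ∈ I, 2 * w * x ∈ idJ K L J := by
    intro x hx
    set y : 𝓞 L := RingOfIntegers.mapRingEquiv σ.toRingEquiv x with hy
    have hyx : (y : L) = σ x := rfl
    have hyI : y ∈ I := by rw [← hIs, mem_idS]; exact ⟨x, hx, rfl⟩
    have hσy : σ (y : L) = x := by rw [hyx]; exact quad_sq σ hσ x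
    obtain ⟨k, hk⟩ := quad_fix_int σ hσ (x + y) (by
      change σ ((x:L) + y) = x + y; rw [map_add, hσy, hyx, add_comm])
    obtain ⟨k', hk'⟩ := quad_fix_int σ hσ (w * x - w * y) (by
      change σ ((w:L) * x - w * y) = w * x - w * y; rw [map_sub, map_mul, map_mul, hσy, hyx, hw]; ring)
    have hkJ : k ∈ J := by rw [hJ, Ideal.mem_comap, hk]; exact I.add_mem hx hyI
    have hkJ' : k' ∈ J := by
      rw [hJ, Ideal.mem_comap, hk']; exact I.sub_mem (I.mul_mem_left _ hx) (I.mul_mem_left _ hyI)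
    have e : 2 * w * x = w * (x + y) + (w * x - w * y) := by ring
    rw [e, ← hk, ← hk']
    exact Ideal.add_mem _ (Ideal.mul_mem_left _ _ (Ideal.mem_map_of_mem _ hkJ))
      (Ideal.mem_map_of_mem _ hkJ')
  have hw0 : w ≠ 0 := by
    rintro rfl
    rw [zero_dvd_iff] at hwN
    exact (pow_ne_zero N two_ne_zero) hwN
  have hle2 : Ideal.span {2 * w} * I ≤ idJ K L J := by
    rw [Ideal.span_singleton_mul_le_iff]
    exact key
  have hJ0 : idJ K L J ≠ ⊥ := by
    intro h
    rw [h, le_bot_iff, Ideal.mul_eq_bot, Ideal.span_singleton_eq_bot] at hle2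
    rcases hle2 with h | h
    · simp [hw0] at h
    · exact hI h
  obtain ⟨C, hC⟩ := Ideal.dvd_iff_le.2 hle
  have hCd : C ∣ Ideal.span {2 * w} := by
    have h1 := Ideal.dvd_iff_le.2 hle2
    rw [hC, mul_comm] at h1
    exact (mul_dvd_mul_iff_right hI).1 h1
  have hC0 : C ≠ ⊥ := by
    rintro rfl
    rw [Ideal.mul_bot] at hC
    exact hJ0 hC
  have h2C : (2 : 𝓞 L) ^ (N + 1) ∈ C := by
    apply Ideal.le_of_dvd hCd
    rw [Ideal.mem_span_singleton, pow_succ, mul_comm]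
    exact mul_dvd_mul hwN (dvd_refl _)
  obtain ⟨k, hk⟩ := pow_of_unique P hP C hC0 _ h2C
  refine ⟨J, k, ?_, by rw [hC, hk]⟩
  intro h; rw [h] at hJ0; exact hJ0 (map_zero (idJ K L))

/-- The group of invariant ideals. -/
theorem amb_index (hσ : σ ≠ 1) (w : 𝓞 L) (hw : σ (w : L) = -w) (N : ℕ) (hwN : w ∣ 2 ^ N)
    (P : Ideal (𝓞 L)) (hP0 : P ≠ ⊥) (hP1 : P.IsPrime) (hP2 : (2 : 𝓞 L) ∈ P)
    (hP : ∀ Q : Ideal (𝓞 L), Q.IsPrime → (2 : 𝓞 L) ∈ Q → Q = P)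
    (Nfix : Subgroup (FractionalIdeal (𝓞 L)⁰ L)ˣ)
    (hNfix : ∀ a, a ∈ Nfix ↔ uS σ.toRingEquiv a = a) :
    (uJ K L).range.relIndex Nfix ∣ 2 := by
  set Pu : (FractionalIdeal (𝓞 L)⁰ L)ˣ :=
    FractionalIdeal.mk0 L ⟨P, mem_nonZeroDivisors_iff_ne_zero.2 hP0⟩ with hPu
  have hσP : idS σ.toRingEquiv P = P := by
    apply hP
    · change (Ideal.map _ P).IsPrime
      exact Ideal.map_isPrime_of_equiv (RingOfIntegers.mapRingEquiv σ.toRingEquiv)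
    · rw [mem_idS]; exact ⟨2, hP2, by change σ (algebraMap (𝓞 L) L 2) = algebraMap (𝓞 L) L 2; rw [map_ofNat]; exact map_ofNat σ 2⟩
  have hPsq : Pu ^ 2 ∈ (uJ K L).range := by
    refine ⟨FractionalIdeal.mk0 K ⟨idN K L P, mem_nonZeroDivisors_iff_ne_zero.2 fun h => hP0 (idN_bot K L P h)⟩, ?_⟩
    rw [uJ_mk0, hPu, ← map_pow]
    congr 1
    ext1
    change idJ K L (idN K L P) = P ^ 2
    rw [← quad_idS_mul σ hσ, hσP, sq]
  have hle : Nfix ≤ Subgroup.zpowers Pu ⊔ (uJ K L).range := by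
    intro a ha
    rw [hNfix] at ha
    obtain ⟨x, hx, I, hI⟩ := exists_frac a
    have hxL : (x : L) ≠ 0 := by simpa using hx
    set y : 𝓞 L := RingOfIntegers.mapRingEquiv σ.toRingEquiv x with hy
    have hyx : (y : L) = σ x := rfl
    have hy0 : y ≠ 0 := by rw [hy]; simpa using hx
    obtain ⟨k, hk⟩ := quad_fix_int σ hσ (x * y) (by
      change σ ((x:L) * y) = x * y; rw [map_mul, hyx, quad_sq σ hσ, mul_comm])
    have hk0 : k ≠ 0 := by rintro rfl; rw [map_zero] at hk; exact mul_ne_zero hx hy0 hk.symm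
    have hkK : (k : K) ≠ 0 := by simpa using hk0
    have hkL : (x : L) * y ≠ 0 := by
      intro h; apply mul_ne_zero hx hy0; apply RingOfIntegers.ext; push_cast; exact h
    set I' : (Ideal (𝓞 L))⁰ := ⟨Ideal.span {y} * I, mem_nonZeroDivisors_iff_ne_zero.2
      (mul_ne_zero (by simpa using hy0) (nonZeroDivisors.ne_zero I.2))⟩ with hI'
    have e1 : a * uJ K L (toPrincipalIdeal (𝓞 K) K (Units.mk0 (k : K) hkK)) = FractionalIdeal.mk0 L I' := by
      rw [uJ_pr]
      have : Units.map (algebraMap K L).toMonoidHom (Units.mk0 (k : K) hkK) =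
          Units.mk0 (x : L) hxL * Units.mk0 (y : L) (by simpa using hy0) := by
        ext1
        change algebraMap K L k = x * y
        have := congrArg (algebraMap (𝓞 L) L) hk
        rw [← IsScalarTower.algebraMap_apply, IsScalarTower.algebraMap_apply (𝓞 K) K L] at this
        rw [map_mul] at this
        exact this
      rw [this, map_mul, ← mul_assoc, hI]
      ext1
      rw [Units.val_mul, coe_toPrincipalIdeal]
      simp only [Units.val_mk0, FractionalIdeal.coe_mk0]
      rw [hI', FractionalIdeal.coeIdeal_mul, FractionalIdeal.coeIdeal_span_singleton, mul_comm]
    have hs : idS σ.toRingEquiv (I' : Ideal (𝓞 L)) = I' := by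
      have h1 : uS σ.toRingEquiv (FractionalIdeal.mk0 L I') = FractionalIdeal.mk0 L I' := by
        rw [← e1, map_mul, ha, uJ_pr, uS_pr]
        congr 2
        ext1
        exact σ.commutes k
      rw [uS_mk0] at h1
      have h2 := congrArg Units.val h1
      simp only [FractionalIdeal.coe_mk0] at h2
      exact FractionalIdeal.coeIdeal_injective h2
    obtain ⟨J, n, hJ, hJn⟩ := amb_int σ hσ w hw N hwN P hP I' (nonZeroDivisors.ne_zero I'.2) hs
    have e2 : uJ K L (FractionalIdeal.mk0 K ⟨J, mem_nonZeroDivisors_iff_ne_zero.2 hJ⟩) =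
        FractionalIdeal.mk0 L I' * Pu ^ n := by
      rw [uJ_mk0, hPu, ← map_pow, ← map_mul]
      congr 1
      ext1
      exact hJn
    have e3 : a = (Pu ^ n)⁻¹ * (uJ K L (FractionalIdeal.mk0 K ⟨J, mem_nonZeroDivisors_iff_ne_zero.2 hJ⟩) *
       (uJ K L (toPrincipalIdeal (𝓞 K) K (Units.mk0 (k : K) hkK)))⁻¹) := by
      rw [e2, ← e1]
      exact aux_grp _ _ _
    rw [e3]
    apply Subgroup.mul_mem_sup
    · exact inv_mem (pow_mem (Subgroup.mem_zpowers _) _)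
    · exact mul_mem ⟨_, rfl⟩ (inv_mem ⟨_, rfl⟩)
  have hIK : (uJ K L).range ≤ Nfix := by
    rintro _ ⟨b, rfl⟩
    rw [hNfix]; exact uS_uJ σ b
  refine dvd_trans ?_ (relIndex_zpowers_dvd (uJ K L).range Pu hPsq)
  rw [← Subgroup.relIndex_sup_right (Subgroup.zpowers Pu) (uJ K L).range,
    ← Subgroup.relIndex_mul_relIndex _ _ _ hIK hle]
  exact dvd_mul_right _ _
end amb
end

section
open NumberField nonZeroDivisors

theorem sq_relIndex_range {G M : Type*} [CommGroup G] [CommGroup M] (i : G →* M)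
    (hi : Function.Injective i) :
    (i.range.map (powMonoidHom 2)).relIndex i.range = (powMonoidHom 2 : G →* G).range.index := by
  have h1 : i.range.map (powMonoidHom 2) = (powMonoidHom 2 : G →* G).range.map i := by
    rw [MonoidHom.map_range, MonoidHom.map_range]
    congr 1
    ext x
    simp
  rw [h1, ← Subgroup.relIndex_top_right, ← Subgroup.relIndex_map_map_of_injective _ _ hi,
    ← MonoidHom.range_eq_map]

section chev
variable {K L : Type*} [Field K] [NumberField K] [Field L] [NumberField L] [Algebra K L]

variable (L) in
/-- units into the multiplicative group -/
noncomputable def uI : (𝓞 L)ˣ →* Lˣ := Units.map (algebraMap (𝓞 L) L).toMonoidHom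

theorem uI_inj : Function.Injective (uI L) :=
  Units.map_injective (FaithfulSMul.algebraMap_injective (𝓞 L) L)

theorem uI_range : (uI L).range = (toPrincipalIdeal (𝓞 L) L).ker := by
  ext x
  rw [MonoidHom.mem_ker, toPrincipalIdeal_eq_iff, Units.val_one]
  constructor
  · rintro ⟨u, rfl⟩
    change FractionalIdeal.spanSingleton _ (algebraMap (𝓞 L) L u) = 1
    rw [← FractionalIdeal.coeIdeal_span_singleton, Ideal.span_singleton_eq_top.2 u.isUnit]
    simp
  · intro h
    have h1 : ∃ a : 𝓞 L, algebraMap (𝓞 L) L a = x := by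
      rw [← FractionalIdeal.mem_one_iff (𝓞 L)⁰, ← h]; exact FractionalIdeal.mem_spanSingleton_self _ _
    have h2 : (1 : L) ∈ FractionalIdeal.spanSingleton (𝓞 L)⁰ (x : L) := by
      rw [h]; exact FractionalIdeal.one_mem_one _
    rw [FractionalIdeal.mem_spanSingleton] at h2
    obtain ⟨a, ha⟩ := h1
    obtain ⟨b, hb⟩ := h2
    have hab : a * b = 1 := by
      apply FaithfulSMul.algebraMap_injective (𝓞 L) L
      rw [map_mul, map_one, ha, mul_comm, ← hb, Algebra.smul_def]
    exact ⟨⟨a, b, hab, by rw [mul_comm, hab]⟩, by ext1; exact ha⟩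

variable [Algebra.IsQuadraticExtension K L] (σ : L ≃ₐ[K] L)

/-- A divisibility form of the ambiguous class number formula. -/
theorem chevalley (hσ : σ ≠ 1) [IsTotallyReal K] [IsTotallyReal L]
    (w : 𝓞 L) (hw : σ (w : L) = -w) (N : ℕ) (hwN : w ∣ 2 ^ N)
    (P : Ideal (𝓞 L)) (hP0 : P ≠ ⊥) (hP1 : P.IsPrime) (hP2 : (2 : 𝓞 L) ∈ P)
    (hP : ∀ Q : Ideal (𝓞 L), Q.IsPrime → (2 : 𝓞 L) ∈ Q → Q = P) :
    Nat.card ((clS σ.toRingEquiv).eqLocus (MonoidHom.id _)) ∣ Nat.card (ClassGroup (𝓞 K)) := by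
  let sM : Lˣ →* Lˣ := Units.map σ
  let sN := uS (L := L) σ.toRingEquiv
  let d := toPrincipalIdeal (𝓞 L) L
  have hsM : ∀ x, sM (sM x) = x := fun x => by ext1; exact quad_sq σ hσ x
  have hσσ : σ.toRingEquiv.trans σ.toRingEquiv = RingEquiv.refl L := by
    ext x; exact quad_sq σ hσ x
  have hsN : ∀ x, sN (sN x) = x := fun x => by
    change uS _ (uS _ x) = x
    rw [uS_uS, hσσ, uS_refl]
  have hd : ∀ x, d (sM x) = sN (d x) := fun x => (uS_pr σ.toRingEquiv x).symm
  have h90 : ∀ x, x * sM x = 1 → ∃ y, x = y / sM y := by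
    intro x hx
    obtain ⟨y, hy, h⟩ := quad_h90 σ hσ (x : L) (congrArg Units.val hx)
    refine ⟨Units.mk0 y hy, ?_⟩
    ext1
    rw [Units.val_div_eq_div_val]
    exact h
  let Mfix : Subgroup Lˣ := sM.eqLocus (MonoidHom.id _)
  let Nfix := sN.eqLocus (MonoidHom.id _)
  let E : Subgroup Lˣ := d.ker
  have hE : ∀ x, x ∈ E ↔ d x = 1 := fun x => Iff.rfl
  have hsE : ∀ x ∈ E, sM x ∈ E := fun x hx => by
    rw [hE] at hx ⊢; rw [hd, hx, map_one]
  let E1 : Subgroup Lˣ := E.map (MonoidHom.id _ / sM)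
  let NE : Subgroup Lˣ := E.map (MonoidHom.id _ * sM)
  let Em : Subgroup Lˣ := E ⊓ (MonoidHom.id _ * sM).ker
  let EK : Subgroup Lˣ := E ⊓ Mfix
  have hE1 : ∀ x, x ∈ E1 ↔ ∃ e, e ∈ E ∧ e / sM e = x := fun x => Iff.rfl
  have hNE : ∀ x, x ∈ NE ↔ ∃ e, e ∈ E ∧ e * sM e = x := fun x => Iff.rfl
  have hEm : ∀ x, x ∈ Em ↔ x ∈ E ∧ x * sM x = 1 := fun x => Iff.rfl
  have hEK : ∀ x, x ∈ EK ↔ x ∈ E ∧ sM x = x := fun x => Iff.rfl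
  have hEr : E = (uI L).range := uI_range.symm
  have hfin : Module.finrank ℚ L = 2 * Module.finrank ℚ K := by
    rw [← Module.finrank_mul_finrank ℚ K L, Algebra.IsQuadraticExtension.finrank_eq_two K L, mul_comm]
  have hE2 : (E.map (powMonoidHom 2)).relIndex E = 2 ^ (2 * Module.finrank ℚ K) := by
    rw [hEr, sq_relIndex_range _ uI_inj, unit_sq_index, hfin]
  let jK : (𝓞 K)ˣ →* Lˣ := (uI L).comp (Units.map (algebraMap (𝓞 K) (𝓞 L)).toMonoidHom)
  have hjK : Function.Injective jK := uI_inj.comp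
    (Units.map_injective (FaithfulSMul.algebraMap_injective (𝓞 K) (𝓞 L)))
  have hEKr : EK = jK.range := by
    ext x
    rw [hEK, hEr]
    constructor
    · rintro ⟨⟨u, rfl⟩, hu⟩
      have hu1 : σ (u : 𝓞 L) = (u : 𝓞 L) := congrArg Units.val hu
      have hu2 : σ ((u⁻¹ : (𝓞 L)ˣ) : 𝓞 L) = ((u⁻¹ : (𝓞 L)ˣ) : 𝓞 L) := by
        have := congrArg Units.val (congrArg Inv.inv hu)
        rw [← map_inv, ← map_inv] at this
        exact this
      obtain ⟨a, ha⟩ := quad_fix_int σ hσ _ hu1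
      obtain ⟨b, hb⟩ := quad_fix_int σ hσ _ hu2
      have hab : a * b = 1 := by
        apply FaithfulSMul.algebraMap_injective (𝓞 K) (𝓞 L)
        rw [map_mul, map_one, ha, hb, Units.mul_inv]
      refine ⟨⟨a, b, hab, by rw [mul_comm, hab]⟩, ?_⟩
      ext1
      exact congrArg (algebraMap (𝓞 L) L) ha
    · rintro ⟨u, rfl⟩
      refine ⟨⟨_, rfl⟩, ?_⟩
      ext1
      exact σ.commutes _
  have hK2 : (EK.map (powMonoidHom 2)).relIndex EK = 2 ^ (Module.finrank ℚ K) := by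
    rw [hEKr, sq_relIndex_range _ hjK, unit_sq_index]
  have hneg : ∀ u : (𝓞 L)ˣ, uI L (-u) = -uI L u := fun u => by
    ext1; exact map_neg (algebraMap (𝓞 L) L) _
  have hunit := unit_index_abstract sM hsM E hsE (-1) (by rw [hEr]; exact ⟨-1, by rw [hneg, map_one]⟩)
    (by
      intro h
      have h1 : (-1 : L) = 1 := congrArg Units.val h
      norm_num at h1)
    (by simp) (by ext1; change σ (-1) = -1; rw [map_neg, map_one])
    (by
      intro x _ h
      have h1 : (x : L) ^ 2 = 1 := congrArg Units.val h
      rcases mul_self_eq_one_iff.1 ((sq (x : L)).symm.trans h1) with h | h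
      · left; ext1; exact h
      · right; ext1; exact h)
    (by
      intro x hx h
      rw [hEr] at hx
      obtain ⟨u, rfl⟩ := hx
      have h1 : u ^ 2 = -1 := by apply uI_inj; rw [map_pow, h, hneg, map_one]
      have h2 : IsOfFinOrder u := isOfFinOrder_iff_pow_eq_one.2 ⟨4, by norm_num, by
        rw [show (4 : ℕ) = 2 * 2 from rfl, pow_mul, h1]; simp⟩
      have h3 : (-1 : (𝓞 L)ˣ) ≠ 1 := by
        intro h
        have h1 : ((-1 : (𝓞 L)ˣ) : 𝓞 L) = 1 := congrArg Units.val h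
        norm_num at h1
      rcases unit_torsion_real L u h2 with h | h <;> rw [h] at h1 <;> simp at h1 <;> exact h3 h1.symm)
    E1 Em NE EK hE1 hEm hNE hEK _ hE2 hK2
  have hNfix : ∀ a, a ∈ Nfix ↔ sN a = a := fun a => Iff.rfl
  have hidx := amb_index σ hσ w hw N hwN P hP0 hP1 hP2 hP Nfix hNfix
  have hMd : Mfix.map d = ((toPrincipalIdeal (𝓞 K) K).range).map (uJ K L) := by
    ext a
    constructor
    · rintro ⟨x, hx, rfl⟩
      obtain ⟨k, hk⟩ := quad_fix σ hσ (x : L) (congrArg Units.val hx)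
      have hk0 : k ≠ 0 := by rintro rfl; rw [map_zero] at hk; exact x.ne_zero hk.symm
      refine ⟨_, ⟨Units.mk0 k hk0, rfl⟩, ?_⟩
      rw [uJ_pr]
      congr 1
      ext1
      exact hk
    · rintro ⟨_, ⟨k, rfl⟩, rfl⟩
      rw [uJ_pr]
      refine ⟨_, ?_, rfl⟩
      change sM _ = _
      ext1
      exact σ.commutes _
  let Z : Subgroup (FractionalIdeal (𝓞 L)⁰ L)ˣ :=
    ((clS σ.toRingEquiv).eqLocus (MonoidHom.id _)).comap (clP L)
  have hZ : ∀ a, a ∈ Z ↔ ∃ x, d x = a / sN a := by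
    intro a
    change clS _ (clP L a) = clP L a ↔ _
    rw [← clP_uS, eq_comm, ← div_eq_one, ← map_div, ← MonoidHom.mem_ker, clP_ker]
    rfl
  have main := chev_abstract sM sN hsM hsN d hd h90 Mfix (fun x => Iff.rfl) Nfix hNfix
    (uJ K L).range (by rintro _ ⟨b, rfl⟩; exact uS_uJ σ b)
    (by rw [hMd]; exact Subgroup.map_le_range _ _) hidx E1 Em NE EK hE1 hEm hNE hEK hunit Z hZ
  have e1 : d.range.relIndex Z = Nat.card ((clS σ.toRingEquiv).eqLocus (MonoidHom.id _)) := by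
    rw [← clP_ker, Subgroup.relIndex_ker, Subgroup.map_comap_eq_self_of_surjective clP_surj]
  have e2 : (Mfix.map d).relIndex (uJ K L).range = Nat.card (ClassGroup (𝓞 K)) := by
    rw [hMd, MonoidHom.range_eq_map (uJ K L), Subgroup.relIndex_map_map_of_injective _ _ uJ_inj, ← clP_ker,
      Subgroup.relIndex_ker, ← MonoidHom.range_eq_map, MonoidHom.range_eq_top.2 clP_surj]
    exact Nat.card_congr Subgroup.topEquiv.toEquiv
  rwa [e1, e2] at main
end chev
end

section
open NumberField nonZeroDivisors

theorem absNorm_two (L : Type*) [Field L] [NumberField L] :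
    Ideal.absNorm (Ideal.span {(2 : 𝓞 L)}) = 2 ^ Module.finrank ℚ L := by
  rw [Ideal.absNorm_span_singleton]
  have : (2 : 𝓞 L) = algebraMap ℤ (𝓞 L) 2 := by simp
  rw [this, Algebra.norm_algebraMap, RingOfIntegers.rank]
  simp [Int.natAbs_pow]

theorem two_le_absNorm {L : Type*} [Field L] [NumberField L] (P : Ideal (𝓞 L)) (h0 : P ≠ ⊥)
    (h1 : P ≠ ⊤) : 2 ≤ Ideal.absNorm P := by
  have h2 := mt Ideal.absNorm_eq_one_iff.1 h1
  have h3 := mt Ideal.absNorm_eq_zero_iff.1 h0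
  omega

theorem unique_prime (L : Type*) [Field L] [NumberField L] (k : ℕ)
    (hfin : Module.finrank ℚ L ≤ 2 ^ k)
    (h : ∀ P : Ideal (𝓞 L), P.IsPrime → (2 : 𝓞 L) ∈ P →
      ∃ x ∈ P, ∃ y, y ∉ P ∧ ∃ z, 2 * y = x ^ (2 ^ k) * z) :
    Module.finrank ℚ L = 2 ^ k ∧ ∃ P : Ideal (𝓞 L), P ≠ ⊥ ∧ P.IsPrime ∧ (2 : 𝓞 L) ∈ P ∧
      ∀ Q : Ideal (𝓞 L), Q.IsPrime → (2 : 𝓞 L) ∈ Q → Q = P := by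
  have hne : ∀ P : Ideal (𝓞 L), (2 : 𝓞 L) ∈ P → P ≠ ⊥ := by
    rintro P h2 rfl
    rw [Ideal.mem_bot] at h2; exact two_ne_zero h2
  have hpow : ∀ P : Ideal (𝓞 L), P.IsPrime → (2 : 𝓞 L) ∈ P → P ^ (2 ^ k) ∣ Ideal.span {2} := by
    intro P hP h2
    obtain ⟨x, hx, y, hy, z, hz⟩ := h P hP h2
    have hm : P.IsMaximal := hP.isMaximal (hne P h2)
    rw [Ideal.dvd_span_singleton]
    have h1 : 2 * y ∈ P ^ (2 ^ k) := by
      rw [hz]; exact Ideal.mul_mem_right _ _ (Ideal.pow_mem_pow hx _)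
    have hco : IsCoprime (P ^ (2 ^ k)) (Ideal.span {y}) := by
      apply IsCoprime.pow_left
      rw [Ideal.isCoprime_iff_sup_eq]
      exact hm.1.2 _ (lt_of_le_of_ne le_sup_left (fun h => hy (by
        rw [h]; exact Ideal.mem_sup_right (Ideal.mem_span_singleton_self y))))
    rw [← Ideal.dvd_span_singleton, ← Ideal.span_singleton_mul_span_singleton] at h1
    rw [← Ideal.dvd_span_singleton]
    exact hco.dvd_of_dvd_mul_right h1
  have hnu : ¬ IsUnit (2 : 𝓞 L) := by
    intro hu
    have := absNorm_two L
    rw [Ideal.span_singleton_eq_top.2 hu, Ideal.absNorm_top] at this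
    have h2 := Nat.one_lt_two_pow (Module.finrank_pos (R := ℚ) (M := L)).ne'
    omega
  obtain ⟨P, hP, h2P⟩ := exists_max_ideal_of_mem_nonunits hnu
  have key : ∀ P : Ideal (𝓞 L), P.IsPrime → (2 : 𝓞 L) ∈ P → 2 ^ (2 ^ k) ≤ Ideal.absNorm (P ^ (2 ^ k)) := by
    intro P hP h2
    rw [map_pow]
    exact Nat.pow_le_pow_left (two_le_absNorm P (hne P h2) hP.ne_top) _
  have hpos : 0 < Ideal.absNorm (Ideal.span {(2 : 𝓞 L)}) := by rw [absNorm_two]; positivity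
  constructor
  · have h1 := Nat.le_of_dvd hpos (map_dvd Ideal.absNorm (hpow P hP.isPrime h2P))
    have h3 := (key P hP.isPrime h2P).trans h1
    rw [absNorm_two] at h3
    have := (Nat.pow_le_pow_iff_right (by norm_num)).1 h3
    omega
  · refine ⟨P, hne P h2P, hP.isPrime, h2P, fun Q hQ h2Q => ?_⟩
    by_contra hQP
    have hQm : Q.IsMaximal := hQ.isMaximal (hne Q h2Q)
    have hco : IsCoprime (Q ^ (2 ^ k)) (P ^ (2 ^ k)) :=
      (Ideal.isCoprime_of_isMaximal hQP).pow
    have h1 := Nat.le_of_dvd hpos (map_dvd Ideal.absNorm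
      (hco.mul_dvd (hpow Q hQ h2Q) (hpow P hP.isPrime h2P)))
    rw [map_mul, absNorm_two] at h1
    have h3 := (Nat.mul_le_mul (key Q hQ h2Q) (key P hP.isPrime h2P)).trans h1
    rw [← pow_add] at h3
    have h4 := (Nat.pow_le_pow_iff_right (by norm_num)).1 h3
    have : 0 < 2 ^ k := by positivity
    omega

/-- valuation chain step -/
theorem chain_step {R : Type*} [CommRing R] (P : Ideal R) (hP : P.IsPrime) (k : ℕ) (x y u : R)
    (h : x ^ 2 = y * u) (hy : y ∈ P) (hu : u ∉ P) (hk : ∃ y', y' ∉ P ∧ ∃ z, 2 * y' = y ^ (2 ^ k) * z) :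
    x ∈ P ∧ ∃ y', y' ∉ P ∧ ∃ z, 2 * y' = x ^ (2 ^ (k + 1)) * z := by
  obtain ⟨y', hy', z, hz⟩ := hk
  refine ⟨hP.mem_of_pow_mem 2 (by rw [h]; exact Ideal.mul_mem_right _ _ hy), y' * u ^ (2 ^ k), ?_, z, ?_⟩
  · intro h1
    rcases hP.mem_or_mem h1 with h1 | h1
    · exact hy' h1
    · exact hu (hP.mem_of_pow_mem _ h1)
  · rw [pow_succ' 2 k, pow_mul, h, mul_pow]
    linear_combination u ^ (2 ^ k) * hz

theorem chain_t {R : Type*} [CommRing R] (P : Ideal R) (hP : P.IsPrime) (h2 : (2 : R) ∈ P)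
    (t : ℕ → R) (ht0 : t 0 = 2) (n : ℕ) (ht : ∀ k < n, t k = t (k + 1) * (4 - t (k + 1))) :
    t n ∣ 2 ∧ t n ∈ P ∧ ∃ y', y' ∉ P ∧ ∃ z, 2 * y' = t n ^ (2 ^ n) * z := by
  induction n with
  | zero => 
    refine ⟨by rw [ht0], by rwa [ht0], 1, fun h => hP.ne_top ((Ideal.eq_top_iff_one _).2 h), 1, ?_⟩
    rw [ht0]; simp
  | succ n ih =>
    obtain ⟨⟨g, hg⟩, h3, h4⟩ := ih fun k hk => ht k (by omega)
    have h5 := ht n (by omega)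
    have h6 : t (n + 1) ^ 2 = t n * (2 * g * t (n + 1) - 1) := by
      linear_combination h5 + 2 * t (n+1) * hg
    have h7 := chain_step P hP n _ _ _ h6 h3 (by
      intro h
      have : (1 : R) ∈ P := by
        have h8 : (1 : R) = 2 * (g * t (n + 1)) - (2 * g * t (n + 1) - 1) := by ring
        rw [h8]
        exact P.sub_mem (P.mul_mem_right _ h2) h
      exact hP.ne_top ((Ideal.eq_top_iff_one _).2 this)) h4
    refine ⟨⟨(4 - t (n + 1)) * g, by rw [hg, h5]; ring⟩, h7⟩

theorem chain_pi {R : Type*} [CommRing R] (P : Ideal R) (hP : P.IsPrime) (h2 : (2 : R) ∈ P)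
    (t : ℕ → R) (ht0 : t 0 = 2) (n : ℕ) (ht : ∀ k < n, t k = t (k + 1) * (4 - t (k + 1)))
    (π k : R) (hπ : π ^ 2 + t n * π + t n * (1 - k * (4 - t n)) = 0) :
    ∃ x ∈ P, ∃ y', y' ∉ P ∧ ∃ z, 2 * y' = x ^ (2 ^ (n + 1)) * z := by
  obtain ⟨_, h3, h4⟩ := chain_t P hP h2 t ht0 n ht
  have hπP : π ∈ P := hP.mem_of_pow_mem 2 (by
    have : π ^ 2 = t n * (-π - (1 - k * (4 - t n))) := by linear_combination hπ
    rw [this]; exact P.mul_mem_right _ h3)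
  refine ⟨π, chain_step P hP n π (t n) (-π - (1 - k * (4 - t n))) (by linear_combination hπ) h3 ?_ h4⟩
  intro h
  have : (1 : R) ∈ P := by
    have h8 : (1 : R) = -(-π - (1 - k * (4 - t n))) - π + 2 * (2 * k) - t n * k := by ring
    rw [h8]
    exact P.sub_mem (P.add_mem (P.sub_mem (P.neg_mem h) hπP) (P.mul_mem_right _ h2)) (P.mul_mem_right _ h3)
  exact hP.ne_top ((Ideal.eq_top_iff_one _).2 this)
end

section
open NumberField nonZeroDivisors

/-- `2 cos (2π/2^(n+2))` -/
noncomputable def cc (n : ℕ) : ℝ := 2 * Real.cos (2 * Real.pi / 2 ^ (n + 2))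
/-- `2 sin (2π/2^(n+2))` -/
noncomputable def ss (n : ℕ) : ℝ := 2 * Real.sin (2 * Real.pi / 2 ^ (n + 2))

theorem ang (n : ℕ) : 2 * Real.pi / 2 ^ (n + 2) = 2 * (2 * Real.pi / 2 ^ (n + 1 + 2)) := by
  rw [show n + 1 + 2 = (n + 2) + 1 from rfl, pow_succ]; ring

theorem cc_zero : cc 0 = 0 := by
  unfold cc
  rw [show 2 * Real.pi / 2 ^ (0 + 2) = Real.pi / 2 by ring, Real.cos_pi_div_two, mul_zero]
theorem ss_zero : ss 0 = 2 := by
  unfold ss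
  rw [show 2 * Real.pi / 2 ^ (0 + 2) = Real.pi / 2 by ring, Real.sin_pi_div_two, mul_one]
theorem cc_sq (n : ℕ) : cc (n + 1) ^ 2 = 2 + cc n := by
  unfold cc
  rw [ang n, Real.cos_two_mul]; ring
theorem ss_mul (n : ℕ) : ss n = ss (n + 1) * cc (n + 1) := by
  unfold cc ss
  rw [ang n, Real.sin_two_mul]; ring
theorem ss_sq (n : ℕ) : ss n ^ 2 = 4 - cc n ^ 2 := by
  unfold cc ss
  have := Real.sin_sq_add_cos_sq (2 * Real.pi / 2 ^ (n + 2))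
  linear_combination 4 * this
theorem cc_pos (n : ℕ) : 0 < cc (n + 1) := by
  have h : ∀ n, 0 ≤ cc n := by
    intro n
    unfold cc
    have : 0 ≤ Real.cos (2 * Real.pi / 2 ^ (n + 2)) := by
      apply Real.cos_nonneg_of_neg_pi_div_two_le_of_le
      · have : 0 ≤ 2 * Real.pi / 2 ^ (n + 2) := by positivity
        linarith [Real.pi_pos]
      · rw [div_le_iff₀ (by positivity), pow_add]
        have h1 : (1 : ℝ) ≤ 2 ^ n := one_le_pow₀ (by norm_num)
        nlinarith [Real.pi_pos]
    linarith
  have h1 := cc_sq n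
  have h2 := h n
  have h3 := h (n + 1)
  rcases h3.lt_or_eq with h4 | h4
  · exact h4
  · rw [← h4] at h1; linarith
theorem cc_one : cc 1 = Real.sqrt 2 := by
  rw [eq_comm, Real.sqrt_eq_iff_mul_self_eq (by norm_num) (cc_pos 0).le, ← sq, cc_sq, cc_zero, add_zero]

/-- elements of `K(w)` with `w² ∈ K` -/
theorem mem_quad (K : IntermediateField ℚ ℝ) (w : ℝ) (hw : w ^ 2 ∈ K) (x : ℝ) :
    x ∈ K ⊔ IntermediateField.adjoin ℚ {w} ↔ ∃ a ∈ K, ∃ b ∈ K, x = a + b * w := by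
  constructor
  · intro hx
    let S : Subalgebra ℚ ℝ :=
      { carrier := {x | ∃ a ∈ K, ∃ b ∈ K, x = a + b * w}
        mul_mem' := by
          rintro _ _ ⟨a, ha, b, hb, rfl⟩ ⟨a', ha', b', hb', rfl⟩
          exact ⟨a * a' + b * b' * w ^ 2, K.add_mem (K.mul_mem ha ha') (K.mul_mem (K.mul_mem hb hb') hw),
            a * b' + b * a', K.add_mem (K.mul_mem ha hb') (K.mul_mem hb ha'), by ring⟩
        add_mem' := by
          rintro _ _ ⟨a, ha, b, hb, rfl⟩ ⟨a', ha', b', hb', rfl⟩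
          exact ⟨a + a', K.add_mem ha ha', b + b', K.add_mem hb hb', by ring⟩
        algebraMap_mem' := fun q => ⟨algebraMap ℚ ℝ q, K.algebraMap_mem q, 0, K.zero_mem, by ring⟩ }
    let T : IntermediateField ℚ ℝ := S.toIntermediateField (by
      rintro x ⟨a, ha, b, hb, rfl⟩
      by_cases hwK : w ∈ K
      · exact ⟨(a + b * w)⁻¹, K.inv_mem (K.add_mem ha (K.mul_mem hb hwK)), 0, K.zero_mem, by ring⟩
      · by_cases hx : a + b * w = 0
        · rw [hx, inv_zero]; exact ⟨0, K.zero_mem, 0, K.zero_mem, by ring⟩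
        have hd : a ^ 2 - b ^ 2 * w ^ 2 ∈ K := K.sub_mem (pow_mem ha 2) (K.mul_mem (pow_mem hb 2) hw)
        have hb0 : a - b * w ≠ 0 := by
          intro h
          by_cases hb' : b = 0
          · rw [hb'] at h hx; apply hx; linear_combination h
          · apply hwK
            have : w = a / b := by field_simp; linear_combination -h
            rw [this]; exact K.div_mem ha hb
        have e : a ^ 2 - b ^ 2 * w ^ 2 = (a + b * w) * (a - b * w) := by ring
        refine ⟨a / (a ^ 2 - b ^ 2 * w ^ 2), K.div_mem ha hd, -b / (a ^ 2 - b ^ 2 * w ^ 2),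
          K.div_mem (K.neg_mem hb) hd, ?_⟩
        rw [e]; field_simp; ring)
    have h1 : K ⊔ IntermediateField.adjoin ℚ {w} ≤ T := by
      apply sup_le
      · intro a ha; exact ⟨a, ha, 0, K.zero_mem, by ring⟩
      · rw [IntermediateField.adjoin_simple_le_iff]
        exact ⟨0, K.zero_mem, 1, K.one_mem, by ring⟩
    exact h1 hx
  · rintro ⟨a, ha, b, hb, rfl⟩
    have h1 : w ∈ K ⊔ IntermediateField.adjoin ℚ {w} :=
      (le_sup_right : IntermediateField.adjoin ℚ {w} ≤ _) (IntermediateField.mem_adjoin_simple_self ℚ w)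
    have h2 : K ≤ K ⊔ IntermediateField.adjoin ℚ {w} := le_sup_left
    exact add_mem (h2 ha) (mul_mem (h2 hb) h1)

theorem layer_zero (F : IntermediateField ℚ ℝ) : layer F 0 = F := by
  have : layer F 0 = F ⊔ IntermediateField.adjoin ℚ {cc 0} := rfl
  rw [this, cc_zero, IntermediateField.adjoin_zero, sup_bot_eq]

theorem cc_mem_layer (F : IntermediateField ℚ ℝ) (n : ℕ) : cc n ∈ layer F n :=
  (le_sup_right : IntermediateField.adjoin ℚ {cc n} ≤ layer F n)
    (IntermediateField.mem_adjoin_simple_self ℚ _)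

theorem layer_succ (F : IntermediateField ℚ ℝ) (n : ℕ) :
    layer F (n + 1) = layer F n ⊔ IntermediateField.adjoin ℚ {cc (n + 1)} := by
  apply le_antisymm
  · apply sup_le
    · exact le_sup_of_le_left le_sup_left
    · exact le_sup_right
  · apply sup_le
    · apply sup_le
      · exact le_sup_left
      · rw [IntermediateField.adjoin_simple_le_iff]
        change cc n ∈ _
        have h := cc_mem_layer F (n + 1)
        have : cc n = cc (n + 1) ^ 2 - 2 := by rw [cc_sq]; ring
        rw [this]; exact sub_mem (pow_mem h 2) (ofNat_mem _ 2)
    · exact le_sup_right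

theorem mem_layer_succ (F : IntermediateField ℚ ℝ) (n : ℕ) (x : ℝ) :
    x ∈ layer F (n + 1) ↔ ∃ a ∈ layer F n, ∃ b ∈ layer F n, x = a + b * cc (n + 1) := by
  rw [layer_succ]
  apply mem_quad
  rw [cc_sq]; exact add_mem (ofNat_mem _ 2) (cc_mem_layer F n)

theorem layer_mono (F : IntermediateField ℚ ℝ) : Monotone (layer F) :=
  monotone_nat_of_le_succ fun n => by rw [layer_succ]; exact le_sup_left

theorem ss_mem_layer (F : IntermediateField ℚ ℝ) (n : ℕ) : ss n ∈ layer F n := by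
  induction n with
  | zero => rw [ss_zero]; exact ofNat_mem _ 2
  | succ n ih =>
    have : ss (n + 1) = ss n / cc (n + 1) := by
      rw [ss_mul n, mul_div_cancel_right₀ _ (cc_pos n).ne']
    rw [this]; exact div_mem (layer_mono F n.le_succ ih) (cc_mem_layer F _)

theorem mem_sqrt (w : ℝ) (hw : ∃ q : ℚ, w ^ 2 = q) (x : ℝ) :
    x ∈ IntermediateField.adjoin ℚ {w} ↔ ∃ a b : ℚ, x = a + b * w := by
  have h := mem_quad ⊥ w (by obtain ⟨q, hq⟩ := hw; exact IntermediateField.mem_bot.2 ⟨q, hq.symm⟩) x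
  rw [bot_sup_eq] at h
  rw [h]
  constructor
  · rintro ⟨a, ha, b, hb, rfl⟩
    obtain ⟨a, rfl⟩ := IntermediateField.mem_bot.1 ha
    obtain ⟨b, rfl⟩ := IntermediateField.mem_bot.1 hb
    exact ⟨a, b, rfl⟩
  · rintro ⟨a, b, rfl⟩
    exact ⟨a, IntermediateField.mem_bot.2 ⟨a, rfl⟩, b, IntermediateField.mem_bot.2 ⟨b, rfl⟩, rfl⟩
end

section
open NumberField nonZeroDivisors

/-- `ℚ(√M)` -/
noncomputable abbrev Qs (M : ℕ) : IntermediateField ℚ ℝ := IntermediateField.adjoin ℚ {Real.sqrt (M : ℕ)}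
/-- the `n`-th layer over `ℚ(√M)` -/
noncomputable abbrev Fl (M n : ℕ) : IntermediateField ℚ ℝ := layer (Qs M) n

theorem sqrt_sq_nat (M : ℕ) : Real.sqrt (M : ℕ) ^ 2 = M := Real.sq_sqrt (Nat.cast_nonneg M)

theorem sqrt_isInt (M : ℕ) : IsIntegral ℤ (Real.sqrt (M : ℕ)) := by
  apply IsIntegral.of_pow (n := 2) (by norm_num)
  rw [sqrt_sq_nat]
  exact isIntegral_algebraMap (x := (M : ℤ)) |> fun h => by simpa using h

theorem cc_isInt (n : ℕ) : IsIntegral ℤ (cc n) := by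
  induction n with
  | zero => rw [cc_zero]; exact isIntegral_zero
  | succ n ih =>
    apply IsIntegral.of_pow (n := 2) (by norm_num)
    rw [cc_sq]
    have h2 : IsIntegral ℤ (2 : ℝ) := by
      simpa using isIntegral_algebraMap (R := ℤ) (A := ℝ) (x := (2 : ℤ))
    exact h2.add ih

instance (M : ℕ) : FiniteDimensional ℚ (Qs M) :=
  IntermediateField.adjoin.finiteDimensional (sqrt_isInt M).tower_top

theorem fin_cc (n : ℕ) : FiniteDimensional ℚ (IntermediateField.adjoin ℚ {2 * Real.cos (2 * Real.pi / 2 ^ (n + 2))}) :=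
  IntermediateField.adjoin.finiteDimensional (cc_isInt n).tower_top

instance (M n : ℕ) : FiniteDimensional ℚ (Fl M n) := by
  have := fin_cc n
  unfold Fl layer
  infer_instance

instance (M : ℕ) : NumberField (Qs M) := { }
instance (M n : ℕ) : NumberField (Fl M n) := { }

theorem conj_of_sq (y : ℂ) (r : ℝ) (hr : 0 ≤ r) (h : y ^ 2 = r) : ∃ t : ℝ, y = t ∧ t ^ 2 = r := by
  have h1 : (y - Real.sqrt r) * (y + Real.sqrt r) = 0 := by
    have : ((Real.sqrt r : ℝ) : ℂ) ^ 2 = r := by rw [← Complex.ofReal_pow, Real.sq_sqrt hr]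
    linear_combination h - this
  rcases mul_eq_zero.1 h1 with h2 | h2
  · exact ⟨Real.sqrt r, by linear_combination h2, Real.sq_sqrt hr⟩
  · exact ⟨-Real.sqrt r, by push_cast; linear_combination h2, by rw [neg_sq, Real.sq_sqrt hr]⟩

theorem cc_emb (L : IntermediateField ℚ ℝ) (n : ℕ) (h : cc n ∈ L) (φ : L →+* ℂ) :
    ∃ r : ℝ, φ ⟨cc n, h⟩ = r ∧ |r| ≤ 2 := by
  induction n with
  | zero =>
    refine ⟨0, ?_, by norm_num⟩
    have : (⟨cc 0, h⟩ : L) = 0 := by ext; exact cc_zero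
    rw [this, map_zero]; simp
  | succ n ih =>
    have hn : cc n ∈ L := by
      have : cc n = cc (n + 1) ^ 2 - 2 := by rw [cc_sq]; ring
      rw [this]; exact sub_mem (pow_mem h 2) (ofNat_mem _ 2)
    obtain ⟨r, hr, hr2⟩ := ih hn
    have e : (⟨cc (n + 1), h⟩ : L) ^ 2 = 2 + ⟨cc n, hn⟩ := by ext; exact cc_sq n
    have e2 := congrArg φ e
    rw [map_pow, map_add, hr, map_ofNat] at e2
    rw [abs_le] at hr2
    obtain ⟨t, ht, ht2⟩ := conj_of_sq _ (2 + r) (by linarith) (by rw [e2]; push_cast; rfl)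
    exact ⟨t, ht, abs_le.2 ⟨by nlinarith, by nlinarith⟩⟩

theorem sqrt_emb (L : IntermediateField ℚ ℝ) (M : ℕ) (h : Real.sqrt (M : ℕ) ∈ L) (φ : L →+* ℂ) :
    ∃ r : ℝ, φ ⟨Real.sqrt (M : ℕ), h⟩ = r := by
  have e : (⟨Real.sqrt (M : ℕ), h⟩ : L) ^ 2 = (M : L) := by ext; push_cast; exact sqrt_sq_nat M
  have e2 := congrArg φ e
  rw [map_pow, map_natCast] at e2
  obtain ⟨t, ht, _⟩ := conj_of_sq _ (M : ℝ) (Nat.cast_nonneg M) (by rw [e2]; push_cast; rfl)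
  exact ⟨t, ht⟩

theorem Qs_emb (L : IntermediateField ℚ ℝ) (M : ℕ) (φ : L →+* ℂ) (hL : Qs M ≤ L) (x : ℝ) (hx : x ∈ Qs M) :
    ∃ r : ℝ, φ ⟨x, hL hx⟩ = r := by
  obtain ⟨a, b, hab⟩ := (mem_sqrt _ ⟨M, by rw [sqrt_sq_nat]; simp⟩ x).1 hx
  have hs : Real.sqrt (M : ℕ) ∈ L := hL (IntermediateField.mem_adjoin_simple_self ℚ _)
  have : (⟨x, hL hx⟩ : L) = (a : L) + (b : L) * ⟨Real.sqrt (M : ℕ), hs⟩ := by ext; push_cast; exact hab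
  obtain ⟨r, hr⟩ := sqrt_emb L M hs φ
  refine ⟨a + b * r, ?_⟩
  rw [this, map_add, map_mul, hr, map_ratCast, map_ratCast]
  push_cast; rfl

theorem Fl_emb (M n : ℕ) (L : IntermediateField ℚ ℝ) (φ : L →+* ℂ) (hL : Fl M n ≤ L) (x : ℝ) (hx : x ∈ Fl M n) :
    ∃ r : ℝ, φ ⟨x, hL hx⟩ = r := by
  induction n generalizing x with
  | zero =>
    have hx' : x ∈ Qs M := by rwa [Fl, layer_zero] at hx
    exact Qs_emb L M φ (by rwa [Fl, layer_zero] at hL) x hx'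
  | succ n ih =>
    obtain ⟨a, ha, b, hb, hab⟩ := (mem_layer_succ _ _ _).1 hx
    have hL' : Fl M n ≤ L := (layer_mono _ n.le_succ).trans hL
    obtain ⟨r, hr⟩ := ih hL' a ha
    obtain ⟨t, ht⟩ := ih hL' b hb
    obtain ⟨u, hu, _⟩ := cc_emb L (n + 1) (hL (cc_mem_layer _ _)) φ
    have : (⟨x, hL hx⟩ : L) = ⟨a, hL' ha⟩ + ⟨b, hL' hb⟩ * ⟨cc (n + 1), hL (cc_mem_layer _ _)⟩ := by
      ext; exact hab
    refine ⟨r + t * u, ?_⟩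
    rw [this, map_add, map_mul, hr, ht, hu]
    push_cast; rfl

theorem tr_of_emb (L : IntermediateField ℚ ℝ) (h : ∀ (φ : L →+* ℂ) (x : L), ∃ r : ℝ, φ x = r) :
    IsTotallyReal L := by
  constructor
  intro v
  rw [InfinitePlace.isReal_iff, ComplexEmbedding.isReal_iff]
  ext x
  obtain ⟨r, hr⟩ := h v.embedding x
  rw [ComplexEmbedding.conjugate_coe_eq, hr, Complex.conj_ofReal]

instance (M : ℕ) : IsTotallyReal (Qs M) := tr_of_emb _ fun φ x => Qs_emb _ M φ le_rfl x x.2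
instance (M n : ℕ) : IsTotallyReal (Fl M n) := tr_of_emb _ fun φ x => Fl_emb M n _ φ le_rfl x x.2
end

section
open NumberField nonZeroDivisors

theorem quad_ext {K L : Type*} [Field K] [Field L] [CharZero K] [Algebra K L] (w : L) (d : K)
    (hw2 : w ^ 2 = algebraMap K L d) (hwK : ∀ a : K, algebraMap K L a ≠ w)
    (hL : ∀ x : L, ∃ a b : K, x = algebraMap K L a + algebraMap K L b * w) :
    ∃ _ : Algebra.IsQuadraticExtension K L, ∃ σ : L ≃ₐ[K] L, σ ≠ 1 ∧ σ w = -w := by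
  have hli : LinearIndependent K ![(1 : L), w] := by
    rw [LinearIndependent.pair_iff]
    intro s t h
    simp only [Algebra.smul_def, mul_one] at h
    have ht : t = 0 := by
      by_contra ht
      apply hwK (-s / t)
      have : algebraMap K L t ≠ 0 := by simpa using ht
      rw [map_div₀, map_neg]; field_simp; linear_combination -h
    refine ⟨?_, ht⟩
    rw [ht] at h; simpa using h
  have hsp : ⊤ ≤ Submodule.span K (Set.range ![(1 : L), w]) := by
    intro x _
    obtain ⟨a, b, hab⟩ := hL x
    rw [Matrix.range_cons, Matrix.range_cons, Matrix.range_empty, Set.union_empty, Set.singleton_union,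
      Submodule.mem_span_pair]
    exact ⟨a, b, by rw [hab, Algebra.smul_def, Algebra.smul_def, mul_one]⟩
  have hf : Module.finrank K L = 2 := by
    rw [Module.finrank_eq_card_basis (Module.Basis.mk hli hsp)]; simp
  have hq : Algebra.IsQuadraticExtension K L := ⟨hf⟩
  refine ⟨hq, ?_⟩
  have : CharZero L := charZero_of_injective_algebraMap (algebraMap K L).injective
  have hc : Nat.card (L ≃ₐ[K] L) = 2 := by rw [IsGalois.card_aut_eq_finrank, hf]
  have hn : Nontrivial (L ≃ₐ[K] L) := by
    have : Finite (L ≃ₐ[K] L) := Nat.finite_of_card_ne_zero (by omega)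
    rw [← Finite.one_lt_card_iff_nontrivial]; omega
  obtain ⟨σ, hσ⟩ := exists_ne (1 : L ≃ₐ[K] L)
  refine ⟨σ, hσ, ?_⟩
  have h1 : (σ w - w) * (σ w + w) = 0 := by
    have : σ w ^ 2 = w ^ 2 := by rw [← map_pow, hw2, AlgEquiv.commutes]
    linear_combination this
  rcases mul_eq_zero.1 h1 with h2 | h2
  · exfalso; apply hσ; ext x
    obtain ⟨a, b, rfl⟩ := hL x
    rw [map_add, map_mul, AlgEquiv.commutes, AlgEquiv.commutes, sub_eq_zero.1 h2]; rfl
  · linear_combination h2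

/-- the inclusion algebra -/
@[reducible] noncomputable def incAlg {K L : IntermediateField ℚ ℝ} (h : K ≤ L) : Algebra K L :=
  (IntermediateField.inclusion h).toRingHom.toAlgebra

theorem incAlg_map {K L : IntermediateField ℚ ℝ} (h : K ≤ L) (x : K) :
    letI := incAlg h
    ((algebraMap K L x : L) : ℝ) = x := rfl

theorem quad_inc {K L : IntermediateField ℚ ℝ} (h : K ≤ L) (w : ℝ) (hwL : w ∈ L) (hwK : w ∉ K)
    (hw2 : w ^ 2 ∈ K) (hL : ∀ x ∈ L, ∃ a ∈ K, ∃ b ∈ K, x = a + b * w) :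
    letI := incAlg h
    ∃ _ : Algebra.IsQuadraticExtension K L, ∃ σ : L ≃ₐ[K] L, σ ≠ 1 ∧ σ ⟨w, hwL⟩ = -⟨w, hwL⟩ := by
  letI := incAlg h
  apply quad_ext (K := K) (L := L) ⟨w, hwL⟩ ⟨w ^ 2, hw2⟩ rfl
  · intro a ha; apply hwK; have := congrArg Subtype.val ha; rw [incAlg_map] at this
    simp only at this; rw [← this]; exact a.2
  · intro x
    obtain ⟨a, ha, b, hb, hx⟩ := hL x x.2
    exact ⟨⟨a, ha⟩, ⟨b, hb⟩, Subtype.ext hx⟩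

theorem finrank_two_mul (K L : IntermediateField ℚ ℝ) [FiniteDimensional ℚ K] [FiniteDimensional ℚ L] (h : K ≤ L) (w : ℝ) (hwL : w ∈ L)
    (hL : ∀ x ∈ L, ∃ a ∈ K, ∃ b ∈ K, x = a + b * w) : Module.finrank ℚ L ≤ 2 * Module.finrank ℚ K := by
  let f : (K × K) →ₗ[ℚ] L :=
    { toFun := fun p => ⟨p.1 + p.2 * w, add_mem (h p.1.2) (mul_mem (h p.2.2) hwL)⟩
      map_add' := by intro x y; ext; push_cast; simp; ring
      map_smul' := by intro c x; ext; simp [Algebra.smul_def]; ring }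
  have hf : Function.Surjective f := by
    intro x
    obtain ⟨a, ha, b, hb, hx⟩ := hL x x.2
    exact ⟨(⟨a, ha⟩, ⟨b, hb⟩), Subtype.ext hx.symm⟩
  have := LinearMap.finrank_le_finrank_of_surjective hf
  rw [Module.finrank_prod] at this
  omega

theorem finrank_Qs_le (M : ℕ) : Module.finrank ℚ (Qs M) ≤ 2 := by
  let f : (ℚ × ℚ) →ₗ[ℚ] Qs M :=
    { toFun := fun p => ⟨p.1 + p.2 * Real.sqrt (M : ℕ), (mem_sqrt _ ⟨M, by rw [sqrt_sq_nat]; simp⟩ _).2 ⟨_, _, rfl⟩⟩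
      map_add' := by intro x y; ext; push_cast; simp; ring
      map_smul' := by intro c x; ext; simp [Algebra.smul_def]; ring }
  have hf : Function.Surjective f := by
    intro x
    obtain ⟨a, b, hx⟩ := (mem_sqrt _ ⟨M, by rw [sqrt_sq_nat]; simp⟩ _).1 x.2
    exact ⟨(a, b), Subtype.ext hx.symm⟩
  have := LinearMap.finrank_le_finrank_of_surjective hf
  rw [Module.finrank_prod] at this
  simpa using this

theorem finrank_Fl_le (M n : ℕ) : Module.finrank ℚ (Fl M n) ≤ 2 ^ (n + 1) := by
  induction n with
  | zero =>
    have := finrank_Qs_le M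
    have e : Fl M 0 = Qs M := layer_zero _
    rw [e]; simpa using this
  | succ n ih =>
    have := finrank_two_mul (Fl M n) (Fl M (n + 1)) (layer_mono _ n.le_succ) (cc (n + 1)) (cc_mem_layer _ _)
      (fun x hx => (mem_layer_succ _ _ _).1 hx)
    rw [pow_succ]; omega

/-- predicate: degree and unique prime over 2 -/
def UP (L : Type*) [Field L] [NumberField L] (k : ℕ) : Prop :=
  Module.finrank ℚ L = 2 ^ k ∧ ∃ P : Ideal (𝓞 L), P ≠ ⊥ ∧ P.IsPrime ∧ (2 : 𝓞 L) ∈ P ∧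
      ∀ Q : Ideal (𝓞 L), Q.IsPrime → (2 : 𝓞 L) ∈ Q → Q = P

theorem cc_mem_of_le (L : IntermediateField ℚ ℝ) (n : ℕ) (h : cc n ∈ L) : ∀ k ≤ n, cc k ∈ L := by
  intro k hk
  induction n with
  | zero => obtain rfl : k = 0 := by omega
            exact h
  | succ n ih =>
    rcases Nat.lt_or_ge k (n + 1) with h1 | h1
    · refine ih ?_ (by omega)
      have : cc n = cc (n + 1) ^ 2 - 2 := by rw [cc_sq]; ring
      rw [this]; exact sub_mem (pow_mem h 2) (ofNat_mem _ 2)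
    · obtain rfl : k = n + 1 := by omega
      exact h

theorem ss_mem_of (L : IntermediateField ℚ ℝ) (n : ℕ) (h : cc n ∈ L) : ss n ∈ L := by
  have : layer L n = L := by
    apply le_antisymm
    · exact sup_le le_rfl (IntermediateField.adjoin_simple_le_iff.2 h)
    · exact le_sup_left
  rw [← this]; exact ss_mem_layer L n

theorem isInt_sub (L : IntermediateField ℚ ℝ) (x : L) (h : IsIntegral ℤ (x : ℝ)) : IsIntegral ℤ x :=
  (isIntegral_algHom_iff (L.val.restrictScalars ℤ) Subtype.val_injective).1 h

theorem ss_isInt (n : ℕ) : IsIntegral ℤ (ss n) := by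
  apply IsIntegral.of_pow (n := 2) (by norm_num)
  rw [ss_sq]
  have h2 : IsIntegral ℤ (4 : ℝ) := by
    simpa using isIntegral_algebraMap (R := ℤ) (A := ℝ) (x := (4 : ℤ))
  exact h2.sub ((cc_isInt n).pow 2)

theorem isInt_quad (u b c : ℝ) (hb : IsIntegral ℤ b) (hc : IsIntegral ℤ c) (h : u ^ 2 + b * u + c = 0) :
    IsIntegral ℤ u := by
  let R := integralClosure ℤ ℝ
  apply isIntegral_trans (R := ℤ) (A := R)
  refine ⟨Polynomial.X ^ 2 + Polynomial.C (⟨b, hb⟩ : R) * Polynomial.X + Polynomial.C (⟨c, hc⟩ : R), ?_, ?_⟩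
  · monicity!
  · simp [Polynomial.eval₂_add, Polynomial.eval₂_mul, Polynomial.eval₂_pow]
    exact h

/-- real value of an algebraic integer -/
noncomputable def ev (L : IntermediateField ℚ ℝ) : 𝓞 L →+* ℝ := (L.val : L →+* ℝ).comp (algebraMap (𝓞 L) L)

theorem ev_inj (L : IntermediateField ℚ ℝ) {x y : 𝓞 L} (h : ev L x = ev L y) : x = y :=
  RingOfIntegers.ext (Subtype.ext h)

/-- make an algebraic integer from a real -/
noncomputable def mkI (L : IntermediateField ℚ ℝ) (x : ℝ) (h : x ∈ L) (hx : IsIntegral ℤ x) : 𝓞 L :=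
  ⟨⟨x, h⟩, isInt_sub L _ hx⟩

theorem ev_mkI (L : IntermediateField ℚ ℝ) (x : ℝ) (h : x ∈ L) (hx : IsIntegral ℤ x) : ev L (mkI L x h hx) = x := rfl

theorem UP_of (L : IntermediateField ℚ ℝ) [NumberField L] (m n : ℕ) (hm : m % 4 = 3)
    (hs : Real.sqrt (m : ℕ) ∈ L) (hc : cc n ∈ L) (hf : Module.finrank ℚ L ≤ 2 ^ (n + 1)) : UP L (n + 1) := by
  obtain ⟨k, hk⟩ : ∃ k : ℕ, m + 1 = 4 * k := ⟨(m + 1) / 4, by omega⟩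
  have hkr : (m : ℝ) + 1 = 4 * k := by exact_mod_cast hk
  apply unique_prime L (n + 1) hf
  intro P hP h2
  classical
  have I2 : IsIntegral ℤ (2 : ℝ) := by
    simpa using isIntegral_algebraMap (R := ℤ) (A := ℝ) (x := (2 : ℤ))
  have Im : ∀ a : ℕ, IsIntegral ℤ (a : ℝ) := fun a => by
    simpa using isIntegral_algebraMap (R := ℤ) (A := ℝ) (x := (a : ℤ))
  let t : ℕ → 𝓞 L := fun j => if h : cc j ∈ L then mkI L (2 - cc j) (sub_mem (ofNat_mem _ 2) h)
    (I2.sub (cc_isInt j)) else 0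
  have ht : ∀ j ≤ n, ev L (t j) = 2 - cc j := by
    intro j hj
    have : t j = _ := dif_pos (cc_mem_of_le L n hc j hj)
    rw [this, ev_mkI]
  let u : ℝ := (cc n + Real.sqrt (m : ℕ) * ss n) / 2
  have hu : u ^ 2 + (-cc n) * u + (k * cc n ^ 2 - m) = 0 := by
    have h1 := ss_sq n
    have h3 := sqrt_sq_nat m
    simp only [u]
    have : (k : ℝ) = (m + 1) / 4 := by linarith
    rw [this]
    linear_combination (m : ℝ) / 4 * h1 + ss n ^ 2 / 4 * h3
  have huI : IsIntegral ℤ u := isInt_quad u _ _ (cc_isInt n).neg (((Im k).mul ((cc_isInt n).pow 2)).sub (Im m)) hu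
  have huL : u ∈ L := div_mem (add_mem hc (mul_mem hs (ss_mem_of L n hc))) (ofNat_mem _ 2)
  let π : 𝓞 L := mkI L u huL huI - 1
  have hπ : ev L π = u - 1 := by simp only [π, map_sub, map_one, ev_mkI]
  refine chain_pi P hP h2 t ?_ n ?_ π (k : 𝓞 L) ?_
  · apply ev_inj
    rw [ht 0 (Nat.zero_le n), cc_zero, map_ofNat]; simp
  · intro j hj
    apply ev_inj
    rw [map_mul, map_sub, map_ofNat, ht j (by omega), ht (j + 1) (by omega)]
    have := cc_sq j
    linear_combination this
  · apply ev_inj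
    simp only [map_add, map_mul, map_sub, map_pow, map_natCast, map_one, map_zero, map_ofNat, ht n le_rfl, hπ]
    linear_combination hu + hkr

theorem UP_Qs (M : ℕ) (hM : M % 4 = 2 ∨ M % 4 = 3) : UP (Qs M) 1 := by
  have hs : Real.sqrt (M : ℕ) ∈ Qs M := IntermediateField.mem_adjoin_simple_self ℚ _
  rcases hM with hM | hM
  · apply unique_prime (Qs M) 1 (by simpa using finrank_Qs_le M)
    intro P hP h2
    obtain ⟨a, ha⟩ : ∃ a : ℕ, M = 2 * (2 * a + 1) := ⟨M / 4, by omega⟩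
    obtain ⟨h3, h4⟩ := chain_step P hP 0 (mkI _ _ hs (sqrt_isInt M)) 2 (2 * (a : 𝓞 (Qs M)) + 1) (by
      apply ev_inj
      simp only [map_add, map_mul, map_pow, map_natCast, map_one, map_ofNat, ev_mkI]
      rw [sqrt_sq_nat, ha]; push_cast; rfl) h2 (by
      intro h
      apply hP.ne_top
      rw [Ideal.eq_top_iff_one]
      have := P.sub_mem h (P.mul_mem_right (a : 𝓞 (Qs M)) h2)
      simpa using this) ⟨1, fun h => hP.ne_top ((Ideal.eq_top_iff_one _).2 h), 1, by simp⟩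
    exact ⟨_, h3, h4⟩
  · exact UP_of (Qs M) M 0 hM hs (by rw [cc_zero]; exact zero_mem _) (by simpa using finrank_Qs_le M)

theorem Fl_zero (M : ℕ) : Fl M 0 = Qs M := layer_zero _

theorem UP_Fl (M n : ℕ) (hM : M % 4 = 3 ∨ M % 8 = 6) : UP (Fl M n) (n + 1) := by
  have hs : Real.sqrt (M : ℕ) ∈ Fl M n :=
    (le_sup_left : Qs M ≤ Fl M n) (IntermediateField.mem_adjoin_simple_self ℚ _)
  rcases hM with hM | hM
  · exact UP_of (Fl M n) M n hM hs (cc_mem_layer _ _) (finrank_Fl_le M n)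
  · rcases Nat.eq_zero_or_pos n with rfl | hn
    · have := UP_Qs M (by omega)
      have e := Fl_zero M
      have h : ∀ (K L : IntermediateField ℚ ℝ) [NumberField K] [NumberField L], K = L → UP K 1 → UP L 1 := by
        intro K L _ _ e h; subst e; exact h
      exact h _ _ e.symm this
    · obtain ⟨m, hm⟩ : ∃ m, M = 2 * m := ⟨M / 2, by omega⟩
      refine UP_of (Fl M n) m n (by omega) ?_ (cc_mem_layer _ _) (finrank_Fl_le M n)
      have h1 : cc 1 ∈ Fl M n := cc_mem_of_le _ n (cc_mem_layer _ _) 1 hn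
      have : Real.sqrt (m : ℕ) = Real.sqrt (M : ℕ) / cc 1 := by
        rw [cc_one, hm]; push_cast
        rw [Real.sqrt_mul (by norm_num), mul_div_cancel_left₀]
        positivity
      rw [this]; exact div_mem hs h1
end

section
open NumberField nonZeroDivisors

/-- 2-adic valuation of a natural number -/
def v2 (n : ℕ) : ℕ := n.factorization 2

theorem v2_mul {a b : ℕ} (ha : a ≠ 0) (hb : b ≠ 0) : v2 (a * b) = v2 a + v2 b := by
  unfold v2; rw [Nat.factorization_mul ha hb]; rfl

theorem v2_dvd {a b : ℕ} (hb : b ≠ 0) (h : a ∣ b) : v2 a ≤ v2 b := by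
  have ha : a ≠ 0 := fun h0 => hb (by rw [h0] at h; exact zero_dvd_iff.1 h)
  exact (Nat.factorization_le_iff_dvd ha hb).2 h 2

theorem v2_odd {a : ℕ} (h : Odd a) : v2 a = 0 :=
  Nat.factorization_eq_zero_of_not_dvd (by rw [← Nat.not_even_iff_odd, even_iff_two_dvd] at h; exact h)

theorem odd_of_v2 {a : ℕ} (ha : a ≠ 0) (h : v2 a = 0) : Odd a := by
  rw [← Nat.not_even_iff_odd, even_iff_two_dvd]
  intro h2
  have := (Nat.Prime.factorization_pos_of_dvd Nat.prime_two ha h2)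
  unfold v2 at h; omega

theorem odd_card_of_sq {B : Type*} [CommGroup B] [Finite B] (h : ∀ b : B, ∃ c, b = c ^ 2) : Odd (Nat.card B) := by
  rw [← Nat.not_even_iff_odd, even_iff_two_dvd]
  intro h2
  have : Fact (Nat.Prime 2) := ⟨Nat.prime_two⟩
  obtain ⟨x, hx⟩ := exists_prime_orderOf_dvd_card' (G := B) 2 h2
  have hsurj : Function.Surjective (fun c : B => c ^ 2) := fun b => (h b).imp fun c hc => hc.symm
  have hinj := Finite.injective_iff_surjective.2 hsurj
  have h1 : x ^ 2 = 1 := by rw [← hx]; exact pow_orderOf_eq_one x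
  have : x = 1 := hinj (by simpa using h1)
  rw [this, orderOf_one] at hx; omega

theorem fukuda {A C : Type*} [CommGroup A] [Finite A] [CommGroup C] [Finite C] (s : A →* A)
    (hs : ∀ a, s (s (s (s a))) = a) (N : A →* C) (hN : ∀ a, N (s a) = N a) (hodd : Odd N.range.index)
    (k : ℕ) (hk0 : k ≠ 0) (hk : Nat.card ((s.comp s).eqLocus (MonoidHom.id A)) ∣ k)
    (hkC : v2 k = v2 (Nat.card C)) : v2 (Nat.card A) ≤ v2 k := by
  let φ : A →* A := s / MonoidHom.id A
  let ψ : A →* A := (s.comp s) / MonoidHom.id A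
  have hφ : ∀ a, φ a = s a / a := fun a => rfl
  have hψ : ∀ a, ψ a = s (s a) / a := fun a => rfl
  have hDB : ψ.range ≤ φ.range := by
    rintro _ ⟨a, rfl⟩
    refine ⟨s a * a, ?_⟩
    rw [hφ, hψ, map_mul, mul_comm (s (s a)), mul_div_mul_left_eq_div]
  have hker : ψ.ker = (s.comp s).eqLocus (MonoidHom.id A) := by
    ext a
    rw [MonoidHom.mem_ker, hψ, div_eq_one]; rfl
  have hc : ∀ H : Subgroup A, H.index ≠ 0 := fun H => Subgroup.FiniteIndex.index_ne_zero
  have hcard : Nat.card A ≠ 0 := Nat.card_pos.ne'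
  have hidx : ψ.range.index = Nat.card ψ.ker := by
    have h1 := Subgroup.card_mul_index ψ.ker
    have h2 := Subgroup.card_mul_index ψ.range
    rw [Subgroup.index_ker] at h1
    have : Nat.card ψ.range ≠ 0 := Nat.card_pos.ne'
    apply mul_left_cancel₀ this
    rw [h2, ← h1, mul_comm]
  have hv1 : v2 ψ.range.index ≤ v2 k := by
    rw [hidx, hker]; exact v2_dvd hk0 hk
  have hBN : φ.range ≤ N.ker := by
    rintro _ ⟨a, rfl⟩
    rw [MonoidHom.mem_ker, hφ, map_div, hN, div_self']
  have hv2 : v2 (Nat.card C) ≤ v2 φ.range.index := by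
    have h1 := Subgroup.card_mul_index N.range
    rw [← h1, v2_mul Nat.card_pos.ne' (by intro h; rw [h] at hodd; exact absurd hodd (by decide)),
      v2_odd hodd, add_zero, ← Subgroup.index_ker]
    exact v2_dvd (hc _) (Subgroup.index_dvd_of_le hBN)
  have hrel := Subgroup.relIndex_mul_index hDB
  have hrel0 : ψ.range.relIndex φ.range ≠ 0 := by
    intro h; rw [h, zero_mul] at hrel; exact hc _ hrel.symm
  have hv3 : v2 (ψ.range.relIndex φ.range) = 0 := by
    have := v2_mul hrel0 (hc φ.range)
    rw [hrel] at this; omega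
  have he := odd_of_v2 hrel0 hv3
  set e := ψ.range.relIndex φ.range with hedef
  have hpow : ∀ b ∈ φ.range, ∃ b' ∈ φ.range, b ^ e = s b' * b' := by
    intro b hb
    have h1 : (⟨b, hb⟩ : φ.range) ^ e ∈ ψ.range.subgroupOf φ.range := Subgroup.pow_index_mem _ _
    have h2 : b ^ e ∈ ψ.range := h1
    obtain ⟨a, ha⟩ := h2
    refine ⟨φ a, ⟨a, rfl⟩, ?_⟩
    rw [← ha, hψ, hφ, map_div, div_mul_div_cancel]
  have hsB : ∀ b ∈ φ.range, s b ∈ φ.range := by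
    rintro _ ⟨a, rfl⟩
    exact ⟨s a, by rw [hφ, hφ, map_div]⟩
  have hBodd : Odd (Nat.card φ.range) := by
    apply odd_card_of_sq
    rintro ⟨b, hb⟩
    obtain ⟨b1, h1, e1⟩ := hpow b hb
    obtain ⟨b2, h2, e2⟩ := hpow b1 h1
    obtain ⟨b3, h3, e3⟩ := hpow b2 h2
    obtain ⟨b4, h4, e4⟩ := hpow b3 h3
    have key : b ^ (e ^ 4) = (b4 * (s b4) ^ 2 * (s (s b4)) ^ 3 * (s (s (s b4))) ^ 2) ^ 2 := by
      have f3 : b2 ^ (e ^ 2) = s (s b4) * (s b4) ^ 2 * b4 := by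
        rw [pow_two, pow_mul, e3, mul_pow, ← map_pow, e4, map_mul]
        rw [pow_two]; simp only [mul_assoc, mul_left_comm, mul_comm]
      have f1 : b ^ (e ^ 2) = s (s b2) * (s b2) ^ 2 * b2 := by
        rw [pow_two, pow_mul, e1, mul_pow, ← map_pow, e2, map_mul]
        rw [pow_two]; simp only [mul_assoc, mul_left_comm, mul_comm]
      have : b ^ (e ^ 4) = s (s (b2 ^ (e ^ 2))) * (s (b2 ^ (e ^ 2))) ^ 2 * b2 ^ (e ^ 2) := by
        rw [show e ^ 4 = e ^ 2 * e ^ 2 by ring, pow_mul, f1, mul_pow, mul_pow]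
        simp only [map_pow]
        rw [← pow_mul, ← pow_mul, mul_comm 2]
      rw [this, f3]
      simp only [map_mul, map_pow, hs]
      generalize b4 = x at *
      generalize s x = y
      generalize s y = z
      generalize s z = u
      have ht : ∀ x y z u : A, u ^ 2 * x * z * (u * z ^ 2 * y) ^ 2 * (z * y ^ 2 * x) =
          (x * y ^ 2 * z ^ 3 * u ^ 2) ^ 2 := by
        intro x y z u
        simp only [mul_pow, ← pow_mul, pow_succ, pow_zero, one_mul]
        simp only [mul_assoc, mul_left_comm, mul_comm]
      rw [← ht]
      simp only [pow_succ, pow_zero, one_mul, mul_assoc, mul_left_comm, mul_comm]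
    obtain ⟨j, hj⟩ := he.pow (n := 4)
    let c : A := (b4 * (s b4) ^ 2 * (s (s b4)) ^ 3 * (s (s (s b4))) ^ 2) * (b ^ j)⁻¹
    have hc' : c ∈ φ.range := by
      apply mul_mem _ (inv_mem (pow_mem hb j))
      exact mul_mem (mul_mem (mul_mem h4 (pow_mem (hsB _ h4) 2)) (pow_mem (hsB _ (hsB _ h4)) 3))
        (pow_mem (hsB _ (hsB _ (hsB _ h4))) 2)
    refine ⟨⟨c, hc'⟩, Subtype.ext ?_⟩
    change b = c ^ 2
    simp only [c]
    rw [mul_pow, ← key, hj, inv_pow, ← pow_mul, pow_succ, mul_comm j 2]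
    group
  have h1 := Subgroup.card_mul_index φ.range
  rw [← h1, v2_mul Nat.card_pos.ne' (hc _), v2_odd hBodd, zero_add]
  refine le_trans (v2_dvd (hc _) (Subgroup.index_dvd_of_le hDB)) hv1
end

section
open NumberField nonZeroDivisors

theorem UP_congr (K L : IntermediateField ℚ ℝ) [NumberField K] [NumberField L] (k : ℕ) (e : K = L) (h : UP K k) :
    UP L k := by
  subst e; exact h

theorem cc_notMem (M n : ℕ) (hM : M % 4 = 3 ∨ M % 8 = 6) : cc (n + 1) ∉ Fl M n := by
  intro h
  have e : Fl M (n + 1) = Fl M n := by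
    apply le_antisymm
    · intro x hx
      obtain ⟨a, ha, b, hb, rfl⟩ := (mem_layer_succ _ _ _).1 hx
      exact add_mem ha (mul_mem hb h)
    · exact layer_mono _ n.le_succ
  have h1 := (UP_Fl M n hM).1
  have h2 := (UP_congr _ _ _ e (UP_Fl M (n + 1) hM)).1
  have : (2 : ℕ) ^ (n + 1) = 2 ^ (n + 2) := by rw [← h1, h2]
  have := Nat.pow_right_injective (le_refl 2) this
  omega

theorem ss_dvd (L : IntermediateField ℚ ℝ) (n : ℕ) (h : cc n ∈ L) :
    mkI L (ss n) (ss_mem_of L n h) (ss_isInt n) ∣ 2 := by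
  induction n with
  | zero =>
    have : mkI L (ss 0) (ss_mem_of L 0 h) (ss_isInt 0) = 2 := by
      apply ev_inj; rw [ev_mkI, map_ofNat, ss_zero]
    rw [this]
  | succ n ih =>
    refine dvd_trans ?_ (ih (cc_mem_of_le L _ h n n.le_succ))
    refine ⟨mkI L _ h (cc_isInt _), ?_⟩
    apply ev_inj; rw [map_mul, ev_mkI, ev_mkI, ev_mkI, ss_mul]

theorem cc_dvd (L : IntermediateField ℚ ℝ) (n : ℕ) (h : cc (n + 1) ∈ L) :
    mkI L (cc (n + 1)) h (cc_isInt _) ∣ 2 := by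
  refine dvd_trans ?_ (ss_dvd L n (cc_mem_of_le L _ h n n.le_succ))
  refine ⟨mkI L _ (ss_mem_of L _ h) (ss_isInt _), ?_⟩
  apply ev_inj; rw [map_mul, ev_mkI, ev_mkI, ev_mkI, ss_mul, mul_comm]

theorem chev_inc {K L : IntermediateField ℚ ℝ} [NumberField K] [NumberField L] [IsTotallyReal K] [IsTotallyReal L]
    (h : K ≤ L) (w : ℝ) (hwL : w ∈ L) (hwK : w ∉ K)
    (hw2 : w ^ 2 ∈ K) (hL : ∀ x ∈ L, ∃ a ∈ K, ∃ b ∈ K, x = a + b * w) (hwI : IsIntegral ℤ w) (N : ℕ)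
    (hwd : mkI L w hwL hwI ∣ 2 ^ N) (k : ℕ) (hU : UP L k) :
    letI := incAlg h
    ∃ _ : Algebra.IsQuadraticExtension K L, ∃ σ : L ≃ₐ[K] L, σ ≠ 1 ∧ σ ⟨w, hwL⟩ = -⟨w, hwL⟩ ∧
      Nat.card ((clS σ.toRingEquiv).eqLocus (MonoidHom.id _)) ∣ Nat.card (ClassGroup (𝓞 K)) := by
  letI := incAlg h
  obtain ⟨hq, σ, hσ, hs⟩ := quad_inc h w hwL hwK hw2 hL
  obtain ⟨_, P, hP0, hP1, hP2, hP⟩ := hU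
  exact ⟨hq, σ, hσ, hs, chevalley σ hσ (mkI L w hwL hwI) hs N hwd P hP0 hP1 hP2 hP⟩

theorem step_chev (M n : ℕ) (hM : M % 4 = 3 ∨ M % 8 = 6) :
    letI := incAlg (layer_mono (Qs M) n.le_succ)
    ∃ _ : Algebra.IsQuadraticExtension (Fl M n) (Fl M (n + 1)), ∃ σ : Fl M (n + 1) ≃ₐ[Fl M n] Fl M (n + 1), σ ≠ 1 ∧
      σ ⟨cc (n + 1), cc_mem_layer _ _⟩ = -⟨cc (n + 1), cc_mem_layer _ _⟩ ∧
      Nat.card ((clS σ.toRingEquiv).eqLocus (MonoidHom.id _)) ∣ Nat.card (ClassGroup (𝓞 (Fl M n))) := by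
  apply chev_inc _ (cc (n + 1)) (cc_mem_layer _ _) (cc_notMem M n hM) _
    (fun x hx => (mem_layer_succ _ _ _).1 hx) (cc_isInt _) 1 _ (n + 2) (UP_Fl M (n + 1) hM)
  · rw [cc_sq]; exact add_mem (ofNat_mem _ 2) (cc_mem_layer _ _)
  · rw [pow_one]; exact cc_dvd _ _ _

theorem ext_aut {K L : Type*} [Field K] [Field L] [Algebra K L] (w : L) (d : K)
    (hw2 : w ^ 2 = algebraMap K L d) (hwK : ∀ a : K, algebraMap K L a ≠ w)
    (hL : ∀ x : L, ∃ a b : K, x = algebraMap K L a + algebraMap K L b * w) (σ : K →+* K) (s : L)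
    (hs : s ^ 2 = algebraMap K L (σ d)) :
    ∃ φ : L →+* L, (∀ a, φ (algebraMap K L a) = algebraMap K L (σ a)) ∧ φ w = s := by
  have huniq : ∀ a b a' b' : K, algebraMap K L a + algebraMap K L b * w = algebraMap K L a' + algebraMap K L b' * w →
      a = a' ∧ b = b' := by
    intro a b a' b' h
    have hb : b = b' := by
      by_contra hb
      apply hwK ((a' - a) / (b - b'))
      have : algebraMap K L b - algebraMap K L b' ≠ 0 := by
        rw [← map_sub]; simpa [sub_eq_zero] using hb
      rw [map_div₀, map_sub, map_sub]; field_simp; linear_combination -h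
    subst hb
    exact ⟨(algebraMap K L).injective (by linear_combination h), rfl⟩
  choose A B hAB using hL
  have hform : ∀ x a b, x = algebraMap K L a + algebraMap K L b * w → A x = a ∧ B x = b := by
    intro x a b h
    exact huniq _ _ _ _ (by rw [← hAB, h])
  let f : L → L := fun x => algebraMap K L (σ (A x)) + algebraMap K L (σ (B x)) * s
  have hf : ∀ x a b, x = algebraMap K L a + algebraMap K L b * w → f x = algebraMap K L (σ a) + algebraMap K L (σ b) * s := by
    intro x a b h
    obtain ⟨rfl, rfl⟩ := hform x a b h
    rfl
  let φ : L →+* L :=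
    { toFun := f
      map_one' := by rw [hf 1 1 0 (by simp)]; simp
      map_zero' := by rw [hf 0 0 0 (by simp)]; simp
      map_add' := by
        intro x y
        rw [hf (x + y) (A x + A y) (B x + B y) (by rw [map_add, map_add]; linear_combination hAB x + hAB y)]
        simp only [f, map_add]; ring
      map_mul' := by
        intro x y
        rw [hf (x * y) (A x * A y + B x * B y * d) (A x * B y + B x * A y) (by
          simp only [map_add, map_mul]; rw [← hw2]
          conv_lhs => rw [hAB x, hAB y]
          ring)]
        simp only [f, map_add, map_mul]; rw [← hs]; ring }
  refine ⟨φ, fun a => ?_, ?_⟩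
  · change f _ = _
    rw [hf _ a 0 (by simp)]; simp
  · change f _ = _
    rw [hf _ 0 1 (by simp)]; simp

theorem exists_sigma (M n : ℕ) (hM : M % 4 = 3 ∨ M % 8 = 6) :
    ∃ σ : Fl M (n + 2) ≃+* Fl M (n + 2), (∀ x (hx : x ∈ Fl M n), σ ⟨x, layer_mono (Qs M) (by omega) hx⟩ = ⟨x, layer_mono (Qs M) (by omega) hx⟩) ∧
      (∀ x (hx : x ∈ Fl M (n + 1)), σ (σ ⟨x, layer_mono (Qs M) (by omega) hx⟩) = ⟨x, layer_mono (Qs M) (by omega) hx⟩) ∧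
      σ (σ ⟨cc (n + 2), cc_mem_layer _ _⟩) = -⟨cc (n + 2), cc_mem_layer _ _⟩ := by
  letI i1 := incAlg (layer_mono (Qs M) n.le_succ)
  letI i2 := incAlg (layer_mono (Qs M) (n + 1).le_succ)
  obtain ⟨hq, σ', hσ', hc, _⟩ := step_chev M n hM
  have hw : cc (n + 2) ∈ Fl M (n + 2) := cc_mem_layer _ _
  have hsm : ss (n + 2) ∈ Fl M (n + 2) := ss_mem_layer _ _
  obtain ⟨φ, h1, h2⟩ := ext_aut (K := Fl M (n + 1)) (L := Fl M (n + 2)) ⟨cc (n + 2), hw⟩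
    (2 + ⟨cc (n + 1), cc_mem_layer _ _⟩) (by apply Subtype.ext; exact cc_sq (n + 1)) (by
      intro a ha
      apply cc_notMem M (n + 1) hM
      have := congrArg Subtype.val ha
      rw [incAlg_map] at this
      simp only at this; rw [← this]; exact a.2) (by
      intro x
      obtain ⟨a, ha, b, hb, hx⟩ := (mem_layer_succ _ _ _).1 x.2
      exact ⟨⟨a, ha⟩, ⟨b, hb⟩, Subtype.ext hx⟩) (σ' : Fl M (n + 1) →+* Fl M (n + 1)) ⟨ss (n + 2), hsm⟩ (by
      have : (σ' : Fl M (n + 1) →+* Fl M (n + 1)) (2 + ⟨cc (n + 1), cc_mem_layer _ _⟩) = 2 - ⟨cc (n + 1), cc_mem_layer _ _⟩ := by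
        change σ' _ = _
        rw [map_add, hc, map_ofNat]; ring
      rw [this]
      apply Subtype.ext
      change ss (n + 2) ^ 2 = 2 - cc (n + 1)
      rw [ss_sq, cc_sq (n + 1)]; ring)
  have hbij : Function.Bijective φ := by
    refine ⟨φ.injective, ?_⟩
    have : Function.Surjective (φ.toRatAlgHom.toLinearMap) :=
      LinearMap.injective_iff_surjective.1 φ.injective
    exact this
  have h3 : ∀ x (hx : x ∈ Fl M n), φ ⟨x, layer_mono (Qs M) (by omega) hx⟩ = ⟨x, layer_mono (Qs M) (by omega) hx⟩ := by
    intro x hx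
    have := h1 (algebraMap (Fl M n) (Fl M (n + 1)) ⟨x, hx⟩)
    have e : (σ' : Fl M (n + 1) →+* Fl M (n + 1)) (algebraMap (Fl M n) (Fl M (n + 1)) ⟨x, hx⟩) = algebraMap (Fl M n) (Fl M (n + 1)) ⟨x, hx⟩ := σ'.commutes _
    rw [e] at this
    exact this
  refine ⟨RingEquiv.ofBijective φ hbij, h3, ?_, ?_⟩
  · intro x hx
    change φ (φ (algebraMap (Fl M (n + 1)) (Fl M (n + 2)) ⟨x, hx⟩)) = algebraMap (Fl M (n + 1)) (Fl M (n + 2)) ⟨x, hx⟩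
    rw [h1, h1]
    congr 1
    exact quad_sq σ' hσ' _
  · change φ (φ _) = _
    rw [h2]
    have hA : (⟨ss (n + 2), hsm⟩ : Fl M (n + 2)) * ⟨cc (n + 2), hw⟩ * ⟨cc (n + 1), layer_mono (Qs M) (n + 1).le_succ (cc_mem_layer _ _)⟩ = ⟨ss n, layer_mono (Qs M) (by omega) (ss_mem_layer _ n)⟩ := by
      apply Subtype.ext
      change ss (n + 2) * cc (n + 2) * cc (n + 1) = ss n
      rw [← ss_mul, ← ss_mul]
    have hB := congrArg φ hA
    rw [h3 (ss n) (ss_mem_layer _ n), map_mul, map_mul, h2] at hB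
    have hC : φ ⟨cc (n + 1), layer_mono (Qs M) (n + 1).le_succ (cc_mem_layer _ _)⟩ = -⟨cc (n + 1), layer_mono (Qs M) (n + 1).le_succ (cc_mem_layer _ _)⟩ := by
      have := h1 ⟨cc (n + 1), cc_mem_layer _ _⟩
      have e : (σ' : Fl M (n + 1) →+* Fl M (n + 1)) ⟨cc (n + 1), cc_mem_layer _ _⟩ = -⟨cc (n + 1), cc_mem_layer _ _⟩ := hc
      rw [e, map_neg] at this
      exact this
    rw [hC, ← hA] at hB
    have n1 : (⟨cc (n + 1), layer_mono (Qs M) (n + 1).le_succ (cc_mem_layer _ _)⟩ : Fl M (n + 2)) ≠ 0 :=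
      fun h => (cc_pos n).ne' (congrArg Subtype.val h)
    have n2 : (⟨ss (n + 2), hsm⟩ : Fl M (n + 2)) ≠ 0 := by
      intro h
      rw [h] at hA
      rw [zero_mul, zero_mul] at hA
      have h0 : ss n = 0 := (congrArg Subtype.val hA).symm
      have : ∀ k, ss k ≠ 0 := by
        intro k
        induction k with
        | zero => rw [ss_zero]; norm_num
        | succ k ih => intro h; apply ih; rw [ss_mul, h, zero_mul]
      exact this n h0
    apply mul_left_cancel₀ n2
    apply mul_right_cancel₀ n1
    linear_combination -hB

theorem Qs_le (M n : ℕ) : Qs M ≤ Fl M n := le_sup_left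

theorem fukuda_step (M n : ℕ) (hM : M % 4 = 3 ∨ M % 8 = 6)
    (hodd : letI := incAlg (Qs_le M (n + 2)); Odd (clN (Qs M) (Fl M (n + 2))).range.index)
    (hk : v2 (Nat.card (ClassGroup (𝓞 (Fl M (n + 1))))) = v2 (Nat.card (ClassGroup (𝓞 (Qs M))))) :
    v2 (Nat.card (ClassGroup (𝓞 (Fl M (n + 2))))) ≤ v2 (Nat.card (ClassGroup (𝓞 (Qs M)))) := by
  obtain ⟨σ, s1, s2, s3⟩ := exists_sigma M n hM
  letI i0 := incAlg (Qs_le M (n + 2))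
  rw [← hk]
  have hρ : Nat.card (((clS σ).comp (clS σ)).eqLocus (MonoidHom.id _)) ∣ Nat.card (ClassGroup (𝓞 (Fl M (n + 1)))) ∧
      (σ.trans σ).trans (σ.trans σ) = RingEquiv.refl _ := by
    letI i2 := incAlg (layer_mono (Qs M) (n + 1).le_succ)
    obtain ⟨hq, ρ, hρ, hc, hd⟩ := step_chev M (n + 1) hM
    have e : σ.trans σ = ρ.toRingEquiv := by
      ext1 x
      obtain ⟨a, ha, b, hb, hx⟩ := (mem_layer_succ _ _ _).1 x.2
      have hx' : x = ⟨a, layer_mono (Qs M) (n + 1).le_succ ha⟩ + ⟨b, layer_mono (Qs M) (n + 1).le_succ hb⟩ * ⟨cc (n + 2), cc_mem_layer _ _⟩ := Subtype.ext hx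
      have c1 : ρ ⟨a, layer_mono (Qs M) (n + 1).le_succ ha⟩ = ⟨a, layer_mono (Qs M) (n + 1).le_succ ha⟩ := ρ.commutes ⟨a, ha⟩
      have c2 : ρ ⟨b, layer_mono (Qs M) (n + 1).le_succ hb⟩ = ⟨b, layer_mono (Qs M) (n + 1).le_succ hb⟩ := ρ.commutes ⟨b, hb⟩
      change σ (σ x) = ρ x
      rw [hx', map_add, map_add, map_mul, map_mul, map_add, map_mul, s2 a ha, s2 b hb, s3, c1, c2]
      congr 2
      exact hc.symm
    constructor
    · have e2 : (clS σ).comp (clS σ) = clS ρ.toRingEquiv := by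
        apply MonoidHom.ext
        intro c
        change clS σ (clS σ c) = _
        rw [clS_trans, e]
      rw [e2]; exact hd
    · rw [e]
      ext1 x
      exact quad_sq ρ hρ x
  refine fukuda (clS σ) ?_ (clN (Qs M) (Fl M (n + 2))) ?_ hodd _ Nat.card_pos.ne' hρ.1 hk
  · intro c
    rw [clS_trans, clS_trans, clS_trans]
    rw [show σ.trans (σ.trans (σ.trans σ)) = (σ.trans σ).trans (σ.trans σ) from rfl, hρ.2, clS_refl]
  · intro c
    exact clN_clS (Qs M) (Fl M (n + 2)) (AlgEquiv.ofRingEquiv (f := σ) fun x => s1 x (Qs_le M n x.2)) c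
end

section
open NumberField nonZeroDivisors

theorem normcond (p : ℕ) [Fact p.Prime] (M1 a : ℤ) (hM1 : ¬ (p : ℤ) ∣ M1) (ha : ¬ (p : ℤ) ∣ a) :
    ∀ (N : ℕ) (x y z : ℤ), z.natAbs ≤ N → z ≠ 0 → x ^ 2 - p * M1 * y ^ 2 = a * z ^ 2 → legendreSym p a = 1 := by
  have hp : Prime (p : ℤ) := Nat.prime_iff_prime_int.1 (Fact.out)
  have hp2 : 2 ≤ p := (Fact.out : p.Prime).two_le
  intro N
  induction N with
  | zero => intro x y z h1 h2; exact absurd (Int.natAbs_eq_zero.1 (by omega)) h2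
  | succ N ih =>
    intro x y z h1 h2 h
    by_cases hz : (p : ℤ) ∣ z
    · obtain ⟨z', rfl⟩ := hz
      have hx : (p : ℤ) ∣ x := hp.dvd_of_dvd_pow (n := 2)
        ⟨M1 * y ^ 2 + a * p * z' ^ 2, by linear_combination h⟩
      obtain ⟨x', rfl⟩ := hx
      have hp0 : (p : ℤ) ≠ 0 := hp.ne_zero
      have h3 : (p : ℤ) * x' ^ 2 - M1 * y ^ 2 = a * p * z' ^ 2 := by
        apply mul_left_cancel₀ hp0; linear_combination h
      have hy : (p : ℤ) ∣ y := by
        have : (p : ℤ) ∣ M1 * y ^ 2 := ⟨x' ^ 2 - a * z' ^ 2, by linear_combination -h3⟩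
        exact hp.dvd_of_dvd_pow ((hp.dvd_or_dvd this).resolve_left hM1)
      obtain ⟨y', rfl⟩ := hy
      refine ih x' y' z' ?_ (right_ne_zero_of_mul h2) ?_
      · have hz' : z' ≠ 0 := right_ne_zero_of_mul h2
        have : 0 < z'.natAbs := Int.natAbs_pos.2 hz'
        rw [Int.natAbs_mul, Int.natAbs_natCast] at h1
        nlinarith
      · apply mul_left_cancel₀ hp0; linear_combination h3
    · have ha0 : (a : ZMod p) ≠ 0 := by
        rw [Ne, ZMod.intCast_zmod_eq_zero_iff_dvd]; exact ha
      have hz0 : (z : ZMod p) ≠ 0 := by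
        rw [Ne, ZMod.intCast_zmod_eq_zero_iff_dvd]; exact hz
      rw [legendreSym.eq_one_iff p ha0]
      refine ⟨x / z, ?_⟩
      have := congrArg (Int.cast : ℤ → ZMod p) h
      push_cast at this
      rw [CharP.cast_eq_zero, zero_mul, zero_mul, sub_zero] at this
      field_simp
      exact this.symm

theorem normcondQ (p : ℕ) [Fact p.Prime] (M1 a : ℤ) (hM1 : ¬ (p : ℤ) ∣ M1) (ha : ¬ (p : ℤ) ∣ a)
    (x y z : ℚ) (hz : z ≠ 0) (h : x ^ 2 - p * M1 * y ^ 2 = a * z ^ 2) : legendreSym p a = 1 := by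
  refine normcond p M1 a hM1 ha _ (x.num * y.den * z.den) (y.num * x.den * z.den) (z.num * x.den * y.den) le_rfl ?_ ?_
  · have := x.den_nz; have := y.den_nz; have := Rat.num_ne_zero.2 hz
    positivity
  · have h1 : (x.den : ℚ) ≠ 0 := by exact_mod_cast x.den_nz
    have h2 : (y.den : ℚ) ≠ 0 := by exact_mod_cast y.den_nz
    have h3 : (z.den : ℚ) ≠ 0 := by exact_mod_cast z.den_nz
    have e1 : (x.num : ℚ) = x * x.den := (Rat.mul_den_eq_num x).symm
    have e2 : (y.num : ℚ) = y * y.den := (Rat.mul_den_eq_num y).symm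
    have e3 : (z.num : ℚ) = z * z.den := (Rat.mul_den_eq_num z).symm
    have : ((x.num * y.den * z.den) ^ 2 - p * M1 * (y.num * x.den * z.den) ^ 2 : ℚ) = a * (z.num * x.den * y.den) ^ 2 := by
      rw [e1, e2, e3]
      linear_combination (x.den * y.den * z.den : ℚ) ^ 2 * h
    exact_mod_cast this

theorem normcondQ' (p : ℕ) [Fact p.Prime] (M1 a : ℤ) (hM1 : ¬ (p : ℤ) ∣ M1) (ha : ¬ (p : ℤ) ∣ a)
    (x y z : ℚ) (hz : z ≠ 0) (h : x ^ 2 - p * M1 * y ^ 2 = p * a * z ^ 2) : legendreSym p (-(M1 * a)) = 1 := by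
  have hp : Prime (p : ℤ) := Nat.prime_iff_prime_int.1 (Fact.out)
  have hp0 : (p : ℚ) ≠ 0 := by exact_mod_cast (Fact.out : p.Prime).ne_zero
  refine normcondQ p M1 (-(M1 * a)) hM1 ?_ (M1 * y) (x / p) z hz ?_
  · rw [dvd_neg]; intro h; rcases hp.dvd_or_dvd h with h | h; exacts [hM1 h, ha h]
  · push_cast; field_simp
    linear_combination -(M1 : ℚ) * h

theorem leg_neg_one (r : ℕ) [Fact r.Prime] (h : r % 8 = 5) : legendreSym r (-1) = 1 := by
  rw [legendreSym.at_neg_one (by omega)]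
  exact ZMod.χ₄_nat_one_mod_four (by omega)

theorem leg_neg_one' (q : ℕ) [Fact q.Prime] (h : q % 4 = 3) : legendreSym q (-1) = -1 := by
  rw [legendreSym.at_neg_one (by omega)]
  exact ZMod.χ₄_nat_three_mod_four h

theorem leg_two (r : ℕ) [Fact r.Prime] (h : r % 8 = 5) : legendreSym r 2 = -1 := by
  rw [legendreSym.at_two (by omega), ZMod.χ₈_nat_eq_if_mod_eight]
  simp [h]; omega

/-- the standing hypotheses on the three primes -/
structure Hyp (q r s : ℕ) [Fact q.Prime] [Fact r.Prime] [Fact s.Prime] (κ : ℤ) : Prop where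
  q4 : q % 4 = 3
  r8 : r % 8 = 5
  s8 : s % 8 = 5
  kk : κ = 1 ∨ κ = -1
  qr : legendreSym r q = κ
  qs : legendreSym s q = κ
  rs : legendreSym s r = 1
  sr : legendreSym r s = 1

section
variable {q r s : ℕ} [Fact q.Prime] [Fact r.Prime] [Fact s.Prime] {κ : ℤ}

theorem Hyp.of (q4 : q % 4 = 3) (r8 : r % 8 = 5) (s8 : s % 8 = 5) (kk : κ = 1 ∨ κ = -1)
    (qr : legendreSym r q = κ) (qs : legendreSym s q = κ) (rs : legendreSym s r = 1) : Hyp q r s κ :=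
  ⟨q4, r8, s8, kk, qr, qs, rs, by
    rw [← rs]; exact legendreSym.quadratic_reciprocity_one_mod_four (by omega) (by omega)⟩

theorem Hyp.swap (H : Hyp q r s κ) : Hyp q s r κ := ⟨H.q4, H.s8, H.r8, H.kk, H.qs, H.qr, H.sr, H.rs⟩

theorem Hyp.rs_ne (H : Hyp q r s κ) : r ≠ s := by
  rintro rfl
  have h := H.rs
  have : legendreSym r (r : ℤ) = 0 := by rw [legendreSym.eq_zero_iff]; simp
  omega

theorem Hyp.ndvd_of (H : Hyp q r s κ) {d : ℤ} (h : legendreSym r d ≠ 0) : ¬ (r : ℤ) ∣ d := by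
  rwa [Ne, legendreSym.eq_zero_iff, ZMod.intCast_zmod_eq_zero_iff_dvd] at h

/-- local condition at `r` -/
theorem Hyp.genus (H : Hyp q r s κ) (T d0 : ℤ) (hT : legendreSym r T ≠ 0) (hd0 : legendreSym r d0 ≠ 0) (a b : ℕ)
    (ha : a ≤ 1) (ε : ℤ) (hε : ε = 1 ∨ ε = -1)
    (x y z : ℚ) (hz : z ≠ 0) (h : x ^ 2 - (T * r * s : ℤ) * y ^ 2 = (ε * d0 * r ^ a * s ^ b : ℤ) * z ^ 2) :
    legendreSym r d0 = legendreSym r T ^ a := by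
  have hε' : legendreSym r ε = 1 := by
    rcases hε with rfl | rfl
    · exact legendreSym.at_one r
    · exact leg_neg_one r H.r8
  have hs : legendreSym r (s ^ b : ℤ) = 1 := by
    have : ∀ b : ℕ, legendreSym r (s ^ b : ℤ) = 1 := by
      intro b
      induction b with
      | zero => simp
      | succ b ih => rw [pow_succ, legendreSym.mul, ih, H.sr]; rfl
    exact this b
  have hM1 : ¬ (r : ℤ) ∣ T * s := H.ndvd_of (by rw [legendreSym.mul, H.sr, mul_one]; exact hT)
  interval_cases a
  · have := normcondQ r (T * s) (ε * d0 * s ^ b) hM1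
      (H.ndvd_of (by rw [legendreSym.mul, legendreSym.mul, hs, hε', mul_one, one_mul]; exact hd0)) x y z hz (by
        rw [← sub_eq_zero] at h ⊢; rw [← h]; push_cast; ring)
    rw [legendreSym.mul, legendreSym.mul, hs, hε', mul_one, one_mul] at this
    rw [this, pow_zero]
  · have := normcondQ' r (T * s) (ε * d0 * s ^ b) hM1
      (H.ndvd_of (by rw [legendreSym.mul, legendreSym.mul, hs, hε', mul_one, one_mul]; exact hd0)) x y z hz (by
        rw [← sub_eq_zero] at h ⊢; rw [← h]; push_cast; ring)
    rw [← neg_one_mul, legendreSym.mul, legendreSym.mul, legendreSym.mul, legendreSym.mul, legendreSym.mul, hs, hε',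
      leg_neg_one r H.r8, H.sr] at this
    simp only [mul_one, one_mul] at this
    rw [pow_one]
    have h1 := legendreSym.sq_one r (a := T) (by
      rw [Ne, legendreSym.eq_zero_iff] at hT; exact hT)
    calc legendreSym r d0 = legendreSym r T ^ 2 * legendreSym r d0 := by rw [h1, one_mul]
      _ = legendreSym r T * (legendreSym r T * legendreSym r d0) := by ring
      _ = _ := by rw [this, mul_one]

/-- `-1` times a square is not a norm when `q ∣ M` -/
theorem neg_sq_not_norm (q4 : q % 4 = 3) (M1 : ℤ) (hM1 : ¬ (q : ℤ) ∣ M1) (x y z : ℚ) (hz : z ≠ 0) :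
    x ^ 2 - q * M1 * y ^ 2 ≠ -z ^ 2 := by
  intro h
  have h0 : ¬ (q : ℤ) ∣ -1 := by
    intro h
    have := Int.isUnit_iff_natAbs_eq.1 (isUnit_of_dvd_unit h (by simp))
    simp at this; omega
  have := normcondQ q M1 (-1) hM1 h0 x y z hz (by rw [h]; push_cast; ring)
  rw [leg_neg_one' q q4] at this
  omega
end
end

section
open NumberField nonZeroDivisors

section Rp
variable (L : Type*) [Field L] [NumberField L]

/-- principal fractional ideal of a nonzero element -/
noncomputable abbrev pr (x : L) (hx : x ≠ 0) : (FractionalIdeal (𝓞 L)⁰ L)ˣ :=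
  toPrincipalIdeal (𝓞 L) L (Units.mk0 x hx)

theorem pr_mul (x y : L) (hx hy) : pr L x hx * pr L y hy = pr L (x * y) (mul_ne_zero hx hy) := by
  rw [pr, pr, pr, ← map_mul]; congr 1; ext1; rfl

theorem pr_inv (x : L) (hx) : (pr L x hx)⁻¹ = pr L x⁻¹ (inv_ne_zero hx) := by
  rw [pr, pr, ← map_inv]; congr 1; ext1; rfl

theorem pr_congr {x y : L} (hx hy) (h : x = y) : pr L x hx = pr L y hy := by subst h; rfl

theorem pr_unit (v : (𝓞 L)ˣ) (hv) : pr L ((v : 𝓞 L) : L) hv = 1 := by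
  ext1
  rw [coe_toPrincipalIdeal, Units.val_mk0, Units.val_one, ← FractionalIdeal.coeIdeal_span_singleton,
    Ideal.span_singleton_eq_top.2 v.isUnit, FractionalIdeal.coeIdeal_top]

theorem pr_neg (x : L) (hx) : pr L (-x) (neg_ne_zero.2 hx) = pr L x hx := by
  have := pr_unit L (-1) (by simp)
  rw [pr_congr L (neg_ne_zero.2 hx) (mul_ne_zero (by simp) hx) (show -x = (((-1 : (𝓞 L)ˣ) : 𝓞 L) : L) * x by simp),
    ← pr_mul, this, one_mul]
  simp

theorem ideal_sq_inj {I J : Ideal (𝓞 L)} (hI : I ≠ ⊥) (hJ : J ≠ ⊥) (h : I ^ 2 = J ^ 2) : I = J := by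
  apply associated_iff_eq.1
  rw [UniqueFactorizationMonoid.associated_iff_normalizedFactors_eq_normalizedFactors hI hJ]
  have := congrArg UniqueFactorizationMonoid.normalizedFactors h
  rw [UniqueFactorizationMonoid.normalizedFactors_pow, UniqueFactorizationMonoid.normalizedFactors_pow] at this
  ext P
  have := congrArg (Multiset.count P) this
  simpa using this

theorem u_sq_inj {a b : (FractionalIdeal (𝓞 L)⁰ L)ˣ} (h : a ^ 2 = b ^ 2) : a = b := by
  suffices ∀ a : (FractionalIdeal (𝓞 L)⁰ L)ˣ, a ^ 2 = 1 → a = 1 by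
    have := this (a / b) (by rw [div_pow, h, div_self'])
    exact div_eq_one.1 this
  clear h a b
  intro a h
  obtain ⟨x, hx, I, hI⟩ := exists_frac a
  have e : (I : Ideal (𝓞 L)) = Ideal.span {x} := by
    apply ideal_sq_inj L (nonZeroDivisors.ne_zero I.2) (by simpa using hx)
    apply FractionalIdeal.coeIdeal_injective (K := L)
    have := congrArg (fun u => ((u ^ 2 : (FractionalIdeal (𝓞 L)⁰ L)ˣ) : FractionalIdeal (𝓞 L)⁰ L)) hI
    simp only [mul_pow, h, one_mul] at this
    simp only [Units.val_pow_eq_pow_val, FractionalIdeal.coe_mk0, coe_toPrincipalIdeal, Units.val_mk0] at this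
    beta_reduce
    rw [FractionalIdeal.coeIdeal_pow, FractionalIdeal.coeIdeal_pow, FractionalIdeal.coeIdeal_span_singleton, ← this]
  have : FractionalIdeal.mk0 L I = toPrincipalIdeal (𝓞 L) L (Units.mk0 (x : L) (by simpa using hx)) := by
    ext1
    rw [FractionalIdeal.coe_mk0, e, FractionalIdeal.coeIdeal_span_singleton, coe_toPrincipalIdeal, Units.val_mk0]
  rw [this] at hI
  exact mul_eq_right.1 hI

/-- `c` is the class of the ideal with square `(d)` -/
def Rp (d : ℕ) (c : ClassGroup (𝓞 L)) : Prop :=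
  ∃ (a : (FractionalIdeal (𝓞 L)⁰ L)ˣ) (hd : (d : L) ≠ 0), clP L a = c ∧ a ^ 2 = pr L d hd

variable {L}
theorem Rp.mul {d e : ℕ} {c c'} (h : Rp L d c) (h' : Rp L e c') : Rp L (d * e) (c * c') := by
  obtain ⟨a, hd, h1, h2⟩ := h
  obtain ⟨b, he, h3, h4⟩ := h'
  refine ⟨a * b, by push_cast; exact mul_ne_zero hd he, by rw [map_mul, h1, h3], ?_⟩
  rw [mul_pow, h2, h4, pr_mul]
  exact pr_congr _ _ _ (by push_cast; rfl)

theorem Rp.uniq {d : ℕ} {c c'} (h : Rp L d c) (h' : Rp L d c') : c = c' := by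
  obtain ⟨a, hd, h1, h2⟩ := h
  obtain ⟨b, he, h3, h4⟩ := h'
  rw [← h1, ← h3, u_sq_inj L (h2.trans h4.symm)]

theorem Rp.of_elt {d : ℕ} (hd : d ≠ 0) (y : L) (v : (𝓞 L)ˣ) (h : y ^ 2 = d * ((v : 𝓞 L) : L)) : Rp L d 1 := by
  have hd' : (d : L) ≠ 0 := by exact_mod_cast hd
  have hv : ((v : 𝓞 L) : L) ≠ 0 := by simp
  have hy : y ≠ 0 := by rintro rfl; apply mul_ne_zero hd' hv; rw [← h]; simp
  refine ⟨pr L y hy, hd', clP_pr _, ?_⟩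
  have := pr_mul L d _ hd' hv
  rw [pr_unit, mul_one] at this
  rw [this, pow_two, pr_mul]
  exact pr_congr _ _ _ (by rw [← h, pow_two])

theorem Rp.ksq {k : ℕ} (hk : k ≠ 0) : Rp L (k ^ 2) 1 :=
  Rp.of_elt (pow_ne_zero 2 hk) (k : L) 1 (by push_cast; simp)

theorem Rp.one : Rp L 1 1 := by simpa using Rp.ksq (L := L) one_ne_zero

theorem Rp.sq {d : ℕ} {c} (h : Rp L d c) : c ^ 2 = 1 := by
  obtain ⟨a, hd, h1, h2⟩ := h
  rw [← h1, ← map_pow, h2, clP_pr]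

theorem Rp.ne {d : ℕ} {c} (h : Rp L d c) : d ≠ 0 := by
  obtain ⟨a, hd, h1, h2⟩ := h
  rintro rfl; simp at hd

theorem Rp.of_mul_sq {d k : ℕ} {c} (h : Rp L (d * k ^ 2) c) : Rp L d c := by
  have h0 := h.ne
  obtain ⟨a, hd, h1, h2⟩ := h
  have hk : (k : L) ≠ 0 := by rintro h; apply hd; push_cast; rw [h]; simp
  have hd' : (d : L) ≠ 0 := by rintro h; apply hd; push_cast; rw [h]; simp
  refine ⟨a * (pr L k hk)⁻¹, hd', by rw [map_mul, map_inv, clP_pr, inv_one, mul_one, h1], ?_⟩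
  rw [mul_pow, h2, pr_inv, pow_two (pr L _ _), pr_mul, pr_mul]
  apply pr_congr
  push_cast; field_simp

theorem Rp.cancel {d e : ℕ} {c c'} (h : Rp L (d * e) c) (h' : Rp L e c') : Rp L d (c * c') := by
  have := h.mul h'
  apply Rp.of_mul_sq (k := e)
  rwa [_root_.sq, ← mul_assoc]

end Rp
end

section
open NumberField nonZeroDivisors

section quadQ
variable {L : Type*} [Field L] [NumberField L] [Algebra.IsQuadraticExtension ℚ L] (σ : L ≃ₐ[ℚ] L)

theorem rat_sq_dvd (d : ℕ) (hd : Squarefree d) (T : ℚ) (k : ℤ) (h : T ^ 2 = d * k) : ∃ m : ℤ, T = d * m := by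
  have hT : IsIntegral ℤ T := by
    refine IsIntegral.of_pow (n := 2) two_pos ?_
    rw [h]
    exact_mod_cast isIntegral_algebraMap (R := ℤ) (A := ℚ) (x := (d * k : ℤ))
  obtain ⟨t, ht⟩ := IsIntegrallyClosed.isIntegral_iff.1 hT
  have ht' : (t : ℚ) = T := ht
  rw [← ht'] at h
  have h1 : t ^ 2 = d * k := by exact_mod_cast h
  have h2 : (d : ℤ) ∣ t ^ 2 := ⟨k, h1⟩
  have h3 : d ∣ t.natAbs ^ 2 := by rw [← Int.natAbs_pow]; exact Int.natCast_dvd.1 h2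
  have h4 := (hd.dvd_pow_iff_dvd two_ne_zero).1 h3
  obtain ⟨m, hm⟩ := Int.natCast_dvd.2 h4
  exact ⟨m, by rw [← ht', hm]; push_cast; ring⟩

theorem rat_sq_int (T : ℚ) (k : ℤ) (h : T ^ 2 = k) : ∃ m : ℤ, T = m := by
  simpa using rat_sq_dvd 1 squarefree_one T k (by simpa using h)

theorem finrank_quad (L : Type*) [Field L] [NumberField L] [Algebra.IsQuadraticExtension ℚ L] :
    Module.finrank ℚ L = 2 := Algebra.IsQuadraticExtension.finrank_eq_two ℚ L

theorem norm_nat (L : Type*) [Field L] [NumberField L] [Algebra.IsQuadraticExtension ℚ L] (d : ℕ) :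
    Algebra.norm ℚ (d : L) = (d : ℚ) ^ 2 := by
  have := Algebra.norm_algebraMap (R := ℚ) (S := L) (d : ℚ)
  rwa [map_natCast, finrank_quad] at this

theorem quad_parts (hσ : σ ≠ 1) (w : L) (M : ℕ) (hM0 : M ≠ 0) (hw2 : w ^ 2 = M) (hw : σ w = -w) (x : L) : ∃ a b : ℚ, x + σ x = algebraMap ℚ L a ∧ (x - σ x) * w = algebraMap ℚ L b ∧
    algebraMap ℚ L M * 2 * x = algebraMap ℚ L (M * a) + algebraMap ℚ L b * w ∧
    Algebra.norm ℚ x = (a / 2) ^ 2 - M * (b / (2 * M)) ^ 2 := by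
  obtain ⟨a, ha⟩ := quad_fix σ hσ (x + σ x) (by rw [map_add, quad_sq σ hσ, add_comm])
  obtain ⟨b, hb⟩ := quad_fix σ hσ ((x - σ x) * w) (by rw [map_mul, map_sub, quad_sq σ hσ, hw]; ring)
  have hML : (M : L) ≠ 0 := by exact_mod_cast hM0
  refine ⟨a, b, ha.symm, hb.symm, ?_, ?_⟩
  · rw [hb, map_mul, ha, map_natCast]; linear_combination -(x - σ x) * hw2
  · apply (algebraMap ℚ L).injective
    rw [quad_norm σ hσ]
    simp only [map_sub, map_mul, map_pow, map_div₀, map_natCast, map_ofNat, ha, hb]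
    field_simp
    linear_combination (x - σ x) ^ 2 * hw2

theorem sq_norm (hσ : σ ≠ 1) (w : L) (M : ℕ) (hM0 : M ≠ 0) (hw2 : w ^ 2 = M) (hw : σ w = -w) (a : (FractionalIdeal (𝓞 L)⁰ L)ˣ) (b : ClassGroup (𝓞 L)) (h : clP L a = b ^ 2) :
    ∃ X Y z : ℚ, ∃ ε : ℤ, (ε = 1 ∨ ε = -1) ∧ z ≠ 0 ∧ X ^ 2 - M * Y ^ 2 = ε * FractionalIdeal.absNorm (a : FractionalIdeal (𝓞 L)⁰ L) * z ^ 2 := by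
  obtain ⟨β, rfl⟩ := clP_surj (L := L) b
  have : a * (β ^ 2)⁻¹ ∈ (clP L).ker := by rw [MonoidHom.mem_ker, map_mul, h, map_inv, map_pow, mul_inv_cancel]
  rw [clP_ker] at this
  obtain ⟨x, hx⟩ := this
  obtain ⟨X, Y, -, -, -, hn⟩ := quad_parts σ hσ w M hM0 hw2 hw (x : L)
  have e : a = β ^ 2 * toPrincipalIdeal (𝓞 L) L x := by rw [hx, mul_comm, inv_mul_cancel_right]
  have e1 := congrArg (fun u : (FractionalIdeal (𝓞 L)⁰ L)ˣ => FractionalIdeal.absNorm (u : FractionalIdeal (𝓞 L)⁰ L)) e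
  simp only [Units.val_mul, Units.val_pow_eq_pow_val, map_mul, map_pow, coe_toPrincipalIdeal,
    FractionalIdeal.absNorm_span_singleton] at e1
  have hβ : FractionalIdeal.absNorm (β : FractionalIdeal (𝓞 L)⁰ L) ≠ 0 := by
    rw [Ne, FractionalIdeal.absNorm_eq_zero_iff]; exact β.ne_zero
  rw [e1]
  rcases abs_choice (Algebra.norm ℚ (x : L)) with h | h
  · refine ⟨_, _, (FractionalIdeal.absNorm (β : FractionalIdeal (𝓞 L)⁰ L))⁻¹, 1, Or.inl rfl, inv_ne_zero hβ, hn.symm.trans ?_⟩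
    rw [h]; push_cast; field_simp
  · refine ⟨_, _, (FractionalIdeal.absNorm (β : FractionalIdeal (𝓞 L)⁰ L))⁻¹, -1, Or.inr rfl, inv_ne_zero hβ, hn.symm.trans ?_⟩
    rw [h]; push_cast; field_simp

theorem Rp.norm (hσ : σ ≠ 1) (w : L) (M : ℕ) (hM0 : M ≠ 0) (hw2 : w ^ 2 = M) (hw : σ w = -w) {d : ℕ} {c} (h : Rp L d c) (b) (hb : c = b ^ 2) :
    ∃ X Y z : ℚ, ∃ ε : ℤ, (ε = 1 ∨ ε = -1) ∧ z ≠ 0 ∧ X ^ 2 - M * Y ^ 2 = ε * d * z ^ 2 := by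
  obtain ⟨a, hd, h1, h2⟩ := h
  have := sq_norm σ hσ w M hM0 hw2 hw a b (h1.trans hb)
  have e : FractionalIdeal.absNorm (a : FractionalIdeal (𝓞 L)⁰ L) = d := by
    have e1 := congrArg (fun u : (FractionalIdeal (𝓞 L)⁰ L)ˣ => FractionalIdeal.absNorm (u : FractionalIdeal (𝓞 L)⁰ L)) h2
    simp only [Units.val_mul, Units.val_pow_eq_pow_val, map_mul, map_pow, coe_toPrincipalIdeal,
      FractionalIdeal.absNorm_span_singleton, Units.val_mk0] at e1
    have e2 := norm_nat L d
    rw [e2, abs_of_nonneg (by positivity)] at e1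
    exact (pow_left_inj₀ (FractionalIdeal.absNorm_nonneg _) (by positivity) two_ne_zero).1 e1
  rwa [e] at this

theorem tors_rep (hσ : σ ≠ 1) (w : L) (M : ℕ) (hM0 : M ≠ 0) (hw2 : w ^ 2 = M) (hw : σ w = -w) (hneg : ∀ X Y z : ℚ, z ≠ 0 → X ^ 2 - M * Y ^ 2 ≠ - z ^ 2) (c : ClassGroup (𝓞 L)) (hc : c ^ 2 = 1) :
    ∃ u : ℕ, Rp L u c := by
  obtain ⟨a, rfl⟩ := clP_surj (L := L) c
  have : a ^ 2 ∈ (clP L).ker := by rw [MonoidHom.mem_ker, map_pow, hc]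
  rw [clP_ker] at this
  obtain ⟨α, hα⟩ := this
  set n := FractionalIdeal.absNorm (a : FractionalIdeal (𝓞 L)⁰ L) with hn
  have hn0 : n ≠ 0 := by
    rw [Ne, FractionalIdeal.absNorm_eq_zero_iff]; exact a.ne_zero
  have e1 := congrArg (fun u : (FractionalIdeal (𝓞 L)⁰ L)ˣ => FractionalIdeal.absNorm (u : FractionalIdeal (𝓞 L)⁰ L)) hα
  simp only [Units.val_pow_eq_pow_val, map_pow, coe_toPrincipalIdeal,
    FractionalIdeal.absNorm_span_singleton] at e1
  have hN : Algebra.norm ℚ (α : L) = n ^ 2 := by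
    obtain ⟨X, Y, -, -, -, hf⟩ := quad_parts σ hσ w M hM0 hw2 hw (α : L)
    rcases abs_choice (Algebra.norm ℚ (α : L)) with h | h
    · rw [← h, e1]
    · rw [h] at e1
      exact absurd (hf.symm.trans (neg_eq_iff_eq_neg.1 e1)) (hneg _ _ _ hn0)
  have hnL : algebraMap ℚ L n ≠ 0 := by simpa using hn0
  have hNL := quad_norm σ hσ (α : L)
  rw [hN, map_pow] at hNL
  obtain ⟨y, hy, hy2⟩ := quad_h90 σ hσ ((α : L) / algebraMap ℚ L n) (by
    rw [map_div₀, AlgEquiv.commutes]; field_simp; rw [← hNL])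
  have hσy : σ y ≠ 0 := by simpa using hy
  have hyN := quad_norm σ hσ y
  set m := Algebra.norm ℚ y
  have hm0 : m ≠ 0 := by
    intro h; rw [h, map_zero] at hyN; exact mul_ne_zero hy hσy hyN.symm
  have hmL : algebraMap ℚ L m ≠ 0 := by simpa using hm0
  -- J ^ 2 = n / m
  have hJ : (a * (pr L y hy)⁻¹) ^ 2 = pr L (algebraMap ℚ L (n / m)) (by simpa using ⟨hn0, hm0⟩) := by
    rw [mul_pow, ← hα, pr_inv, pow_two (pr L _ _), pr_mul, pr, pr, ← map_mul]
    congr 1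
    ext1
    rw [Units.val_mul, Units.val_mk0, Units.val_mk0, map_div₀, hyN]
    field_simp at hy2 ⊢
    linear_combination hy2
  set u : ℚ := n / m with hu
  have hu0 : u ≠ 0 := div_ne_zero hn0 hm0
  have hden : (u.den : L) ≠ 0 := by exact_mod_cast u.den_nz
  have hnum : u.num ≠ 0 := Rat.num_ne_zero.2 hu0
  have hd0 : ((u.num.natAbs * u.den : ℕ) : L) ≠ 0 := by
    have : u.num.natAbs * u.den ≠ 0 := mul_ne_zero (by simpa using hnum) u.den_nz
    exact_mod_cast this
  refine ⟨u.num.natAbs * u.den, a * (pr L y hy)⁻¹ * pr L u.den hden, hd0, ?_, ?_⟩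
  · rw [map_mul, map_mul, map_inv, clP_pr, clP_pr]; simp
  · rw [mul_pow, hJ, pow_two (pr L _ _), pr_mul, pr_mul]
    have e : algebraMap ℚ L u * ((u.den : L) * u.den) = (u.num : L) * u.den := by
      rw [← mul_assoc]
      congr 1
      have := congrArg (algebraMap ℚ L) (Rat.mul_den_eq_num u)
      rwa [map_mul, map_natCast, map_intCast] at this
    have h3 : (u.num : L) * u.den ≠ 0 := mul_ne_zero (by exact_mod_cast hnum) hden
    rw [pr_congr L _ h3 e]
    rcases Int.natAbs_eq u.num with h | h
    · apply pr_congr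
      conv_lhs => rw [h]
      rw [Nat.cast_mul, Int.cast_natCast]
    · rw [← pr_neg]
      apply pr_congr
      conv_lhs => rw [h]
      rw [Nat.cast_mul, Int.cast_neg, Int.cast_natCast]; ring

theorem Rp.dvd (hσ : σ ≠ 1) (w : L) (M : ℕ) (hM0 : M ≠ 0) (hw2 : w ^ 2 = M) (hw : σ w = -w) {d : ℕ} {c} (h : Rp L d c) (hd : Squarefree d) : d ∣ 4 * M ^ 2 := by
  obtain ⟨a, hd0, h1, h2⟩ := h
  have hML : (M : L) ≠ 0 := by exact_mod_cast hM0
  have hdQ : (d : ℚ) ≠ 0 := by exact_mod_cast hd0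
  have h2' := congrArg Units.val h2
  rw [Units.val_pow_eq_pow_val, coe_toPrincipalIdeal, Units.val_mk0] at h2'
  have hwi : IsIntegral ℤ w := IsIntegral.of_pow (n := 2) two_pos (by
    rw [hw2]; exact_mod_cast isIntegral_algebraMap (R := ℤ) (A := L) (x := (M : ℤ)))
  have key : ∀ x ∈ (a : FractionalIdeal (𝓞 L)⁰ L), ∃ z : 𝓞 L, 2 * M * x = d * z := by
    intro x hx
    have hx2 : x * x ∈ FractionalIdeal.spanSingleton (𝓞 L)⁰ (d : L) := by
      rw [← h2', pow_two]; exact FractionalIdeal.mul_mem_mul hx hx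
    rw [FractionalIdeal.mem_spanSingleton] at hx2
    obtain ⟨z, hz⟩ := hx2
    have hz' : x * x = d * z := by rw [← hz, Algebra.smul_def, mul_comm]
    obtain ⟨T, W, hT, hW, hx3, hN⟩ := quad_parts σ hσ w M hM0 hw2 hw x
    -- norm of x
    obtain ⟨k, hk⟩ : ∃ k : ℤ, Algebra.norm ℚ x = d * k := by
      have e : Algebra.norm ℚ x ^ 2 = (d : ℚ) ^ 2 * Algebra.norm ℚ (z : L) := by
        have e2 := norm_nat L d
        rw [pow_two (Algebra.norm ℚ x), ← map_mul, hz', map_mul, e2]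
      have hzi : IsIntegral ℤ (Algebra.norm ℚ (z : L)) := Algebra.isIntegral_norm ℚ z.isIntegral_coe
      obtain ⟨t, ht⟩ := IsIntegrallyClosed.isIntegral_iff.1 hzi
      obtain ⟨m, hm⟩ := rat_sq_int (Algebra.norm ℚ x / d) t (by
        rw [div_pow, e, ← ht]; field_simp; rfl)
      exact ⟨m, by rw [← hm]; field_simp⟩
    obtain ⟨l, hl⟩ : ∃ l : ℤ, (z : L) + σ z = algebraMap ℚ L l := by
      obtain ⟨l, hl⟩ := quad_fix σ hσ ((z : L) + σ z) (by rw [map_add, quad_sq σ hσ, add_comm])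
      have : IsIntegral ℤ l := by
        rw [← isIntegral_algebraMap_iff (algebraMap ℚ L).injective, hl]
        exact z.isIntegral_coe.add (z.isIntegral_coe.map σ.toRingEquiv.toRingHom.toIntAlgHom)
      obtain ⟨t, ht⟩ := IsIntegrallyClosed.isIntegral_iff.1 this
      exact ⟨t, by rw [← hl, ← ht]; rfl⟩
    have hσz : σ x * σ x = d * σ z := by rw [← map_mul, hz', map_mul, map_natCast]
    have hNx := quad_norm σ hσ x
    have hT2 : T ^ 2 = d * (l + 2 * k : ℤ) := by
      apply (algebraMap ℚ L).injective
      rw [map_pow, ← hT]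
      rw [hk] at hNx
      simp only [map_mul, map_natCast, Int.cast_add, Int.cast_mul, Int.cast_ofNat, map_add, map_ofNat] at hNx ⊢
      rw [← hl]
      linear_combination hz' + hσz - 2 * hNx
    have hW2 : W ^ 2 = d * (M * (l - 2 * k) : ℤ) := by
      apply (algebraMap ℚ L).injective
      rw [map_pow, ← hW]
      rw [hk] at hNx
      simp only [map_mul, map_natCast, Int.cast_sub, Int.cast_mul, Int.cast_ofNat, Int.cast_natCast, map_sub, map_ofNat] at hNx ⊢
      rw [← hl, mul_pow, hw2]
      linear_combination M * hz' + M * hσz + 2 * M * hNx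
    obtain ⟨t, ht⟩ := rat_sq_dvd d hd T _ hT2
    obtain ⟨v, hv⟩ := rat_sq_dvd d hd W _ hW2
    have hiz : ∀ t : ℤ, IsIntegral ℤ (t : L) := fun t => isIntegral_algebraMap (R := ℤ) (A := L) (x := t)
    refine ⟨⟨(M : ℤ) * (t : ℤ) + (v : ℤ) * w, ((hiz M).mul (hiz t)).add ((hiz v).mul hwi)⟩, ?_⟩
    rw [ht, hv] at hx3
    simp only [map_mul, map_natCast, map_intCast] at hx3
    change _ = (d : L) * ((M : ℤ) * (t : ℤ) + (v : ℤ) * w)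
    push_cast
    linear_combination hx3
  have h2M : (2 * M : L) ≠ 0 := mul_ne_zero two_ne_zero hML
  have hle : (a : FractionalIdeal (𝓞 L)⁰ L) * (a : FractionalIdeal (𝓞 L)⁰ L) ≤ FractionalIdeal.spanSingleton (𝓞 L)⁰ ((d : L) ^ 2 / (2 * M) ^ 2) := by
    rw [FractionalIdeal.mul_le]
    intro i hi j hj
    obtain ⟨z1, e1⟩ := key i hi
    obtain ⟨z2, e2⟩ := key j hj
    rw [FractionalIdeal.mem_spanSingleton]
    refine ⟨z1 * z2, ?_⟩
    rw [Algebra.smul_def, map_mul]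
    have : (z1 : L) * z2 * (d : L) ^ 2 = (2 * M) ^ 2 * (i * j) := by linear_combination -e1 * (d * z2) - e2 * (2 * M * i)
    field_simp
    linear_combination this
  have hm : (d : L) ∈ FractionalIdeal.spanSingleton (𝓞 L)⁰ ((d : L) ^ 2 / (2 * M) ^ 2) := by
    apply hle
    rw [← pow_two, h2']
    exact FractionalIdeal.mem_spanSingleton_self _ _
  rw [FractionalIdeal.mem_spanSingleton] at hm
  obtain ⟨z, hz⟩ := hm
  rw [Algebra.smul_def] at hz
  have hz' : (4 * M ^ 2 : L) = d * z := by
    change (z : L) * _ = _ at hz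
    field_simp at hz
    linear_combination -hz
  have hzi : IsIntegral ℤ ((4 * M ^ 2 : ℚ) / d) := by
    rw [← isIntegral_algebraMap_iff (algebraMap ℚ L).injective]
    have : algebraMap ℚ L ((4 * M ^ 2 : ℚ) / d) = z := by
      simp only [map_div₀, map_mul, map_pow, map_natCast, map_ofNat]
      rw [hz']; field_simp
    rw [this]; exact z.isIntegral_coe
  obtain ⟨t, ht⟩ := IsIntegrallyClosed.isIntegral_iff.1 hzi
  have ht' : (t : ℚ) = _ := ht
  rw [eq_div_iff hdQ] at ht'
  have : (t : ℤ) * d = 4 * M ^ 2 := by exact_mod_cast ht'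
  have h3 : (d : ℤ) ∣ ((4 * M ^ 2 : ℕ) : ℤ) := ⟨t, by push_cast; linear_combination -this⟩
  exact Int.natCast_dvd_natCast.1 h3

/-- every class of order two is represented by a squarefree number -/
theorem tors_rep' (hσ : σ ≠ 1) (w : L) (M : ℕ) (hM0 : M ≠ 0) (hw2 : w ^ 2 = M) (hw : σ w = -w) (hneg : ∀ X Y z : ℚ, z ≠ 0 → X ^ 2 - M * Y ^ 2 ≠ - z ^ 2) (c : ClassGroup (𝓞 L)) (hc : c ^ 2 = 1) :
    ∃ d : ℕ, Squarefree d ∧ d ∣ 4 * M ^ 2 ∧ Rp L d c := by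
  obtain ⟨u, hu⟩ := tors_rep σ hσ w M hM0 hw2 hw hneg c hc
  obtain ⟨a, b, hab, ha⟩ := Nat.sq_mul_squarefree u
  have h1 : Rp L a c := by
    apply Rp.of_mul_sq (k := b); rw [mul_comm, hab]; exact hu
  exact ⟨a, ha, Rp.dvd σ hσ w M hM0 hw2 hw h1 ha, h1⟩
end quadQ
end

section
open NumberField nonZeroDivisors

theorem Qs_irr (M : ℕ) (hM : M % 4 = 2 ∨ M % 4 = 3) (a : ℚ) : (a : ℝ) ≠ Real.sqrt (M : ℕ) := by
  intro h
  have h1 : (a : ℝ) ^ 2 = M := by rw [h, sqrt_sq_nat]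
  have h2 : a ^ 2 = (M : ℤ) := by exact_mod_cast h1
  obtain ⟨m, hm⟩ := rat_sq_int a _ h2
  rw [hm] at h2
  have h3 : m ^ 2 = (M : ℤ) := by exact_mod_cast h2
  have h4 : m ^ 2 % 4 = 0 ∨ m ^ 2 % 4 = 1 := by
    rcases Int.even_or_odd' m with ⟨k, rfl | rfl⟩
    · left; ring_nf; omega
    · right; ring_nf; omega
  omega

/-- the square root as an element of the field -/
noncomputable def wQ (M : ℕ) : Qs M := ⟨Real.sqrt (M : ℕ), IntermediateField.mem_adjoin_simple_self ℚ _⟩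

theorem wQ_sq (M : ℕ) : wQ M ^ 2 = M := by
  apply Subtype.ext
  change Real.sqrt (M : ℕ) ^ 2 = (((M : ℕ) : Qs M) : ℝ)
  rw [sqrt_sq_nat]; simp

/-- quadratic over the rationals, with conjugation negating `w` -/
def QuadQ (L : Type*) [Field L] [NumberField L] (w : L) : Prop :=
  ∃ _ : Algebra.IsQuadraticExtension ℚ L, ∃ σ : L ≃ₐ[ℚ] L, σ ≠ 1 ∧ σ w = - w

theorem quadQ_of (L : Type*) [Field L] [NumberField L] (w : L) (d : ℚ) (h1 : w ^ 2 = algebraMap ℚ L d)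
    (h2 : ∀ a : ℚ, algebraMap ℚ L a ≠ w) (h3 : ∀ x : L, ∃ a b : ℚ, x = algebraMap ℚ L a + algebraMap ℚ L b * w) :
    QuadQ L w := quad_ext w d h1 h2 h3

theorem Qs_quad (M : ℕ) (hM : M % 4 = 2 ∨ M % 4 = 3) : QuadQ (Qs M) (wQ M) := by
  apply quadQ_of (Qs M) (wQ M) (M : ℚ)
  · rw [wQ_sq]; simp
  · intro a ha
    apply Qs_irr M hM a
    have := congrArg Subtype.val ha
    rw [← show (wQ M : ℝ) = Real.sqrt (M : ℕ) from rfl, ← ha]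
    simp
  · intro x
    obtain ⟨a, b, h⟩ := (mem_sqrt (Real.sqrt (M : ℕ)) ⟨M, by rw [sqrt_sq_nat]; simp⟩ x).1 x.2
    refine ⟨a, b, Subtype.ext ?_⟩
    rw [h]
    simp [wQ]

theorem Rp.Qs_norm (M : ℕ) (hM : M % 4 = 2 ∨ M % 4 = 3) {d : ℕ} {c} (h : Rp (Qs M) d c) (b) (hb : c = b ^ 2) :
    ∃ X Y z : ℚ, ∃ ε : ℤ, (ε = 1 ∨ ε = -1) ∧ z ≠ 0 ∧ X ^ 2 - M * Y ^ 2 = ε * d * z ^ 2 := by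
  obtain ⟨_, σ, hσ, hw⟩ := Qs_quad M hM
  exact Rp.norm σ hσ (wQ M) M (by omega) (wQ_sq M) hw h b hb

theorem Qs_sq_norm (M : ℕ) (hM : M % 4 = 2 ∨ M % 4 = 3) 
   (a : (FractionalIdeal (𝓞 (Qs M))⁰ (Qs M))ˣ) (b : ClassGroup (𝓞 (Qs M))) (h : clP (Qs M) a = b ^ 2) :
    ∃ X Y z : ℚ, ∃ ε : ℤ, (ε = 1 ∨ ε = -1) ∧ z ≠ 0 ∧ X ^ 2 - M * Y ^ 2 = ε * FractionalIdeal.absNorm (a : FractionalIdeal (𝓞 (Qs M))⁰ (Qs M)) * z ^ 2 := by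
  obtain ⟨_, σ, hσ, hw⟩ := Qs_quad M hM
  exact sq_norm σ hσ (wQ M) M (by omega) (wQ_sq M) hw a b h

theorem Rp.Qs_dvd (M : ℕ) (hM : M % 4 = 2 ∨ M % 4 = 3) {d : ℕ} {c} (h : Rp (Qs M) d c) (hd : Squarefree d) : d ∣ 4 * M ^ 2 := by
  obtain ⟨_, σ, hσ, hw⟩ := Qs_quad M hM
  exact Rp.dvd σ hσ (wQ M) M (by omega) (wQ_sq M) hw h hd

theorem Qs_tors (M : ℕ) (hM : M % 4 = 2 ∨ M % 4 = 3)
    (hneg : ∀ X Y z : ℚ, z ≠ 0 → X ^ 2 - M * Y ^ 2 ≠ - z ^ 2) (c : ClassGroup (𝓞 (Qs M))) (hc : c ^ 2 = 1) :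
    ∃ d : ℕ, Squarefree d ∧ d ∣ 4 * M ^ 2 ∧ Rp (Qs M) d c := by
  obtain ⟨_, σ, hσ, hw⟩ := Qs_quad M hM
  exact tors_rep' σ hσ (wQ M) M (by omega) (wQ_sq M) hw hneg c hc

theorem Rp.Qs_M (M : ℕ) (hM : M % 4 = 2 ∨ M % 4 = 3) : Rp (Qs M) M 1 :=
  Rp.of_elt (by omega) (wQ M) 1 (by rw [wQ_sq]; simp)

/-- Pell unit gives a principal ideal -/
theorem Rp.pell (M : ℕ) (g g' : ℤ) (hg : 0 < g) (hP : g ^ 2 - M * g' ^ 2 = 1) :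
    Rp (Qs M) (2 * (g + 1)).toNat 1 := by
  have hi : ∀ x : ℤ, IsIntegral ℤ (x : Qs M) := fun t => isIntegral_algebraMap (R := ℤ) (A := Qs M) (x := t)
  have hwi : IsIntegral ℤ (wQ M) := IsIntegral.of_pow (n := 2) two_pos (by
    rw [wQ_sq]; exact hi M)
  have hPL : (g : Qs M) ^ 2 - M * (g' : Qs M) ^ 2 = 1 := by exact_mod_cast congrArg (Int.cast : ℤ → Qs M) hP
  let v : (𝓞 (Qs M))ˣ := ⟨⟨g + g' * wQ M, (hi g).add ((hi g').mul hwi)⟩, ⟨g - g' * wQ M, (hi g).sub ((hi g').mul hwi)⟩,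
    by 
      apply RingOfIntegers.ext
      change ((g : Qs M) + g' * wQ M) * ((g : Qs M) - g' * wQ M) = 1
      linear_combination hPL - (g' : Qs M) ^ 2 * wQ_sq M, by 
      apply RingOfIntegers.ext
      change ((g : Qs M) - g' * wQ M) * ((g : Qs M) + g' * wQ M) = 1
      linear_combination hPL - (g' : Qs M) ^ 2 * wQ_sq M⟩
  refine Rp.of_elt (by omega) (g + 1 + g' * wQ M : Qs M) v ?_
  have h1 : (((2 * (g + 1)).toNat : ℕ) : Qs M) = 2 * (g + 1) := by
    have : (((2 * (g + 1)).toNat : ℕ) : ℤ) = 2 * (g + 1) := Int.toNat_of_nonneg (by omega)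
    exact_mod_cast congrArg (Int.cast : ℤ → Qs M) this
  have h2 : ((v : 𝓞 (Qs M)) : Qs M) = g + g' * wQ M := rfl
  rw [h1, h2]
  linear_combination (g' : Qs M) ^ 2 * wQ_sq M - hPL
end

section
open NumberField nonZeroDivisors

section
variable {q r s : ℕ} [Fact q.Prime] [Fact r.Prime] [Fact s.Prime] {κ : ℤ}

theorem Hyp.mod4 (H : Hyp q r s κ) {T : ℕ} (hT : T = q ∨ T = 2 * q) :
    (T * r * s) % 4 = 3 ∨ (T * r * s) % 8 = 6 := by
  have h1 := H.q4; have h2 := H.r8; have h3 := H.s8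
  have h4 : (r * s) % 8 = 1 := by rw [Nat.mul_mod, h2, h3]
  rw [mul_assoc]
  rcases hT with rfl | rfl
  · left; rw [Nat.mul_mod, h1, show (r * s) % 4 = 1 by omega]
  · right; rw [Nat.mul_mod, h4, show (2 * q) % 8 = 6 by omega]

theorem Hyp.mod4' (H : Hyp q r s κ) {T : ℕ} (hT : T = q ∨ T = 2 * q) :
    (T * r * s) % 4 = 2 ∨ (T * r * s) % 4 = 3 := by
  rcases H.mod4 hT with h | h <;> omega

theorem Hyp.q_ndvd (H : Hyp q r s κ) {u : ℤ} (hu : u = 1 ∨ u = 2) : ¬ (q : ℤ) ∣ u * r * s := by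
  have hq : Prime (q : ℤ) := Nat.prime_iff_prime_int.1 (Fact.out)
  have h1 := H.q4; have h2 := H.r8; have h3 := H.s8
  intro h
  rcases hq.dvd_or_dvd h with h | h
  · rcases hq.dvd_or_dvd h with h | h
    · rcases hu with rfl | rfl
      · have := Int.le_of_dvd (by norm_num) h; omega
      · have := Int.le_of_dvd (by norm_num) h; omega
    · have := (Nat.prime_dvd_prime_iff_eq (Fact.out : q.Prime) (Fact.out : r.Prime)).1 (by exact_mod_cast h); omega
  · have := (Nat.prime_dvd_prime_iff_eq (Fact.out : q.Prime) (Fact.out : s.Prime)).1 (by exact_mod_cast h); omega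

theorem Hyp.neg (H : Hyp q r s κ) {T : ℕ} (hT : T = q ∨ T = 2 * q) (X Y z : ℚ) (hz : z ≠ 0) :
    X ^ 2 - (T * r * s : ℕ) * Y ^ 2 ≠ - z ^ 2 := by
  rcases hT with rfl | rfl
  · have := neg_sq_not_norm H.q4 (1 * r * s) (H.q_ndvd (Or.inl rfl)) X Y z hz
    intro h; apply this; rw [← h]; push_cast; ring
  · have := neg_sq_not_norm H.q4 (2 * r * s) (H.q_ndvd (Or.inr rfl)) X Y z hz
    intro h; apply this; rw [← h]; push_cast; ring

/-- the possible parts away from `r`, `s` -/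
def D0 (q d : ℕ) : Prop := d = 1 ∨ d = 2 ∨ d = q ∨ d = 2 * q

theorem Hyp.class_d (H : Hyp q r s κ) {T : ℕ} (hT : T = q ∨ T = 2 * q) (d : ℕ) (hd : Squarefree d)
    (h : d ∣ 4 * (T * r * s) ^ 2) : ∃ d0 a b, a ≤ 1 ∧ b ≤ 1 ∧ D0 q d0 ∧ d = d0 * r ^ a * s ^ b := by
  have h1 : d ∣ (2 * q * r * s) ^ 4 := by
    refine h.trans ?_
    rcases hT with hT | hT
    · exact ⟨4 * (q * r * s) ^ 2, by rw [hT]; ring⟩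
    · exact ⟨(q * r * s) ^ 2, by rw [hT]; ring⟩
  have h2 := (hd.dvd_pow_iff_dvd (by norm_num)).1 h1
  obtain ⟨x, ds, hx, hs, rfl⟩ := Nat.dvd_mul.1 h2
  obtain ⟨d0, dr, h0, hr, rfl⟩ := Nat.dvd_mul.1 hx
  obtain ⟨e, dq, he, hq, rfl⟩ := Nat.dvd_mul.1 h0
  have H0 : D0 q (e * dq) := by
    rcases (Nat.dvd_prime Nat.prime_two).1 he with rfl | rfl <;>
    rcases (Nat.dvd_prime (Fact.out : q.Prime)).1 hq with rfl | rfl <;> simp [D0]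
  have Hr : ∃ a ≤ 1, dr = r ^ a := by
    rcases (Nat.dvd_prime (Fact.out : r.Prime)).1 hr with rfl | rfl
    · exact ⟨0, by simp⟩
    · exact ⟨1, by simp⟩
  have Hs : ∃ a ≤ 1, ds = s ^ a := by
    rcases (Nat.dvd_prime (Fact.out : s.Prime)).1 hs with rfl | rfl
    · exact ⟨0, by simp⟩
    · exact ⟨1, by simp⟩
  obtain ⟨a, ha, rfl⟩ := Hr
  obtain ⟨b, hb, rfl⟩ := Hs
  exact ⟨_, a, b, ha, hb, H0, rfl⟩

/-- the value of the Legendre symbol on `D0` (the same at `r` and at `s`) -/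
theorem Hyp.leg_d0 (H : Hyp q r s κ) {d : ℕ} (h : D0 q d) :
    (d = 1 ∧ legendreSym r d = 1) ∨ (d = 2 ∧ legendreSym r d = -1) ∨ (d = q ∧ legendreSym r d = κ) ∨
    (d = 2 * q ∧ legendreSym r d = -κ) := by
  rcases h with rfl | rfl | rfl | rfl
  · left; simp
  · right; left; exact ⟨rfl, leg_two r H.r8⟩
  · right; right; left; exact ⟨rfl, H.qr⟩
  · right; right; right; refine ⟨rfl, ?_⟩
    push_cast
    rw [legendreSym.mul, leg_two r H.r8, H.qr]; ring

theorem Hyp.leg_d0_ne (H : Hyp q r s κ) {d : ℕ} (h : D0 q d) : legendreSym r d ≠ 0 := by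
  have := H.kk
  rcases H.leg_d0 h with h | h | h | h <;> omega

/-- genus conditions for principal ideals and squares -/
theorem Hyp.genus_Rp (H : Hyp q r s κ) {T : ℕ} (hT : T = q ∨ T = 2 * q) {d0 a b : ℕ} (hd0 : D0 q d0)
    (ha : a ≤ 1) (hb : b ≤ 1) {c} (h : Rp (Qs (T * r * s)) (d0 * r ^ a * s ^ b) c) (x) (hx : c = x ^ 2) :
    legendreSym r d0 = legendreSym r T ^ a ∧ legendreSym s d0 = legendreSym s T ^ b := by
  have hTD : D0 q T := by rcases hT with h | h <;> simp [D0, h]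
  obtain ⟨X, Y, z, ε, hε, hz, h1⟩ := h.Qs_norm _ (H.mod4' hT) x hx
  constructor
  · refine H.genus T d0 (H.leg_d0_ne hTD) (H.leg_d0_ne hd0) a b ha ε hε X Y z hz ?_
    push_cast at h1 ⊢; linear_combination h1
  · refine H.swap.genus T d0 (H.swap.leg_d0_ne hTD) (H.swap.leg_d0_ne hd0) b a hb ε hε X Y z hz ?_
    push_cast at h1 ⊢; linear_combination h1
end

/-- Pell: the squarefree part -/
theorem pell_d (M : ℕ) (hM : M % 4 = 2 ∨ M % 4 = 3) (hsf : Squarefree M)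
    (hneg : ∀ X Y z : ℚ, z ≠ 0 → X ^ 2 - M * Y ^ 2 ≠ - z ^ 2)
    (g g' : ℤ) (hg : 0 < g) (hg' : 0 < g') (hP : g ^ 2 - M * g' ^ 2 = 1)
    (hmin : ∀ a b : ℤ, 0 < a → 0 < b → a ^ 2 - M * b ^ 2 = 1 → g ≤ a) :
    ∃ d : ℕ, Squarefree d ∧ Rp (Qs M) d 1 ∧ d ≠ 1 ∧ d ≠ M ∧
      ∃ k : ℤ, k ≠ 0 ∧ 2 * (g + 1) = d * k ^ 2 := by
  have h := Rp.pell M g g' hg hP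
  obtain ⟨d, k, hdk, hd⟩ := Nat.sq_mul_squarefree (2 * (g + 1)).toNat
  rw [← hdk, mul_comm] at h
  have hdk' : 2 * (g + 1) = d * (k : ℤ) ^ 2 := by
    have : (((2 * (g + 1)).toNat : ℕ) : ℤ) = 2 * (g + 1) := Int.toNat_of_nonneg (by omega)
    rw [← this, ← hdk]; push_cast; ring
  have hk : (k : ℤ) ≠ 0 := by
    intro h; rw [h] at hdk'; simp at hdk'; omega
  have hkQ : (k : ℚ) ≠ 0 := by exact_mod_cast hk
  have hMQ : (M : ℚ) ≠ 0 := by exact_mod_cast (show M ≠ 0 by omega)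
  have hPQ : (g : ℚ) ^ 2 - M * (g' : ℚ) ^ 2 = 1 := by exact_mod_cast hP
  have hdkQ : 2 * ((g : ℚ) + 1) = d * (k : ℚ) ^ 2 := by exact_mod_cast hdk'
  refine ⟨d, hd, h.of_mul_sq, ?_, ?_, k, hk, hdk'⟩
  · rintro rfl
    have hev : Even (k : ℤ) := by
      have : Even ((k : ℤ) ^ 2) := ⟨g + 1, by push_cast at hdk'; linarith⟩
      exact (Int.even_pow' two_ne_zero).1 this
    obtain ⟨u, hu⟩ := hev
    have hu0 : u ≠ 0 := by rintro rfl; omega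
    have hu0' : (u : ℚ) ≠ 0 := by exact_mod_cast hu0
    have hgu : g + 1 = 2 * u ^ 2 := by rw [hu] at hdk'; push_cast at hdk'; linarith
    have hguQ : (g : ℚ) + 1 = 2 * (u : ℚ) ^ 2 := by exact_mod_cast hgu
    have h1 : M * ((g' : ℚ) / (2 * u)) ^ 2 = u ^ 2 - 1 := by
      field_simp
      have : (g : ℚ) = 2 * u ^ 2 - 1 := by linarith
      rw [this] at hPQ
      linear_combination -hPQ
    obtain ⟨m, hm⟩ := rat_sq_dvd M hsf (M * ((g' : ℚ) / (2 * u))) (u ^ 2 - 1) (by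
      push_cast; rw [← h1]; ring)
    have hm' : (g' : ℚ) / (2 * u) = m := mul_left_cancel₀ hMQ hm
    have h3 : (g' : ℚ) = m * (2 * u) := by rw [← hm']; field_simp
    have h3' : g' = m * (2 * u) := by exact_mod_cast h3
    rw [hm'] at h1
    have h1' : (M : ℤ) * m ^ 2 = u ^ 2 - 1 := by exact_mod_cast h1
    have hm0 : m ≠ 0 := by rintro rfl; simp at h3'; omega
    have := hmin |u| |m| (abs_pos.2 hu0) (abs_pos.2 hm0) (by rw [sq_abs, sq_abs, h1']; ring)
    have hu2 : u ^ 2 = |u| ^ 2 := (sq_abs u).symm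
    have hM2 : 2 ≤ M := by omega
    have : 1 ≤ m ^ 2 := by have := sq_pos_of_ne_zero hm0; omega
    have : 2 ≤ |u| := by
      have := abs_pos.2 hu0
      by_contra hh
      have : |u| = 1 := by omega
      rw [this] at hu2
      rw [hu2] at h1'
      have h5 : (2 : ℤ) ≤ M := by exact_mod_cast hM2
      nlinarith
    nlinarith
  · rintro rfl
    have hg1 : (g : ℚ) + 1 ≠ 0 := by have : (0 : ℚ) < g := by exact_mod_cast hg
                                     linarith
    apply hneg (2 * g' / k) k 2 two_ne_zero
    field_simp
    have e : (g : ℚ) = d * (k : ℚ) ^ 2 / 2 - 1 := by linarith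
    rw [e] at hPQ
    have : (d : ℚ) * k ^ 2 ≠ 0 := by positivity
    apply mul_left_cancel₀ hMQ
    linear_combination -4 * hPQ
end

section
open NumberField nonZeroDivisors

theorem pell_exists (M : ℕ) (hM : M % 4 = 2 ∨ M % 4 = 3) : ∃ g g' : ℤ, 0 < g ∧ 0 < g' ∧ g ^ 2 - M * g' ^ 2 = 1 ∧
    ∀ a b : ℤ, 0 < a → 0 < b → a ^ 2 - M * b ^ 2 = 1 → g ≤ a := by
  have hns : ¬ IsSquare (M : ℤ) := by
    rintro ⟨m, hm⟩
    rcases Int.even_or_odd' m with ⟨k, rfl | rfl⟩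
    · ring_nf at hm; omega
    · ring_nf at hm; omega
  obtain ⟨a, ha1, ha2, ha3⟩ := Pell.IsFundamental.exists_of_not_isSquare (d := M) (by omega) hns
  refine ⟨a.x, a.y, by omega, ha2, a.prop, ?_⟩
  intro x y hx hy h
  have h1 : 1 < x := by
    have : (0 : ℤ) < M * y ^ 2 := by have : (0 : ℤ) < M := by omega
                                     positivity
    nlinarith
  exact ha3 (b := Pell.Solution₁.mk x y h) (by simpa using h1)

section
variable {q r s : ℕ} [Fact q.Prime] [Fact r.Prime] [Fact s.Prime] {κ : ℤ}

theorem Hyp.sqf (H : Hyp q r s κ) {T : ℕ} (hT : T = q ∨ T = 2 * q) : Squarefree (T * r * s) := by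
  have h1 := H.q4; have h2 := H.r8; have h3 := H.s8; have h4 := H.rs_ne
  have hq := (Fact.out : q.Prime); have hr := (Fact.out : r.Prime); have hs := (Fact.out : s.Prime)
  have e1 : Nat.Coprime q r := (Nat.coprime_primes hq hr).2 (by rintro rfl; omega)
  have e2 : Nat.Coprime q s := (Nat.coprime_primes hq hs).2 (by rintro rfl; omega)
  have e3 : Nat.Coprime r s := (Nat.coprime_primes hr hs).2 h4
  have f1 : Nat.Coprime 2 q := (Nat.coprime_primes Nat.prime_two hq).2 (by omega)
  have f2 : Nat.Coprime 2 r := (Nat.coprime_primes Nat.prime_two hr).2 (by omega)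
  have f3 : Nat.Coprime 2 s := (Nat.coprime_primes Nat.prime_two hs).2 (by omega)
  have : Squarefree (2 * q * r * s) := by
    rw [Nat.squarefree_mul_iff, Nat.squarefree_mul_iff, Nat.squarefree_mul_iff]
    exact ⟨(f3.mul_left e2).mul_left e3, ⟨f2.mul_left e1, ⟨f1, Nat.prime_two.squarefree, hq.squarefree⟩, hr.squarefree⟩, hs.squarefree⟩
  refine this.squarefree_of_dvd ?_
  rcases hT with hT | hT
  · exact ⟨2, by rw [hT]; ring⟩
  · rw [hT]

theorem Hyp.leg_q (H : Hyp q r s κ) {u : ℤ} (hu : u = 1 ∨ u = 2) : legendreSym q (-(u * r * s * u)) ≠ 1 := by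
  have hr : legendreSym q r = κ := by
    rw [← H.qr]; exact legendreSym.quadratic_reciprocity_one_mod_four (by have := H.r8; omega) (by have := H.q4; omega)
  have hs : legendreSym q s = κ := by
    rw [← H.qs]; exact legendreSym.quadratic_reciprocity_one_mod_four (by have := H.s8; omega) (by have := H.q4; omega)
  have hu2 : legendreSym q (u ^ 2) = 1 := by
    apply legendreSym.sq_one'
    rw [Ne, ZMod.intCast_zmod_eq_zero_iff_dvd]
    intro h
    exact H.q_ndvd hu ((h.mul_right _).mul_right _)
  have : -(u * r * s * u) = -1 * (r * (s * u ^ 2)) := by ring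
  rw [this, legendreSym.mul, legendreSym.mul, legendreSym.mul, hr, hs, hu2, leg_neg_one' q H.q4]
  rcases H.kk with h | h <;> rw [h] <;> norm_num

theorem Hyp.t_or {t : ℕ} (ht : (κ = 1 ∧ t = q) ∨ (κ = -1 ∧ t = 2 * q)) : t = q ∨ t = 2 * q := by
  rcases ht with h | h; exacts [Or.inl h.2, Or.inr h.2]

theorem Hyp.F0 (H : Hyp q r s κ) {t : ℕ} (ht : (κ = 1 ∧ t = q) ∨ (κ = -1 ∧ t = 2 * q))
    (g g' : ℤ) (hg : 0 < g) (hg' : 0 < g') (hP : g ^ 2 - (t * r * s : ℕ) * g' ^ 2 = 1)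
    (hmin : ∀ a b : ℤ, 0 < a → 0 < b → a ^ 2 - (t * r * s : ℕ) * b ^ 2 = 1 → g ≤ a)
    (hns : ¬ ∃ l : ℚ, 2 * ((g : ℚ) - 1) = t * l ^ 2) :
    Rp (Qs (t * r * s)) r 1 ∨ Rp (Qs (t * r * s)) s 1 := by
  have hT := Hyp.t_or ht
  obtain ⟨d, hd, hR, h1, hM, k, hk, hgk⟩ := pell_d _ (H.mod4' hT) (H.sqf hT) (H.neg hT) g g' hg hg' hP hmin
  obtain ⟨d0, a, b, ha, hb, hd0, rfl⟩ := H.class_d hT d hd (hR.Qs_dvd _ (H.mod4' hT) hd)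
  have hgen := H.genus_Rp hT hd0 ha hb hR 1 (by simp)
  have hRM := Rp.Qs_M _ (H.mod4' hT)
  have hr0 : (r : ℚ) ≠ 0 := by exact_mod_cast (Fact.out : r.Prime).ne_zero
  have hs0 : (s : ℚ) ≠ 0 := by exact_mod_cast (Fact.out : s.Prime).ne_zero
  have hq0 : (q : ℚ) ≠ 0 := by exact_mod_cast (Fact.out : q.Prime).ne_zero
  have ht0 : (t : ℚ) ≠ 0 := by
    have : t ≠ 0 := by have := (Fact.out : q.Prime).pos; omega
    exact_mod_cast this
  have hlegt : legendreSym r t = 1 := by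
    rcases ht with ⟨h1, h2⟩ | ⟨h1, h2⟩
    · rw [h2, H.qr, h1]
    · rw [h2]; push_cast; rw [legendreSym.mul, leg_two r H.r8, H.qr, h1]; norm_num
  have hd0' : d0 = 1 ∨ d0 = t := by
    have e1 := hgen.1
    rw [hlegt, one_pow] at e1
    have := H.leg_d0 hd0
    omega
  have hkQ : (k : ℚ) ≠ 0 := by exact_mod_cast hk
  have hPQ : (g : ℚ) ^ 2 - (t * r * s) * (g' : ℚ) ^ 2 = 1 := by exact_mod_cast hP
  have hgkQ : 2 * ((g : ℚ) + 1) = (d0 * r ^ a * s ^ b) * (k : ℚ) ^ 2 := by exact_mod_cast hgk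
  interval_cases a <;> interval_cases b <;> rcases hd0' with h | h <;> subst h
  · simp at h1
  · exfalso
    -- d = t
    have key : ((d0 : ℚ) * k) ^ 2 - (d0 * r * s) * (2 * g' / k) ^ 2 = d0 * 2 ^ 2 := by
      have e : (g : ℚ) = d0 * (k : ℚ) ^ 2 / 2 - 1 := by simp at hgkQ; linarith
      rw [e] at hPQ
      field_simp
      apply mul_left_cancel₀ ht0
      linear_combination 4 * hPQ
    rcases hT with h | h
    · refine H.leg_q (u := 1) (Or.inl rfl) (normcondQ' q _ 1 (H.q_ndvd (Or.inl rfl)) ?_ (d0 * k) (2 * g' / k) 2 two_ne_zero ?_)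
      · intro h
        exact H.q_ndvd (Or.inl rfl) ((h.mul_right _).mul_right _)
      · rw [h] at key ⊢; push_cast; linear_combination key
    · refine H.leg_q (u := 2) (Or.inr rfl) (normcondQ' q _ 2 (H.q_ndvd (Or.inr rfl)) ?_ (d0 * k) (2 * g' / k) 2 two_ne_zero ?_)
      · intro h
        exact H.q_ndvd (Or.inr rfl) ((h.mul_right _).mul_right _)
      · rw [h] at key ⊢; push_cast at key ⊢; linear_combination key
  · right; simpa using hR
  · left
    have : Rp (Qs (d0 * r * s)) (r * (d0 * r ^ 0 * s ^ 1)) 1 := by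
      convert hRM using 1; ring
    simpa using this.cancel hR
  · left; simpa using hR
  · right
    have : Rp (Qs (d0 * r * s)) (s * (d0 * r ^ 1 * s ^ 0)) 1 := by
      convert hRM using 1; ring
    simpa using this.cancel hR
  · exfalso
    apply hns
    refine ⟨2 * g' / k, ?_⟩
    have e : (r : ℚ) * s * k ^ 2 = 2 * (g + 1) := by rw [hgkQ]; push_cast; ring
    have : (r * s : ℚ) ≠ 0 := by positivity
    field_simp
    apply mul_left_cancel₀ this
    linear_combination (g - 1) * e + 2 * hPQ
  · simp at hM

theorem Hyp.F0_tors (H : Hyp q r s κ) {t : ℕ} (hT : t = q ∨ t = 2 * q)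
    (h : Rp (Qs (t * r * s)) r 1 ∨ Rp (Qs (t * r * s)) s 1) (c : ClassGroup (𝓞 (Qs (t * r * s)))) (hc : c ^ 2 = 1) :
    ∃ d0, D0 q d0 ∧ Rp (Qs (t * r * s)) d0 c := by
  obtain ⟨d, hd, hd4, hR⟩ := Qs_tors _ (H.mod4' hT) (H.neg hT) c hc
  obtain ⟨d0, a, b, ha, hb, hd0, rfl⟩ := H.class_d hT d hd hd4
  have hRM := Rp.Qs_M _ (H.mod4' hT)
  -- the class of `d0 * t` reduces to one in D0
  have red : ∀ d0, D0 q d0 → Rp (Qs (t * r * s)) (d0 * t) c → ∃ d0, D0 q d0 ∧ Rp (Qs (t * r * s)) d0 c := by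
    intro d0 h0 h1
    rcases hT with hT | hT <;> rcases h0 with rfl | rfl | h0 | h0
    · exact ⟨t, by simp [D0, hT], by simpa using h1⟩
    · exact ⟨2 * t, by simp [D0, hT], h1⟩
    · exact ⟨1, by simp [D0], Rp.of_mul_sq (k := q) (by convert h1 using 1; rw [hT, h0]; ring)⟩
    · exact ⟨2, by simp [D0], Rp.of_mul_sq (k := q) (by convert h1 using 1; rw [hT, h0]; ring)⟩
    · exact ⟨t, by simp [D0, hT], by simpa using h1⟩
    · exact ⟨q, by simp [D0], Rp.of_mul_sq (k := 2) (by convert h1 using 1; rw [hT]; ring)⟩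
    · exact ⟨2, by simp [D0], Rp.of_mul_sq (k := q) (by convert h1 using 1; rw [hT, h0]; ring)⟩
    · exact ⟨1, by simp [D0], Rp.of_mul_sq (k := 2 * q) (by convert h1 using 1; rw [hT, h0]; ring)⟩
  rcases h with h | h
  · have hts : Rp (Qs (t * r * s)) (t * s) 1 := by
      have : Rp (Qs (t * r * s)) (t * s * r) 1 := by convert hRM using 1; ring
      simpa using this.cancel h
    have hc1 : Rp (Qs (t * r * s)) (d0 * s ^ b) c := by
      interval_cases a
      · simpa using hR
      · have : Rp (Qs (t * r * s)) (d0 * s ^ b * r) c := by convert hR using 1; ring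
        simpa using this.cancel h
    interval_cases b
    · exact ⟨d0, hd0, by simpa using hc1⟩
    · apply red d0 hd0
      apply Rp.of_mul_sq (k := s)
      have := hc1.mul hts
      rw [mul_one] at this
      convert this using 1; ring
  · have hts : Rp (Qs (t * r * s)) (t * r) 1 := by
      have : Rp (Qs (t * r * s)) (t * r * s) 1 := by convert hRM using 1
      simpa using this.cancel h
    have hc1 : Rp (Qs (t * r * s)) (d0 * r ^ a) c := by
      interval_cases b
      · simpa using hR
      · have : Rp (Qs (t * r * s)) (d0 * r ^ a * s) c := by convert hR using 1; ring
        simpa using this.cancel h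
    interval_cases a
    · exact ⟨d0, hd0, by simpa using hc1⟩
    · apply red d0 hd0
      apply Rp.of_mul_sq (k := r)
      have := hc1.mul hts
      rw [mul_one] at this
      convert this using 1; ring

/-- the other field: squares -/
theorem Hyp.F0'_aux (H : Hyp q r s κ) {t t' : ℕ} (ht : (κ = 1 ∧ t = q ∧ t' = 2 * q) ∨ (κ = -1 ∧ t = 2 * q ∧ t' = q))
    (d : ℕ) (hd : Squarefree d) (c) (hR : Rp (Qs (t' * r * s)) d c) (x) (hx : c = x ^ 2) :
    (d = 1 ∨ d = t' * r * s) ∨ Rp (Qs (t' * r * s)) t c := by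
  have hT : t' = q ∨ t' = 2 * q := by omega
  obtain ⟨d0, a, b, ha, hb, hd0, rfl⟩ := H.class_d hT d hd (hR.Qs_dvd _ (H.mod4' hT) hd)
  have hgen := H.genus_Rp hT hd0 ha hb hR x hx
  have hRM := Rp.Qs_M _ (H.mod4' hT)
  have hq1 : 1 < q := (Fact.out : q.Prime).one_lt
  have hq4 := H.q4
  have hTD : D0 q t' := by rcases hT with h | h <;> simp [D0, h]
  have e1 := H.leg_d0 hTD
  have e2 := H.swap.leg_d0 hTD
  have e3 := H.leg_d0 hd0
  have e4 := H.swap.leg_d0 hd0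
  have l1 : legendreSym r t' = -1 := by omega
  have l2 : legendreSym s t' = -1 := by omega
  rw [l1, l2] at hgen
  interval_cases a <;> interval_cases b <;> norm_num at hgen
  · have : d0 = 1 ∨ d0 = t := by omega
    rcases this with h | h
    · left; left; rw [h]; simp
    · right; rw [h] at hR; simpa using hR
  · omega
  · omega
  · have : d0 = t' ∨ d0 = 2 := by omega
    rcases this with h | h
    · left; right; rw [h]; ring
    · right
      rw [h] at hR
      have h5 := hR.mul hRM
      rw [mul_one] at h5
      rcases ht with ⟨-, h6, h7⟩ | ⟨-, h6, h7⟩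
      · apply Rp.of_mul_sq (k := 2 * r * s)
        convert h5 using 1; rw [h6, h7]; ring
      · apply Rp.of_mul_sq (k := r * s)
        convert h5 using 1; rw [h6, h7]; ring

theorem Hyp.F0' (H : Hyp q r s κ) {t t' : ℕ} (ht : (κ = 1 ∧ t = q ∧ t' = 2 * q) ∨ (κ = -1 ∧ t = 2 * q ∧ t' = q)) :
    Rp (Qs (t' * r * s)) t 1 := by
  have hT : t' = q ∨ t' = 2 * q := by omega
  obtain ⟨g, g', hg, hg', hP, hmin⟩ := pell_exists _ (H.mod4' hT)
  obtain ⟨d, hd, hR, h1, hM, -⟩ := pell_d _ (H.mod4' hT) (H.sqf hT) (H.neg hT) g g' hg hg' hP hmin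
  have := H.F0'_aux ht d hd 1 hR 1 (by simp)
  tauto

theorem Hyp.F0'_sq (H : Hyp q r s κ) {t t' : ℕ} (ht : (κ = 1 ∧ t = q ∧ t' = 2 * q) ∨ (κ = -1 ∧ t = 2 * q ∧ t' = q))
    (x : ClassGroup (𝓞 (Qs (t' * r * s)))) (hx : x ^ 4 = 1) : x ^ 2 = 1 := by
  have hT : t' = q ∨ t' = 2 * q := by omega
  obtain ⟨d, hd, hd4, hR⟩ := Qs_tors _ (H.mod4' hT) (H.neg hT) (x ^ 2) (by rw [← pow_mul]; exact hx)
  rcases H.F0'_aux ht d hd _ hR x rfl with (h | h) | h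
  · rw [h] at hR; exact hR.uniq Rp.one
  · rw [h] at hR; exact hR.uniq (Rp.Qs_M _ (H.mod4' hT))
  · exact h.uniq (H.F0' ht)

theorem Hyp.F0'_odd (H : Hyp q r s κ) {t t' : ℕ} (ht : (κ = 1 ∧ t = q ∧ t' = 2 * q) ∨ (κ = -1 ∧ t = 2 * q ∧ t' = q))
    (k : ℕ) (x : ClassGroup (𝓞 (Qs (t' * r * s)))) (hx : x ^ (2 ^ k) = 1) : x ^ 2 = 1 := by
  induction k generalizing x with
  | zero => simp at hx; rw [hx]; simp
  | succ k ih =>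
    apply H.F0'_sq ht
    have := ih (x ^ 2) (by rw [← pow_mul, ← pow_succ']; exact hx)
    rw [← pow_mul] at this; exact this
end
end

section
open NumberField nonZeroDivisors

theorem dickson_cos (θ : ℝ) (k : ℕ) : (Polynomial.dickson 1 (1 : ℝ) k).eval (2 * Real.cos θ) = 2 * Real.cos (k * θ) ∧
    (Polynomial.dickson 1 (1 : ℝ) (k + 1)).eval (2 * Real.cos θ) = 2 * Real.cos ((k + 1 : ℕ) * θ) := by
  induction k with
  | zero => simp; norm_num
  | succ k ih =>
    refine ⟨ih.2, ?_⟩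
    rw [Polynomial.dickson_add_two]
    simp only [Polynomial.eval_sub, Polynomial.eval_mul, Polynomial.eval_X, Polynomial.eval_C, ih.1, ih.2]
    have h1 : ((k + 1 + 1 : ℕ) : ℝ) * θ = (k + 1 : ℕ) * θ + θ := by push_cast; ring
    have h2 : (k : ℝ) * θ = (k + 1 : ℕ) * θ - θ := by push_cast; ring
    rw [h1, h2, Real.cos_add, Real.cos_sub]; ring

/-- the order generated by `√M` and `c_n` -/
noncomputable def OrdM (M n : ℕ) : Subring ℝ := Subring.closure {Real.sqrt (M : ℕ), cc n}

theorem Ord_mono (M n : ℕ) : OrdM M n ≤ OrdM M (n + 1) := by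
  have h2 : cc (n + 1) ∈ OrdM M (n + 1) := Subring.subset_closure (by simp)
  apply Subring.closure_le.2
  rintro x (rfl | rfl)
  · exact Subring.subset_closure (by simp)
  · have : cc n = cc (n + 1) ^ 2 - 2 := by rw [cc_sq]; ring
    rw [this]
    exact sub_mem (pow_mem h2 2) (ofNat_mem _ 2)

theorem Ord_of (M n : ℕ) : ∀ x ∈ Fl M n, ∃ N : ℕ, N ≠ 0 ∧ (N : ℝ) * x ∈ OrdM M n := by
  induction n with
  | zero =>
    intro x hx
    rw [show Fl M 0 = Qs M from layer_zero _] at hx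
    obtain ⟨a, b, h⟩ := (mem_sqrt (Real.sqrt (M : ℕ)) ⟨M, by rw [sqrt_sq_nat]; simp⟩ x).1 hx
    refine ⟨a.den * b.den, mul_ne_zero a.den_nz b.den_nz, ?_⟩
    have : ((a.den * b.den : ℕ) : ℝ) * x = (a.num * b.den : ℤ) + (b.num * a.den : ℤ) * Real.sqrt (M : ℕ) := by
      rw [h]
      have h1 : (a : ℝ) = a.num / a.den := by exact_mod_cast (Rat.num_div_den a).symm
      have h2 : (b : ℝ) = b.num / b.den := by exact_mod_cast (Rat.num_div_den b).symm
      have h3 : (a.den : ℝ) ≠ 0 := by exact_mod_cast a.den_nz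
      have h4 : (b.den : ℝ) ≠ 0 := by exact_mod_cast b.den_nz
      rw [h1, h2]; push_cast; field_simp
    rw [this]
    exact add_mem (intCast_mem _ _) (mul_mem (intCast_mem _ _) (Subring.subset_closure (by simp)))
  | succ n ih =>
    intro x hx
    obtain ⟨a, ha, b, hb, h⟩ := (mem_layer_succ _ _ _).1 hx
    obtain ⟨A, hA, hA'⟩ := ih a ha
    obtain ⟨B, hB, hB'⟩ := ih b hb
    refine ⟨A * B, mul_ne_zero hA hB, ?_⟩
    have : ((A * B : ℕ) : ℝ) * x = B * (A * a) + A * (B * b) * cc (n + 1) := by rw [h]; push_cast; ring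
    rw [this]
    exact add_mem (mul_mem (natCast_mem _ _) (Ord_mono _ _ hA'))
      (mul_mem (mul_mem (natCast_mem _ _) (Ord_mono _ _ hB')) (Subring.subset_closure (by simp)))

theorem Ord_unif (M n : ℕ) : ∃ N : ℕ, N ≠ 0 ∧ ∀ x : 𝓞 (Fl M n), (N : ℝ) * ev _ x ∈ OrdM M n := by
  obtain ⟨S, hS⟩ := (Module.Finite.fg_top : (⊤ : Submodule ℤ (𝓞 (Fl M n))).FG)
  choose f hf hf' using fun x : 𝓞 (Fl M n) => Ord_of M n (ev _ x) (x : Fl M n).2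
  refine ⟨∏ y ∈ S, f y, Finset.prod_ne_zero_iff.2 fun y _ => hf y, fun x => ?_⟩
  have hx : x ∈ Submodule.span ℤ (S : Set (𝓞 (Fl M n))) := by rw [hS]; trivial
  induction hx using Submodule.span_induction with
  | mem y hy =>
    obtain ⟨k, hk⟩ := Finset.dvd_prod_of_mem f hy
    rw [hk]; push_cast
    rw [mul_comm (f y : ℝ), mul_assoc]
    exact mul_mem (natCast_mem _ _) (hf' y)
  | zero => rw [map_zero, mul_zero]; exact zero_mem _
  | add x y _ _ h1 h2 => rw [map_add, mul_add]; exact add_mem h1 h2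
  | smul a x _ h =>
    rw [zsmul_eq_mul, map_mul, map_intCast, mul_left_comm]; exact mul_mem (intCast_mem _ _) h

theorem exists_deg_one (M n : ℕ) : ∃ N : ℕ, N ≠ 0 ∧ ∀ p : ℕ, p.Prime → ¬ p ∣ N → p % 2 ^ (n + 2) = 1 →
    (∃ m : ℤ, (p : ℤ) ∣ M - m ^ 2) → ∃ P : Ideal (𝓞 (Fl M n)), Ideal.absNorm P = p := by
  obtain ⟨N, hN, hO⟩ := Ord_unif M n
  refine ⟨N, hN, fun p hp hpN hp1 hm => ?_⟩
  haveI := Fact.mk hp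
  obtain ⟨m, k, hm⟩ := hm
  have hp0 : ¬ IsUnit (p : 𝓞 (Fl M n)) := by
    intro h
    have h1 := h.map (Algebra.norm ℤ)
    have h2 : (Algebra.norm ℤ) (p : 𝓞 (Fl M n)) = (p : ℤ) ^ Fintype.card (Module.Free.ChooseBasisIndex ℤ (𝓞 (Fl M n))) := by
      have := Algebra.norm_algebraMap_of_basis (Module.Free.chooseBasis ℤ (𝓞 (Fl M n))) (p : ℤ)
      simpa using this
    rw [h2, isUnit_pow_iff] at h1
    · exact (Nat.prime_iff_prime_int.1 hp).not_unit h1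
    · exact Fintype.card_ne_zero
  obtain ⟨P, hP, hle⟩ := Ideal.exists_le_maximal (Ideal.span {(p : 𝓞 (Fl M n))}) (by
    rw [Ne, Ideal.span_singleton_eq_top]; exact hp0)
  have hpP : (p : 𝓞 (Fl M n)) ∈ P := (Ideal.span_singleton_le_iff_mem _).1 hle
  refine ⟨P, ?_⟩
  have hPb : P ≠ ⊥ := by rintro rfl; exact hp.ne_zero (by exact_mod_cast (Ideal.mem_bot.1 hpP))
  letI : Field (𝓞 (Fl M n) ⧸ P) := Ideal.Quotient.field P
  haveI : Finite (𝓞 (Fl M n) ⧸ P) := Ideal.finiteQuotientOfFreeOfNeBot P hPb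
  letI := Fintype.ofFinite (𝓞 (Fl M n) ⧸ P)
  let π := Ideal.Quotient.mk P
  have hpk : (p : 𝓞 (Fl M n) ⧸ P) = 0 := by
    rw [← map_natCast π]; exact Ideal.Quotient.eq_zero_iff_mem.2 hpP
  haveI : CharP (𝓞 (Fl M n) ⧸ P) p := by
    have := CharP.ringChar_of_prime_eq_zero hp hpk
    exact this ▸ ringChar.charP _
  let S : Subring (𝓞 (Fl M n)) := ((frobenius (𝓞 (Fl M n) ⧸ P) p).comp π).eqLocus π
  have hwS : mkI (Fl M n) (Real.sqrt (M : ℕ)) (Qs_le M n (IntermediateField.mem_adjoin_simple_self ℚ _)) (sqrt_isInt M) ∈ S := by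
    set w := mkI (Fl M n) (Real.sqrt (M : ℕ)) (Qs_le M n (IntermediateField.mem_adjoin_simple_self ℚ _)) (sqrt_isInt M)
    have h1 : w ^ 2 = (M : 𝓞 (Fl M n)) := by
      apply ev_inj; rw [map_pow, ev_mkI, map_natCast, sqrt_sq_nat]
    have h2 : (π w - π (m : 𝓞 (Fl M n))) * (π w + π (m : 𝓞 (Fl M n))) = 0 := by
      have : (M : 𝓞 (Fl M n)) - m ^ 2 = p * k := by exact_mod_cast congrArg (Int.cast : ℤ → 𝓞 (Fl M n)) hm
      have h3 : (w - m) * (w + m) = p * k := by rw [← this, ← h1]; ring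
      rw [← map_sub, ← map_add, ← map_mul, h3, map_mul, map_natCast, hpk, zero_mul]
    have hmS : (m : 𝓞 (Fl M n)) ∈ S := intCast_mem _ _
    rcases mul_eq_zero.1 h2 with h | h
    · change frobenius _ p (π w) = π w
      rw [sub_eq_zero.1 h]; exact hmS
    · change frobenius _ p (π w) = π w
      rw [eq_neg_of_add_eq_zero_left h, map_neg]; exact congrArg Neg.neg hmS
  have hcS : mkI (Fl M n) (cc n) (cc_mem_layer _ n) (cc_isInt n) ∈ S := by
    set c := mkI (Fl M n) (cc n) (cc_mem_layer _ n) (cc_isInt n)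
    have h1 : (Polynomial.dickson 1 (1 : 𝓞 (Fl M n)) p).eval c = c := by
      apply ev_inj
      rw [← Polynomial.eval_map_apply, Polynomial.map_dickson, map_one, ev_mkI, cc, (dickson_cos _ p).1]
      have h3 : (p : ℝ) = 2 ^ (n + 2) * (p / 2 ^ (n + 2) : ℕ) + 1 := by
        have := Nat.div_add_mod p (2 ^ (n + 2))
        rw [hp1] at this
        exact_mod_cast this.symm
      have h4 : (p : ℝ) * (2 * Real.pi / 2 ^ (n + 2)) = 2 * Real.pi / 2 ^ (n + 2) + (p / 2 ^ (n + 2) : ℕ) * (2 * Real.pi) := by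
        rw [h3]; field_simp; ring
      rw [h4, Real.cos_add_nat_mul_two_pi]
    have h2 := congrArg π h1
    rw [← Polynomial.eval_map_apply, Polynomial.map_dickson, map_one, Polynomial.dickson_one_one_charP] at h2
    simp at h2
    exact h2
  have hO2 : OrdM M n ≤ S.map (ev (Fl M n)) := by
    apply Subring.closure_le.2
    rintro x (rfl | rfl)
    · exact ⟨_, hwS, ev_mkI _ _ _ _⟩
    · exact ⟨_, hcS, ev_mkI _ _ _ _⟩
  have hall : ∀ x : 𝓞 (Fl M n) ⧸ P, x ^ p = x := by
    intro x
    obtain ⟨x, rfl⟩ := Ideal.Quotient.mk_surjective x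
    obtain ⟨y, hy, hxy⟩ := hO2 (hO x)
    have hyx : y = N * x := by apply ev_inj; rw [hxy, map_mul, map_natCast]
    have h1 : π (N * x) ^ p = π (N * x) := by rw [← hyx]; exact hy
    have h2 : π (N : 𝓞 (Fl M n)) ^ p = π (N : 𝓞 (Fl M n)) := (natCast_mem S N : _)
    have h3 : π (N : 𝓞 (Fl M n)) ≠ 0 := by
      rw [map_natCast, Ne, CharP.cast_eq_zero_iff _ p]; exact hpN
    rw [map_mul, mul_pow, h2] at h1
    exact mul_left_cancel₀ h3 h1
  rw [Ideal.absNorm_apply, Submodule.cardQuot_apply, Nat.card_eq_fintype_card]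
  obtain ⟨f, hf, hc⟩ := FiniteField.card (𝓞 (Fl M n) ⧸ P) p
  have hle2 : Fintype.card (𝓞 (Fl M n) ⧸ P) ≤ p := by
    classical
    have h0 := FiniteField.X_pow_card_sub_X_ne_zero (𝓞 (Fl M n) ⧸ P) hp.one_lt
    rw [← FiniteField.X_pow_card_sub_X_natDegree_eq (𝓞 (Fl M n) ⧸ P) hp.one_lt]
    refine le_trans ?_ (Polynomial.card_roots' _)
    refine le_trans ?_ (Multiset.toFinset_card_le _)
    apply Finset.card_le_card
    intro x _
    rw [Multiset.mem_toFinset, Polynomial.mem_roots h0]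
    simp [hall x]
  rw [hc] at hle2 ⊢
  have : (f : ℕ) ≤ 1 := by
    by_contra h
    have := Nat.pow_lt_pow_right hp.one_lt (show 1 < (f : ℕ) by omega)
    rw [pow_one] at this
    omega
  have : (f : ℕ) = 1 := by have := f.pos; omega
  rw [this, pow_one]
end

section
open NumberField nonZeroDivisors

theorem odd_index {G : Type*} [CommGroup G] [Finite G] (H : Subgroup G)
    (h4 : Nat.card (powMonoidHom 2 : G →* G).ker ≤ 4) (c c' : G) (hc : c ∈ H) (hc' : c' ∈ H)
    (h1 : ∀ b, c ≠ b ^ 2) (h2 : ∀ b, c' ≠ b ^ 2) (h3 : ∀ b, c * c' ≠ b ^ 2) : Odd H.index := by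
  let S := (powMonoidHom 2 : G →* G).range
  have hS : Nat.card (G ⧸ S) ≤ 4 := by
    have e1 := S.card_mul_index
    have e2 := (powMonoidHom 2 : G →* G).ker.card_mul_index
    rw [Subgroup.index_ker] at e2
    have e3 : Nat.card S * S.index = Nat.card S * Nat.card (powMonoidHom 2 : G →* G).ker := by
      rw [e1, ← e2, mul_comm]
    rw [← Subgroup.index_eq_card, Nat.eq_of_mul_eq_mul_left Nat.card_pos e3]
    exact h4
  have hSm : ∀ g : G, (g : G ⧸ S) = 1 ↔ ∃ b, g = b ^ 2 := by
    intro g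
    rw [QuotientGroup.eq_one_iff]
    constructor
    · rintro ⟨b, rfl⟩; exact ⟨b, rfl⟩
    · rintro ⟨b, rfl⟩; exact ⟨b, rfl⟩
  have hsq : ∀ x : G ⧸ S, x * x = 1 := by
    intro x
    obtain ⟨g, rfl⟩ := QuotientGroup.mk_surjective x
    rw [← QuotientGroup.mk_mul, hSm]; exact ⟨g, (sq g).symm⟩
  have n1 : (c : G ⧸ S) ≠ 1 := by rw [Ne, hSm]; push Not; exact h1
  have n2 : (c' : G ⧸ S) ≠ 1 := by rw [Ne, hSm]; push Not; exact h2
  have n3 : (c : G ⧸ S) * c' ≠ 1 := by rw [← QuotientGroup.mk_mul, Ne, hSm]; push Not; exact h3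
  have n4 : (c : G ⧸ S) ≠ c' := by
    intro h; apply n3; rw [h]; exact hsq _
  classical
  letI := Fintype.ofFinite (G ⧸ S)
  have hu : ({1, (c : G ⧸ S), (c' : G ⧸ S), (c : G ⧸ S) * c'} : Finset (G ⧸ S)) = Finset.univ := by
    apply Finset.eq_univ_of_card
    have : ({1, (c : G ⧸ S), (c' : G ⧸ S), (c : G ⧸ S) * c'} : Finset (G ⧸ S)).card = 4 := by
      rw [Finset.card_insert_of_notMem, Finset.card_insert_of_notMem, Finset.card_insert_of_notMem, Finset.card_singleton]
      · simp [n1]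
      · simp [n4, n2]
      · simp [n1.symm, n2.symm, n3.symm]
    rw [Nat.card_eq_fintype_card] at hS
    have := Finset.card_le_univ ({1, (c : G ⧸ S), (c' : G ⧸ S), (c : G ⧸ S) * c'} : Finset (G ⧸ S))
    omega
  rw [Subgroup.index_eq_card]
  apply odd_card_of_sq
  intro x
  obtain ⟨g, rfl⟩ := QuotientGroup.mk_surjective x
  have key : ∀ h ∈ H, (g : G ⧸ S) = h → ∃ y : G ⧸ H, (g : G ⧸ H) = y ^ 2 := by
    intro h hh hg
    have : ((g * h⁻¹ : G) : G ⧸ S) = 1 := by rw [QuotientGroup.mk_mul, hg, QuotientGroup.mk_inv, mul_inv_cancel]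
    obtain ⟨b, hb⟩ := (hSm _).1 this
    refine ⟨b, ?_⟩
    rw [← QuotientGroup.mk_pow, ← hb, QuotientGroup.mk_mul, QuotientGroup.mk_inv, (QuotientGroup.eq_one_iff h).2 hh]
    simp
  have hg : (g : G ⧸ S) ∈ ({1, (c : G ⧸ S), (c' : G ⧸ S), (c : G ⧸ S) * c'} : Finset (G ⧸ S)) := by rw [hu]; simp
  simp only [Finset.mem_insert, Finset.mem_singleton] at hg
  rcases hg with h | h | h | h
  · exact key 1 (one_mem _) h
  · exact key c hc h
  · exact key c' hc' h
  · exact key (c * c') (mul_mem hc hc') h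

theorem exists_res (p : ℕ) [Fact p.Prime] (hp : p ≠ 2) (e : ℤ) (he : e = 1 ∨ e = -1) : ∃ a : ℕ, legendreSym p a = e := by
  rcases he with rfl | rfl
  · exact ⟨1, by simpa using legendreSym.at_one p⟩
  · obtain ⟨a, ha⟩ := quadraticChar_exists_neg_one (F := ZMod p) (by rwa [ZMod.ringChar_zmod_n])
    refine ⟨a.val, ?_⟩
    rw [legendreSym]; simpa using ha

theorem leg_congr (p : ℕ) [Fact p.Prime] {a b : ℕ} (h : a ≡ b [MOD p]) : legendreSym p a = legendreSym p b := by
  rw [legendreSym, legendreSym]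
  have := (ZMod.natCast_eq_natCast_iff a b p).2 h
  push_cast
  rw [this]

theorem leg_coprime (p : ℕ) [Fact p.Prime] {a : ℕ} (h : legendreSym p a ≠ 0) : Nat.Coprime a p := by
  rw [Nat.coprime_comm, Nat.Prime.coprime_iff_not_dvd Fact.out]
  rw [Ne, legendreSym.eq_zero_iff] at h
  intro hd
  apply h
  push_cast
  exact (ZMod.natCast_eq_zero_iff _ _).2 hd

theorem exists_prime (q r s k B : ℕ) [Fact q.Prime] [Fact r.Prime] [Fact s.Prime] (hq : q ≠ 2) (hr : r ≠ 2) (hs : s ≠ 2)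
    (hqr : q ≠ r) (hqs : q ≠ s) (hrs : r ≠ s) (hk : k ≠ 0) (a b c : ℤ) (ha : a = 1 ∨ a = -1) (hb : b = 1 ∨ b = -1) (hc : c = 1 ∨ c = -1) :
    ∃ p, p.Prime ∧ B < p ∧ p % 2 ^ k = 1 ∧ legendreSym q p = a ∧ legendreSym r p = b ∧ legendreSym s p = c := by
  obtain ⟨a', ha'⟩ := exists_res q hq a ha
  obtain ⟨b', hb'⟩ := exists_res r hr b hb
  obtain ⟨c', hc'⟩ := exists_res s hs c hc
  have pq := (Fact.out : q.Prime); have pr' := (Fact.out : r.Prime); have ps := (Fact.out : s.Prime)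
  have e1 : Nat.Coprime q r := (Nat.coprime_primes pq pr').2 hqr
  have e2 : Nat.Coprime q s := (Nat.coprime_primes pq ps).2 hqs
  have e3 : Nat.Coprime r s := (Nat.coprime_primes pr' ps).2 hrs
  have f1 : Nat.Coprime (2 ^ k) q := ((Nat.coprime_primes Nat.prime_two pq).2 hq.symm).pow_left k
  have f2 : Nat.Coprime (2 ^ k) r := ((Nat.coprime_primes Nat.prime_two pr').2 hr.symm).pow_left k
  have f3 : Nat.Coprime (2 ^ k) s := ((Nat.coprime_primes Nat.prime_two ps).2 hs.symm).pow_left k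
  obtain ⟨x, x1, x2⟩ := Nat.chineseRemainder f1 1 a'
  obtain ⟨y, y1, y2⟩ := Nat.chineseRemainder (f2.mul_left e1) x b'
  obtain ⟨z, z1, z2⟩ := Nat.chineseRemainder ((f3.mul_left e2).mul_left e3) y c'
  have zr : z ≡ b' [MOD r] := (z1.of_mul_left _).trans y2
  have zx : z ≡ x [MOD 2 ^ k * q] := (z1.of_mul_right _).trans y1
  have zq : z ≡ a' [MOD q] := (zx.of_mul_left _).trans x2
  have z0 : z ≡ 1 [MOD 2 ^ k] := (zx.of_mul_right _).trans x1
  have cq : Nat.Coprime z q := leg_coprime q (by rw [leg_congr q zq, ha']; omega)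
  have cr : Nat.Coprime z r := leg_coprime r (by rw [leg_congr r zr, hb']; omega)
  have cs : Nat.Coprime z s := leg_coprime s (by rw [leg_congr s z2, hc']; omega)
  have c2 : Nat.Coprime z (2 ^ k) := by
    have := z0.gcd_eq; rw [Nat.gcd_one_left] at this; exact this
  obtain ⟨p, hpB, hp, hpz⟩ := Nat.forall_exists_prime_gt_and_modEq B (q := 2 ^ k * q * r * s) (a := z)
    (by have := pq.ne_zero; have := pr'.ne_zero; have := ps.ne_zero; positivity) (((c2.mul_right cq).mul_right cr).mul_right cs)
  refine ⟨p, hp, hpB, ?_, ?_, ?_, ?_⟩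
  · have : p ≡ 1 [MOD 2 ^ k] := (((hpz.of_mul_right _).of_mul_right _).of_mul_right _).trans z0
    have h2 : 1 < 2 ^ k := Nat.one_lt_two_pow hk
    rw [Nat.ModEq, Nat.mod_eq_of_lt h2] at this; exact this
  · rw [← ha']; exact leg_congr q ((((hpz.of_mul_right _).of_mul_right _).of_mul_left _).trans zq)
  · rw [← hb']; exact leg_congr r (((hpz.of_mul_right _).of_mul_left _).trans zr)
  · rw [← hc']; exact leg_congr s ((hpz.of_mul_left _).trans z2)
end

section
open NumberField nonZeroDivisors

theorem sq_of_leg (p M : ℕ) [Fact p.Prime] (h : legendreSym p M = 1) : ∃ m : ℤ, (p : ℤ) ∣ M - m ^ 2 := by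
  have h0 : ((M : ℤ) : ZMod p) ≠ 0 := by
    intro h'; rw [← legendreSym.eq_zero_iff] at h'; omega
  obtain ⟨x, hx⟩ := (legendreSym.eq_one_iff p h0).1 h
  refine ⟨x.val, ?_⟩
  rw [← ZMod.intCast_zmod_eq_zero_iff_dvd]
  push_cast
  push_cast at hx
  rw [hx]; simp; ring

theorem deg_one_class (M n : ℕ) : ∃ N : ℕ, N ≠ 0 ∧ ∀ p : ℕ, p.Prime → ¬ p ∣ N → p % 2 ^ (n + 2) = 1 →
    (∃ m : ℤ, (p : ℤ) ∣ M - m ^ 2) → 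
    letI := incAlg (Qs_le M n)
    ∃ a : (FractionalIdeal (𝓞 (Qs M))⁰ (Qs M))ˣ, clP (Qs M) a ∈ (clN (Qs M) (Fl M n)).range ∧
      FractionalIdeal.absNorm (a : FractionalIdeal (𝓞 (Qs M))⁰ (Qs M)) = p := by
  obtain ⟨N, hN, h⟩ := exists_deg_one M n
  refine ⟨N, hN, fun p hp h1 h2 h3 => ?_⟩
  obtain ⟨P, hP⟩ := h p hp h1 h2 h3
  letI := incAlg (Qs_le M n)
  have hP0 : P ∈ (Ideal (𝓞 (Fl M n)))⁰ := by
    rw [mem_nonZeroDivisors_iff_ne_zero]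
    rintro rfl
    simp at hP; exact hp.ne_zero hP.symm
  refine ⟨FractionalIdeal.mk0 _ (idRestrict (idN (Qs M) (Fl M n)) (idN_bot _ _) ⟨P, hP0⟩), ?_, ?_⟩
  · rw [clP_mk0]
    refine ⟨ClassGroup.mk0 ⟨P, hP0⟩, ?_⟩
    rw [clN, clMap_mk0]
  · rw [FractionalIdeal.coe_mk0, FractionalIdeal.coeIdeal_absNorm]
    have : Ideal.absNorm (idN (Qs M) (Fl M n) P) = p := by
      rw [← hP]; exact Ideal.absNorm_relNorm (𝓞 (Qs M)) (𝓞 (Fl M n)) P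
    exact_mod_cast this

section
variable {q r s : ℕ} [Fact q.Prime] [Fact r.Prime] [Fact s.Prime] {κ : ℤ}

theorem Hyp.not_sq (H : Hyp q r s κ) {t : ℕ} (hT : t = q ∨ t = 2 * q) (a : (FractionalIdeal (𝓞 (Qs (t * r * s)))⁰ (Qs (t * r * s)))ˣ)
    (p : ℕ) (hp : FractionalIdeal.absNorm (a : FractionalIdeal (𝓞 (Qs (t * r * s)))⁰ (Qs (t * r * s))) = p)
    (hpr : legendreSym r p = -1 ∨ legendreSym s p = -1) (b) : clP _ a ≠ b ^ 2 := by
  intro h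
  obtain ⟨X, Y, z, ε, hε, hz, e⟩ := Qs_sq_norm _ (H.mod4' hT) a b h
  rw [hp] at e
  have hTD : D0 q t := by rcases hT with h | h <;> simp [D0, h]
  rcases hpr with hpr | hpr
  · have := H.genus t p (H.leg_d0_ne hTD) (by omega) 0 0 (by omega) ε hε X Y z hz (by push_cast at e ⊢; simpa using e)
    rw [pow_zero] at this; omega
  · have := H.swap.genus t p (H.swap.leg_d0_ne hTD) (by omega) 0 0 (by omega) ε hε X Y z hz (by push_cast at e ⊢; simp; linear_combination e)
    rw [pow_zero] at this; omega

theorem Hyp.card_ker (H : Hyp q r s κ) {t : ℕ} (hT : t = q ∨ t = 2 * q)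
    (h : Rp (Qs (t * r * s)) r 1 ∨ Rp (Qs (t * r * s)) s 1) :
    Nat.card (powMonoidHom 2 : ClassGroup (𝓞 (Qs (t * r * s))) →* ClassGroup (𝓞 (Qs (t * r * s)))).ker ≤ 4 := by
  choose f hf hf' using fun x : (powMonoidHom 2 : ClassGroup (𝓞 (Qs (t * r * s))) →* ClassGroup (𝓞 (Qs (t * r * s)))).ker =>
    H.F0_tors hT h x x.2
  let S : Finset ℕ := {1, 2, q, 2 * q}
  let F : (powMonoidHom 2 : ClassGroup (𝓞 (Qs (t * r * s))) →* ClassGroup (𝓞 (Qs (t * r * s)))).ker → S := fun x =>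
    ⟨f x, by have := hf x; simpa [S, D0] using this⟩
  have hF : Function.Injective F := by
    intro x y hxy
    have h1 : f x = f y := congrArg Subtype.val hxy
    apply Subtype.ext
    have := hf' x
    rw [h1] at this
    exact this.uniq (hf' y)
  refine (Nat.card_le_card_of_injective F hF).trans ?_
  rw [Nat.card_eq_fintype_card, Fintype.card_coe]
  exact Finset.card_le_four

theorem Hyp.leg_M (H : Hyp q r s κ) {t : ℕ} (hT : t = q ∨ t = 2 * q) (p : ℕ) [Fact p.Prime] (hp : p % 8 = 1)
    (h1 : legendreSym q p * (legendreSym r p * legendreSym s p) = 1) : legendreSym p (t * r * s : ℕ) = 1 := by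
  have e1 : legendreSym q p = legendreSym p q := legendreSym.quadratic_reciprocity_one_mod_four (by omega) (by have := H.q4; omega)
  have e2 : legendreSym r p = legendreSym p r := legendreSym.quadratic_reciprocity_one_mod_four (by omega) (by have := H.r8; omega)
  have e3 : legendreSym s p = legendreSym p s := legendreSym.quadratic_reciprocity_one_mod_four (by omega) (by have := H.s8; omega)
  have e4 : legendreSym p 2 = 1 := by
    rw [legendreSym.at_two (by omega), ZMod.χ₈_nat_eq_if_mod_eight]
    simp [hp]; omega
  rw [e1, e2, e3] at h1
  rcases hT with h | h <;> rw [h] <;> push_cast <;> simp only [legendreSym.mul, e4] <;> linarith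

theorem Hyp.odd_norm (H : Hyp q r s κ) {t : ℕ} (hT : t = q ∨ t = 2 * q)
    (h : Rp (Qs (t * r * s)) r 1 ∨ Rp (Qs (t * r * s)) s 1) (n : ℕ) :
    letI := incAlg (Qs_le (t * r * s) n)
    Odd (clN (Qs (t * r * s)) (Fl (t * r * s) n)).range.index := by
  letI := incAlg (Qs_le (t * r * s) n)
  obtain ⟨N, hN, hd⟩ := deg_one_class (t * r * s) n
  have h1 := H.q4; have h2 := H.r8; have h3 := H.s8
  have key : ∀ b c : ℤ, (b = 1 ∨ b = -1) → (c = 1 ∨ c = -1) → b * c = -1 → 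
      ∃ p : ℕ, legendreSym r p = b ∧ legendreSym s p = c ∧ ∃ a : (FractionalIdeal (𝓞 (Qs (t * r * s)))⁰ (Qs (t * r * s)))ˣ, clP (Qs (t * r * s)) a ∈ (clN (Qs (t * r * s)) (Fl (t * r * s) n)).range ∧
      FractionalIdeal.absNorm (a : FractionalIdeal (𝓞 (Qs (t * r * s)))⁰ (Qs (t * r * s))) = p := by
    intro b c hb hc hbc
    obtain ⟨p, hp, hpN, hp1, l1, l2, l3⟩ := exists_prime q r s (n + 3) N (by omega) (by omega) (by omega)
      (by rintro rfl; omega) (by rintro rfl; omega) H.rs_ne (by omega) (-1) b c (Or.inr rfl) hb hc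
    haveI := Fact.mk hp
    have m1 : p % 8 = 1 := by
      have : (8 : ℕ) ∣ 2 ^ (n + 3) := ⟨2 ^ n, by ring⟩
      rw [← Nat.mod_mod_of_dvd p this, hp1]
    have m2 : p % 2 ^ (n + 2) = 1 := by
      have : 2 ^ (n + 2) ∣ 2 ^ (n + 3) := ⟨2, by ring⟩
      rw [← Nat.mod_mod_of_dvd p this, hp1]
      exact Nat.mod_eq_of_lt (Nat.one_lt_two_pow (by omega))
    refine ⟨p, l2, l3, hd p hp (fun h => ?_) m2 (sq_of_leg p _ (H.leg_M hT p m1 ?_))⟩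
    · have := Nat.le_of_dvd (by omega) h; omega
    · rw [l1, l2, l3, hbc]; norm_num
  obtain ⟨p, l2, l3, a, ha, hpa⟩ := key (-1) 1 (Or.inr rfl) (Or.inl rfl) (by norm_num)
  obtain ⟨p', l2', l3', a', ha', hpa'⟩ := key 1 (-1) (Or.inl rfl) (Or.inr rfl) (by norm_num)
  refine odd_index _ (H.card_ker hT h) (clP _ a) (clP _ a') ha ha' (H.not_sq hT a p hpa (Or.inl l2))
    (H.not_sq hT a' p' hpa' (Or.inr l3')) ?_
  rw [← map_mul]
  refine H.not_sq hT (a * a') (p * p') ?_ (Or.inl ?_)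
  · rw [Units.val_mul, map_mul, hpa, hpa']; push_cast; rfl
  · push_cast; rw [legendreSym.mul, l2, l2']; norm_num
end
end

section
open NumberField nonZeroDivisors

section lift
variable (K L : Type*) [Field K] [NumberField K] [Field L] [NumberField L] [Algebra K L]

theorem clP_uJ (a : (FractionalIdeal (𝓞 K)⁰ K)ˣ) : clP L (uJ K L a) = clJ K L (clP K a) := by
  obtain ⟨x, hx, I, h⟩ := exists_frac a
  rw [← eq_div_iff_mul_eq'] at h
  rw [h]
  simp only [map_div, uJ_mk0, uJ_pr, clP_pr, clP_mk0, clJ, clMap_mk0, map_one, div_one]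

theorem Rp.lift {d : ℕ} {c} (h : Rp K d c) : Rp L d (clJ K L c) := by
  obtain ⟨a, hd, h1, h2⟩ := h
  have hd' : (d : L) ≠ 0 := by
    intro h; apply hd
    exact_mod_cast (by exact_mod_cast h : d = 0)
  refine ⟨uJ K L a, hd', by rw [clP_uJ, h1], ?_⟩
  rw [← map_pow, h2, pr, pr, uJ_pr]
  congr 1
  ext1
  simp
end lift

/-- an automorphism commuting argument for power maps -/
theorem v2_le_of_pow {G : Type*} [CommGroup G] [Finite G] (e : ℕ) (he : Odd e) (S : Subgroup G)
    (h : ∀ c : G, c ^ e ∈ S) : v2 (Nat.card G) ≤ v2 (Nat.card S) := by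
  have h1 := (powMonoidHom e : G →* G).ker.card_mul_index
  rw [Subgroup.index_ker] at h1
  have h2 : Nat.card (powMonoidHom e : G →* G).range ∣ Nat.card S := by
    apply Subgroup.card_dvd_of_le
    rintro _ ⟨c, rfl⟩
    exact h c
  have h3 : Odd (Nat.card (powMonoidHom e : G →* G).ker) := by
    apply odd_card_of_sq
    intro b
    obtain ⟨k, hk⟩ := he
    refine ⟨(b⁻¹) ^ k, ?_⟩
    have hb : b ^ e = 1 := Subtype.ext b.2
    have hb2 : b ^ (k * 2) * b = 1 := by rw [← pow_succ, mul_comm k 2]; rw [← hb]; congr 1; exact hk.symm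
    rw [inv_pow, inv_pow, ← pow_mul]
    exact eq_inv_of_mul_eq_one_right hb2
  rw [← h1, v2_mul Nat.card_pos.ne' Nat.card_pos.ne', v2_odd h3, zero_add]
  exact v2_dvd Nat.card_pos.ne' h2

theorem h_two_odd : Odd (Nat.card (ClassGroup (𝓞 (Qs 2)))) := by
  obtain ⟨_, σ, hσ, hw⟩ := Qs_quad 2 (by norm_num)
  obtain ⟨-, P, hP0, hP1, hP2, hP⟩ := UP_Qs 2 (by norm_num)
  have hQ : Nat.card (ClassGroup (𝓞 ℚ)) = 1 := by
    rw [Nat.card_eq_fintype_card]; exact Rat.classNumber_eq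
  let w : 𝓞 (Qs 2) := mkI (Qs 2) _ (wQ 2).2 (sqrt_isInt 2)
  have hc := chevalley σ hσ w hw 1 ⟨w, by
    apply ev_inj
    have hev : ev (Qs 2) w = Real.sqrt ((2 : ℕ) : ℝ) := rfl
    rw [pow_one, map_mul, hev, map_ofNat]
    have := sqrt_sq_nat 2
    rw [sq] at this; push_cast at this ⊢; exact this.symm⟩ P hP0 hP1 hP2 hP
  rw [hQ, Nat.dvd_one] at hc
  apply odd_of_v2 Nat.card_pos.ne'
  have h2 : ∀ c : ClassGroup (𝓞 (Qs 2)), c ^ 2 = 1 → c = 1 := by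
    intro c hc2
    have h1 := quad_cl σ hσ c
    have h3 : clN ℚ (Qs 2) c = 1 := by
      haveI := (Nat.card_eq_one_iff_unique.1 hQ).1
      exact Subsingleton.elim _ _
    rw [h3, map_one] at h1
    have h4 : clS σ.toRingEquiv c = c := by
      rw [eq_inv_of_mul_eq_one_right h1]; rw [sq] at hc2; exact (eq_inv_of_mul_eq_one_left hc2).symm
    have h5 := (Nat.card_eq_one_iff_unique.1 hc).1
    have := Subsingleton.elim (⟨c, h4⟩ : (clS σ.toRingEquiv).eqLocus (MonoidHom.id _)) 1
    exact congrArg Subtype.val this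
  apply v2_odd
  apply odd_card_of_sq
  have hinj : Function.Injective (powMonoidHom 2 : ClassGroup (𝓞 (Qs 2)) →* ClassGroup (𝓞 (Qs 2))) := by
    rw [injective_iff_map_eq_one]; exact h2
  intro b
  obtain ⟨c, hc⟩ := Finite.surjective_of_injective hinj b
  exact ⟨c, hc.symm⟩

theorem sqrt_two_cc : Real.sqrt ((2 : ℕ) : ℝ) = cc 1 := by rw [cc_one]; norm_num

theorem sqrt_mem (M : ℕ) : Real.sqrt (M : ℕ) ∈ Qs M := IntermediateField.mem_adjoin_simple_self ℚ _

theorem Fl_one (M : ℕ) (x : ℝ) (hx : x ∈ Fl M 1) : ∃ a b c d : ℚ,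
    x = (a + b * Real.sqrt (M : ℕ)) + (c + d * Real.sqrt (M : ℕ)) * cc 1 := by
  obtain ⟨A, hA, B, hB, rfl⟩ := (mem_layer_succ _ _ _).1 hx
  rw [layer_zero] at hA hB
  obtain ⟨a, b, rfl⟩ := (mem_sqrt (Real.sqrt (M : ℕ)) ⟨M, by rw [sqrt_sq_nat]; simp⟩ A).1 hA
  obtain ⟨c, d, rfl⟩ := (mem_sqrt (Real.sqrt (M : ℕ)) ⟨M, by rw [sqrt_sq_nat]; simp⟩ B).1 hB
  exact ⟨a, b, c, d, rfl⟩

theorem rat_mem (K : IntermediateField ℚ ℝ) (a : ℚ) : (a : ℝ) ∈ K := K.algebraMap_mem a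

theorem Fl_one_le (M : ℕ) (K : IntermediateField ℚ ℝ) (h1 : cc 1 ∈ K) (h2 : Real.sqrt (M : ℕ) ∈ K) : Fl M 1 ≤ K := by
  intro x hx
  obtain ⟨a, b, c, d, rfl⟩ := Fl_one M x hx
  have := rat_mem K
  exact add_mem (add_mem (this _) (mul_mem (this _) h2)) (mul_mem (add_mem (this _) (mul_mem (this _) h2)) h1)

theorem not_both (M M' : ℕ) (hM : M % 4 = 3 ∨ M % 8 = 6) (h1 : cc 1 ∈ Qs M') (h2 : Real.sqrt (M : ℕ) ∈ Qs M') : False := by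
  have h := Fl_one_le M (Qs M') h1 h2
  have h3 := (UP_Fl M 1 hM).1
  have h4 := finrank_Qs_le M'
  have h5 : Module.finrank ℚ (Fl M 1) ≤ Module.finrank ℚ (Qs M') :=
    LinearMap.finrank_le_finrank_of_injective (f := (IntermediateField.inclusion h).toLinearMap) (IntermediateField.inclusion h).injective
  omega

theorem Fl_one_ext (M : ℕ) (φ ψ : Fl M 1 ≃+* Fl M 1)
    (h1 : φ ⟨cc 1, cc_mem_layer _ _⟩ = ψ ⟨cc 1, cc_mem_layer _ _⟩)
    (h2 : φ ⟨Real.sqrt (M : ℕ), Qs_le M 1 (sqrt_mem M)⟩ = ψ ⟨Real.sqrt (M : ℕ), Qs_le M 1 (sqrt_mem M)⟩) : φ = ψ := by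
  ext1 x
  obtain ⟨a, b, c, d, hx⟩ := Fl_one M x x.2
  have hx' : x = ((a : Fl M 1) + b * ⟨Real.sqrt (M : ℕ), Qs_le M 1 (sqrt_mem M)⟩) + (c + d * ⟨Real.sqrt (M : ℕ), Qs_le M 1 (sqrt_mem M)⟩) * ⟨cc 1, cc_mem_layer _ _⟩ := by
    apply Subtype.ext; rw [hx]; push_cast; rfl
  rw [hx']
  simp only [map_add, map_mul, map_ratCast, h1, h2]
end

section
open NumberField nonZeroDivisors

theorem Rp.inc {K L : IntermediateField ℚ ℝ} [NumberField K] [NumberField L] (hKL : K ≤ L) {d : ℕ} (h : Rp K d 1) : Rp L d 1 := by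
  letI := incAlg hKL
  have := h.lift K L
  rwa [map_one] at this

theorem Qs_two_le (M : ℕ) : Qs 2 ≤ Fl M 1 := by
  rw [Qs, IntermediateField.adjoin_simple_le_iff, sqrt_two_cc]
  exact cc_mem_layer _ _

theorem tau_ex (M : ℕ) (hM : M % 4 = 3 ∨ M % 8 = 6) : ∃ τ : Fl M 1 ≃+* Fl M 1,
    τ ⟨cc 1, cc_mem_layer _ _⟩ = ⟨cc 1, cc_mem_layer _ _⟩ ∧
    τ ⟨Real.sqrt (M : ℕ), Qs_le M 1 (sqrt_mem M)⟩ = -⟨Real.sqrt (M : ℕ), Qs_le M 1 (sqrt_mem M)⟩ ∧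
    ∀ c : ClassGroup (𝓞 (Fl M 1)), (c * clS τ c) ^ (Nat.card (ClassGroup (𝓞 (Qs 2)))) = 1 := by
  have hcc : cc 1 ∈ Qs 2 := by rw [← sqrt_two_cc]; exact sqrt_mem 2
  letI := incAlg (Qs_two_le M)
  obtain ⟨_, τ, hτ, h1⟩ := quad_inc (Qs_two_le M) (Real.sqrt (M : ℕ)) (Qs_le M 1 (sqrt_mem M))
    (fun h => not_both M 2 hM hcc h) (by rw [sqrt_sq_nat]; exact _root_.natCast_mem _ _) (by
      intro x hx
      obtain ⟨a, b, c, d, rfl⟩ := Fl_one M x hx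
      have := rat_mem (Qs 2)
      exact ⟨a + c * cc 1, add_mem (this _) (mul_mem (this _) hcc), b + d * cc 1,
        add_mem (this _) (mul_mem (this _) hcc), by ring⟩)
  refine ⟨τ.toRingEquiv, ?_, h1, ?_⟩
  · exact τ.commutes (⟨cc 1, hcc⟩ : Qs 2)
  · intro c
    rw [quad_cl τ hτ c, ← map_pow, pow_card_eq_one', map_one]

section
variable {q r s : ℕ} [Fact q.Prime] [Fact r.Prime] [Fact s.Prime] {κ : ℤ}

theorem Hyp.sqrt_rel (t t' : ℕ) (ht : (κ = 1 ∧ t = q ∧ t' = 2 * q) ∨ (κ = -1 ∧ t = 2 * q ∧ t' = q)) :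
    ∃ k k' : ℚ, Real.sqrt (t * r * s : ℕ) = k * Real.sqrt (t' * r * s : ℕ) * cc 1 ∧
      Real.sqrt (t' * r * s : ℕ) = k' * Real.sqrt (t * r * s : ℕ) * cc 1 := by
  have hc : cc 1 * cc 1 = 2 := by rw [cc_one]; exact Real.mul_self_sqrt (by norm_num)
  have h2 : Real.sqrt ((2 * q * r * s : ℕ) : ℝ) = Real.sqrt ((q * r * s : ℕ) : ℝ) * cc 1 := by
    rw [cc_one, ← Real.sqrt_mul (by positivity)]; congr 1; push_cast; ring
  have h3 : Real.sqrt ((q * r * s : ℕ) : ℝ) = (1 / 2) * Real.sqrt ((2 * q * r * s : ℕ) : ℝ) * cc 1 := by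
    rw [h2]; linear_combination (-1 / 2) * Real.sqrt ((q * r * s : ℕ) : ℝ) * hc
  rcases ht with ⟨-, rfl, rfl⟩ | ⟨-, rfl, rfl⟩
  · exact ⟨1 / 2, 1, by rw [h3]; push_cast; ring_nf, by rw [h2]; push_cast; ring_nf⟩
  · exact ⟨1, 1 / 2, by rw [h2]; push_cast; ring_nf, by rw [h3]; push_cast; ring_nf⟩

theorem Hyp.Rp_one (H : Hyp q r s κ) {t t' : ℕ} (ht : (κ = 1 ∧ t = q ∧ t' = 2 * q) ∨ (κ = -1 ∧ t = 2 * q ∧ t' = q))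
    (h : Rp (Qs (t * r * s)) r 1 ∨ Rp (Qs (t * r * s)) s 1) (hle : Qs (t' * r * s) ≤ Fl (t * r * s) 1)
    (d0 a b : ℕ) (hd0 : D0 q d0) : Rp (Fl (t * r * s) 1) (d0 * r ^ a * s ^ b) 1 := by
  have hT : t = q ∨ t = 2 * q := by omega
  have e2 : Rp (Fl (t * r * s) 1) 2 1 := Rp.inc (Qs_two_le _) (Rp.Qs_M 2 (by norm_num))
  have eM := Rp.inc (Qs_le (t * r * s) 1) (Rp.Qs_M _ (H.mod4' hT))
  have et := Rp.inc hle (H.F0' ht)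
  have eq : Rp (Fl (t * r * s) 1) q 1 := by
    rcases hT with h | h
    · rwa [h] at et ⊢
    · have h' : q * 2 = t := by omega
      have := Rp.cancel (L := Fl (t * r * s) 1) (d := q) (e := 2) (c := 1) (c' := 1) (by rw [h']; exact et) e2
      rwa [one_mul] at this
  have ers : Rp (Fl (t * r * s) 1) (r * s) 1 := by
    have := Rp.cancel (L := Fl (t * r * s) 1) (d := r * s) (e := t) (c := 1) (c' := 1)
      (by rw [show r * s * t = t * r * s by ring]; exact eM) et
    rwa [one_mul] at this
  have er : Rp (Fl (t * r * s) 1) r 1 := by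
    rcases h with h | h
    · exact Rp.inc (Qs_le _ 1) h
    · have := Rp.cancel ers (Rp.inc (Qs_le _ 1) h)
      rwa [one_mul] at this
  have es : Rp (Fl (t * r * s) 1) s 1 := by
    have h' : s * r = r * s := mul_comm s r
    have := Rp.cancel (d := s) (e := r) (c := 1) (by rw [h']; exact ers) er
    rwa [one_mul] at this
  have epow : ∀ x a : ℕ, Rp (Fl (t * r * s) 1) x 1 → Rp (Fl (t * r * s) 1) (x ^ a) 1 := by
    intro x a hx
    induction a with
    | zero => rw [pow_zero]; exact Rp.one
    | succ a ih => have := ih.mul hx; rwa [one_mul, ← pow_succ] at this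
  have e0 : Rp (Fl (t * r * s) 1) d0 1 := by
    rcases hd0 with rfl | rfl | rfl | rfl
    · exact Rp.one
    · exact e2
    · exact eq
    · have := e2.mul eq; rwa [one_mul] at this
  have := (e0.mul (epow r a er)).mul (epow s b es)
  rwa [one_mul, one_mul] at this

theorem Hyp.rho_ex (H : Hyp q r s κ) {t t' : ℕ} (ht : (κ = 1 ∧ t = q ∧ t' = 2 * q) ∨ (κ = -1 ∧ t = 2 * q ∧ t' = q))
    (h : Rp (Qs (t * r * s)) r 1 ∨ Rp (Qs (t * r * s)) s 1) : ∃ ρ : Fl (t * r * s) 1 ≃+* Fl (t * r * s) 1,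
    ρ ⟨cc 1, cc_mem_layer _ _⟩ = -⟨cc 1, cc_mem_layer _ _⟩ ∧
    ρ ⟨Real.sqrt (t * r * s : ℕ), Qs_le _ 1 (sqrt_mem _)⟩ = -⟨Real.sqrt (t * r * s : ℕ), Qs_le _ 1 (sqrt_mem _)⟩ ∧
    ∃ e : ℕ, Odd e ∧ ∀ c : ClassGroup (𝓞 (Fl (t * r * s) 1)), (c * clS ρ c) ^ e = 1 := by
  have hT : t = q ∨ t = 2 * q := by omega
  have hT' : t' = q ∨ t' = 2 * q := by omega
  obtain ⟨k, k', hk, hk'⟩ := Hyp.sqrt_rel (r := r) (s := s) t t' ht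
  have hc : cc 1 * cc 1 = 2 := by rw [cc_one]; exact Real.mul_self_sqrt (by norm_num)
  have hR := rat_mem (Qs (t' * r * s))
  have hle : Qs (t' * r * s) ≤ Fl (t * r * s) 1 := by
    rw [Qs, IntermediateField.adjoin_simple_le_iff, hk']
    exact mul_mem (mul_mem (rat_mem _ _) (Qs_le _ 1 (sqrt_mem _))) (cc_mem_layer _ _)
  have hsq := sqrt_mem (t' * r * s)
  letI := incAlg hle
  obtain ⟨_, ρ, hρ, h1⟩ := quad_inc hle (cc 1) (cc_mem_layer _ _)
    (fun h => not_both _ _ (H.mod4 hT) h (by rw [hk]; exact mul_mem (mul_mem (hR _) hsq) h))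
    (by rw [sq, hc]; exact ofNat_mem _ 2) (by
      intro x hx
      obtain ⟨a, b, c, d, rfl⟩ := Fl_one _ x hx
      refine ⟨a + d * k * 2 * Real.sqrt (t' * r * s : ℕ), ?_, c + b * k * Real.sqrt (t' * r * s : ℕ), ?_, ?_⟩
      · exact add_mem (hR _) (mul_mem (mul_mem (mul_mem (hR _) (hR _)) (ofNat_mem _ 2)) hsq)
      · exact add_mem (hR _) (mul_mem (mul_mem (hR _) (hR _)) hsq)
      · rw [hk]; linear_combination (d * k * Real.sqrt (t' * r * s : ℕ)) * hc)
  refine ⟨ρ.toRingEquiv, h1, ?_, ?_⟩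
  · have e1 : (⟨Real.sqrt (t * r * s : ℕ), Qs_le _ 1 (sqrt_mem _)⟩ : Fl (t * r * s) 1) =
        (k : Fl (t * r * s) 1) * ⟨Real.sqrt (t' * r * s : ℕ), hle hsq⟩ * ⟨cc 1, cc_mem_layer _ _⟩ := by
      apply Subtype.ext; push_cast; push_cast at hk; exact hk
    have e2 : ρ (⟨Real.sqrt (t' * r * s : ℕ), hle hsq⟩ : Fl (t * r * s) 1) = ⟨Real.sqrt (t' * r * s : ℕ), hle hsq⟩ :=
      ρ.commutes (⟨Real.sqrt (t' * r * s : ℕ), hsq⟩ : Qs (t' * r * s))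
    change ρ _ = _
    rw [e1, map_mul, map_mul, map_ratCast, e2, h1, mul_neg]
  · set N := Nat.card (ClassGroup (𝓞 (Qs (t' * r * s)))) with hN
    have hN0 : N ≠ 0 := Nat.card_pos.ne'
    refine ⟨ordCompl[2] N, ?_, ?_⟩
    · have := Nat.not_dvd_ordCompl Nat.prime_two hN0
      rwa [← Nat.not_even_iff_odd, even_iff_two_dvd]
    · intro c
      rw [quad_cl ρ hρ c, ← map_pow]
      set y := clN (Qs (t' * r * s)) (Fl (t * r * s) 1) c ^ (ordCompl[2] N) with hy
      have hy2 : y ^ 2 = 1 := by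
        apply H.F0'_odd ht (N.factorization 2)
        rw [hy, ← pow_mul, mul_comm (N / _) _, Nat.ordProj_mul_ordCompl_eq_self]
        exact pow_card_eq_one'
      obtain ⟨d, hd, hd4, hRp⟩ := Qs_tors _ (H.mod4' hT') (H.neg hT') y hy2
      obtain ⟨d0, a, b, ha, hb, hd0, rfl⟩ := H.class_d hT' d hd hd4
      exact (hRp.lift _ _).uniq (H.Rp_one ht h hle d0 a b hd0)

theorem Hyp.step_one (H : Hyp q r s κ) {t t' : ℕ} (ht : (κ = 1 ∧ t = q ∧ t' = 2 * q) ∨ (κ = -1 ∧ t = 2 * q ∧ t' = q))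
    (h : Rp (Qs (t * r * s)) r 1 ∨ Rp (Qs (t * r * s)) s 1) :
    v2 (Nat.card (ClassGroup (𝓞 (Fl (t * r * s) 1)))) ≤ v2 (Nat.card (ClassGroup (𝓞 (Fl (t * r * s) 0)))) := by
  have hT : t = q ∨ t = 2 * q := by omega
  obtain ⟨τ, t1, t2, t3⟩ := tau_ex _ (H.mod4 hT)
  obtain ⟨ρ, r1, r2, e, he, r3⟩ := H.rho_ex ht h
  letI := incAlg (layer_mono (Qs (t * r * s)) (Nat.le_succ 0))
  obtain ⟨_, σ, hσ, s1, s3⟩ := step_chev _ 0 (H.mod4 hT)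
  have s2 : σ.toRingEquiv ⟨Real.sqrt (t * r * s : ℕ), Qs_le _ 1 (sqrt_mem _)⟩ = ⟨Real.sqrt (t * r * s : ℕ), Qs_le _ 1 (sqrt_mem _)⟩ :=
    σ.commutes (⟨Real.sqrt (t * r * s : ℕ), Qs_le _ 0 (sqrt_mem _)⟩ : Fl (t * r * s) 0)
  have s1' : σ.toRingEquiv ⟨cc 1, cc_mem_layer _ _⟩ = -⟨cc 1, cc_mem_layer _ _⟩ := s1
  have hσρ : σ.toRingEquiv = ρ.trans τ := by
    apply Fl_one_ext
    · rw [s1', RingEquiv.trans_apply, r1, map_neg, t1]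
    · rw [s2, RingEquiv.trans_apply, r2, map_neg, t2, neg_neg]
  refine (v2_le_of_pow (Nat.card (ClassGroup (𝓞 (Qs 2))) * e) (h_two_odd.mul he) _ ?_).trans (v2_dvd Nat.card_pos.ne' s3)
  intro c
  change clS σ.toRingEquiv _ = _
  have a1 : ∀ c, clS τ c ^ (Nat.card (ClassGroup (𝓞 (Qs 2))) * e) = (c ^ (Nat.card (ClassGroup (𝓞 (Qs 2))) * e))⁻¹ := by
    intro c
    apply eq_inv_of_mul_eq_one_right
    rw [← mul_pow, pow_mul, t3, one_pow]
  have a2 : clS ρ c ^ (Nat.card (ClassGroup (𝓞 (Qs 2))) * e) = (c ^ (Nat.card (ClassGroup (𝓞 (Qs 2))) * e))⁻¹ := by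
    apply eq_inv_of_mul_eq_one_right
    rw [← mul_pow, pow_mul', r3, one_pow]
  rw [hσρ, ← clS_trans, map_pow, map_pow, a1, a2, inv_inv]
  rfl

theorem lower (K L : Type*) [Field K] [NumberField K] [Field L] [NumberField L] [Algebra K L]
    (h : Odd (clN K L).range.index) : v2 (Nat.card (ClassGroup (𝓞 K))) ≤ v2 (Nat.card (ClassGroup (𝓞 L))) := by
  rw [← (clN K L).range.card_mul_index, v2_mul Nat.card_pos.ne' h.pos.ne', v2_odd h, add_zero]
  apply v2_dvd Nat.card_pos.ne'
  exact Subgroup.card_range_dvd _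

theorem Hyp.main (H : Hyp q r s κ) {t t' : ℕ} (ht : (κ = 1 ∧ t = q ∧ t' = 2 * q) ∨ (κ = -1 ∧ t = 2 * q ∧ t' = q))
    (h : Rp (Qs (t * r * s)) r 1 ∨ Rp (Qs (t * r * s)) s 1) (n : ℕ) :
    v2 (Nat.card (ClassGroup (𝓞 (Fl (t * r * s) n)))) = v2 (Nat.card (ClassGroup (𝓞 (Qs (t * r * s))))) := by
  have hT : t = q ∨ t = 2 * q := by omega
  have low : ∀ n, v2 (Nat.card (ClassGroup (𝓞 (Qs (t * r * s))))) ≤ v2 (Nat.card (ClassGroup (𝓞 (Fl (t * r * s) n)))) := by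
    intro n
    letI := incAlg (Qs_le (t * r * s) n)
    exact lower _ _ (H.odd_norm hT h n)
  have h0 : v2 (Nat.card (ClassGroup (𝓞 (Fl (t * r * s) 0)))) = v2 (Nat.card (ClassGroup (𝓞 (Qs (t * r * s))))) := by
    rw [Fl_zero]
  induction n with
  | zero => exact h0
  | succ n ih =>
    rcases n with _ | n
    · exact le_antisymm ((H.step_one ht h).trans h0.le) (low 1)
    · exact le_antisymm (fukuda_step _ n (H.mod4 hT) (H.odd_norm hT h (n + 2)) ih) (low _)
end
end

theorem statement_16 (η q r s : ℕ) [Fact q.Prime] [Fact r.Prime] [Fact s.Prime]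
    (hη : η = 1 ∨ η = 2)
    (hq4 : q % 4 = 3) (hr8 : r % 8 = 5) (hs8 : s % 8 = 5)
    (hqr : legendreSym r q = (-1) ^ (if η = 2 then 1 else 0))
    (hqs : legendreSym s q = (-1) ^ (if η = 2 then 1 else 0))
    (hrs : legendreSym s r = 1)
    (γ γ' : ℤ) (hγ : 0 < γ) (hγ' : 0 < γ')
    (hPell : γ ^ 2 - (η * q * r * s : ℕ) * γ' ^ 2 = 1)
    (hfund : ∀ a b : ℤ, 0 < a → 0 < b → a ^ 2 - (η * q * r * s : ℕ) * b ^ 2 = 1 → γ ≤ a)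
    (hnsq : ¬ ∃ t : ℤ, 2 ^ (if η = 1 then 1 else 0) * (q : ℤ) * (γ - 1) = t ^ 2) :
    ∀ n : ℕ,
      h2 (layer (IntermediateField.adjoin ℚ {Real.sqrt (η * q * r * s : ℕ)}) n) =
        h2 (IntermediateField.adjoin ℚ {Real.sqrt (η * q * r * s : ℕ)}) := by
  intro n
  have key : v2 (Nat.card (ClassGroup (𝓞 (Fl (η * q * r * s) n)))) =
      v2 (Nat.card (ClassGroup (𝓞 (Qs (η * q * r * s))))) := by
    rcases hη with rfl | rfl
    · have H : Hyp q r s 1 := Hyp.of hq4 hr8 hs8 (Or.inl rfl) (by simpa using hqr) (by simpa using hqs) hrs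
      rw [one_mul] at hPell hfund ⊢
      refine H.main (t' := 2 * q) (Or.inl ⟨rfl, rfl, rfl⟩) (H.F0 (Or.inl ⟨rfl, rfl⟩) γ γ' hγ hγ' hPell hfund ?_) n
      rintro ⟨l, hl⟩
      have h1 : ((q : ℚ) * l) ^ 2 = ((2 * q * (γ - 1) : ℤ) : ℚ) := by
        push_cast; linear_combination -(q : ℚ) * hl
      obtain ⟨m, hm⟩ := rat_sq_int _ _ h1
      refine hnsq ⟨m, ?_⟩
      rw [hm] at h1
      have h2 : m ^ 2 = 2 * q * (γ - 1) := by exact_mod_cast h1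
      rw [h2]; simp
    · have H : Hyp q r s (-1) := Hyp.of hq4 hr8 hs8 (Or.inr rfl) (by simpa using hqr) (by simpa using hqs) hrs
      refine H.main (t' := q) (Or.inr ⟨rfl, rfl, rfl⟩) (H.F0 (Or.inr ⟨rfl, rfl⟩) γ γ' hγ hγ' hPell hfund ?_) n
      rintro ⟨l, hl⟩
      have h1 : ((q : ℚ) * l) ^ 2 = ((q * (γ - 1) : ℤ) : ℚ) := by
        push_cast at hl ⊢; linear_combination -(q : ℚ) / 2 * hl
      obtain ⟨m, hm⟩ := rat_sq_int _ _ h1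
      refine hnsq ⟨m, ?_⟩
      rw [hm] at h1
      have h2 : m ^ 2 = q * (γ - 1) := by exact_mod_cast h1
      rw [h2]; simp
  exact congrArg (fun k => 2 ^ k) key
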